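/- Let p be a prime number, r ≥ 1 an integer, and q = p^r. Let K be a function field of one variable over the algebraic closure Qbar of ℚ, let c ∈ K be non-constant, let f = X^q + C c ∈ K[X], and let β ∈ K. Fix an algebraic closure Ω of K, set K_0(β) = K and, for n ≥ 1, let K_n(β) be the intermediate field of Ω/K generated over K by all roots in Ω of f^n(X) − β. Then the following are equivalent: (1) β is neither periodic nor postcritical for f; (2) there exists N such that for all n ≥ N, the degree [K_n(β) : K_{n−1}(β)] equals q^(q^(n−1)). -/

import Mathlib

open Polynomial

/-- The `n`-th iterate of a polynomial under composition (`polyIter f 0 = X`). -/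
noncomputable def polyIter {K : Type*} [CommRing K] (f : K[X]) : ℕ → K[X]
  | 0 => X
  | n + 1 => f.comp (polyIter f n)

/-- `preimField K Ω f β n` is the intermediate field of `Ω/K` generated over `K` by all roots
in `Ω` of `f^n(X) - β`; for `n = 0` this is `K` itself. -/
noncomputable def preimField (K Ω : Type*) [Field K] [Field Ω] [Algebra K Ω]
    (f : K[X]) (β : K) (n : ℕ) : IntermediateField K Ω :=
  IntermediateField.adjoin K {x : Ω | Polynomial.aeval x (polyIter f n) = algebraMap K Ω β}

universe u
set_option linter.unusedSectionVars false

open TensorProduct in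
theorem deriv_ext_exists (E E' : Type*) [Field E] [Field E'] [Algebra E E'] [CharZero E]
    [Algebra.IsAlgebraic E E'] (D : Derivation ℤ E E) :
    ∃ D' : Derivation ℤ E' E', ∀ x, D' (algebraMap E E' x) = algebraMap E E' (D x) := by
  have : Algebra.FormallyEtale E E' := Algebra.FormallyEtale.of_isSeparable E E'
  let D1 : Derivation ℤ E E' := (Algebra.linearMap E E').compDer D
  let l : Ω[E⁄ℤ] →ₗ[E] E' := D1.liftKaehlerDifferential
  let l2 : E' ⊗[E] Ω[E⁄ℤ] →ₗ[E'] E' := l.liftBaseChange E'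
  refine ⟨(l2 ∘ₗ (KaehlerDifferential.tensorKaehlerEquivOfFormallyEtale ℤ E E').symm.toLinearMap).compDer
    (KaehlerDifferential.D ℤ E'), fun x => ?_⟩
  simp [KaehlerDifferential.tensorKaehlerEquivOfFormallyEtale_symm_D_algebraMap, l2, l, D1]

theorem deriv_aeval {F L : Type*} [Field F] [Field L] [Algebra F L]
    (D : Derivation ℤ F F) (DL : Derivation ℤ L L)
    (hL : ∀ x, DL (algebraMap F L x) = algebraMap F L (D x)) (x : L) (P : F[X]) :
    DL (aeval x P) = aeval x (P.sum fun n a => C (D a) * X ^ n) +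
      aeval x (derivative P) * DL x := by
  induction P using Polynomial.induction_on' with
  | add P Q hP hQ =>
    simp only [map_add, hP, hQ]
    rw [Polynomial.sum_add_index]
    · simp; ring
    · simp
    · intros; simp; ring
  | monomial n a =>
    rw [Polynomial.sum_monomial_index _ _ (by simp)]
    simp [aeval_monomial, hL, derivative_monomial]
    ring

theorem deriv_compat {F L M : Type*} [Field F] [Field L] [Field M] [Algebra F L] [Algebra F M]
    [CharZero F] [Algebra.IsAlgebraic F L] (D : Derivation ℤ F F) (DL : Derivation ℤ L L)
    (DC : Derivation ℤ M M) (hL : ∀ x, DL (algebraMap F L x) = algebraMap F L (D x))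
    (hC : ∀ x, DC (algebraMap F M x) = algebraMap F M (D x)) (σ : L →ₐ[F] M) (x : L) :
    DC (σ x) = σ (DL x) := by
  have hx : IsIntegral F x := Algebra.IsIntegral.isIntegral x
  have h1 := deriv_aeval D DL hL x (minpoly F x)
  have h2 := deriv_aeval D DC hC (σ x) (minpoly F x)
  rw [minpoly.aeval, map_zero] at h1
  rw [aeval_algHom_apply, minpoly.aeval, map_zero, map_zero, aeval_algHom_apply, aeval_algHom_apply] at h2
  have h3 := congrArg σ h1
  rw [map_zero, map_add, map_mul] at h3
  have hne : σ (aeval x (derivative (minpoly F x))) ≠ 0 := by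
    rw [Ne, map_eq_zero]
    exact (minpoly.irreducible hx).separable.aeval_derivative_ne_zero (minpoly.aeval F x)
  apply mul_left_cancel₀ hne
  linear_combination h3 - h2

/-- Complete field data attached to a nonarchimedean absolute value with bounded derivation. -/
theorem exists_completion (F : Type u) [Field F] (D : Derivation ℤ F F) (v : AbsoluteValue F ℝ)
    (hv : IsNonarchimedean v) (hnt : ∃ x, 1 < v x) (A : ℝ) (hA : ∀ x, v (D x) ≤ A * v x) :
    ∃ (B : Type u) (_ : NontriviallyNormedField B) (_ : CompleteSpace B) (_ : IsUltrametricDist B)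
      (φ : F →+* B) (DB : B →+ B), (∀ a b, DB (a * b) = a • DB b + b • DB a) ∧
      (∀ x, ‖φ x‖ = v x) ∧ DenseRange φ ∧
      (∀ x, DB (φ x) = φ (D x)) ∧ (∀ x, ‖DB x‖ ≤ A * ‖x‖) := by
  let φ0 : F →+* WithAbs v := (WithAbs.equiv v).symm.toRingHom
  let φ : F →+* v.Completion := (UniformSpace.Completion.coeRingHom).comp φ0
  have hφn : ∀ x, ‖φ x‖ = v x := by
    intro x
    simp only [φ, RingHom.comp_apply, UniformSpace.Completion.coeRingHom]
    exact (UniformSpace.Completion.norm_coe _).trans (WithAbs.norm_toAbs_eq v x)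
  have hdense : DenseRange φ := by
    have := UniformSpace.Completion.denseRange_coe (α := WithAbs v)
    have h2 : Function.Surjective φ0 := (WithAbs.equiv v).symm.surjective
    exact this.comp h2.denseRange (UniformSpace.Completion.continuous_coe _)
  have hAnn : ∀ x : F, v (D x) ≤ A * v x := hA
  let D0 : NormedAddGroupHom (WithAbs v) (WithAbs v) :=
    AddMonoidHom.mkNormedAddGroupHom
      ((φ0.toAddMonoidHom).comp ((D.toLinearMap.toAddMonoidHom).comp
        ((WithAbs.equiv v).toRingHom.toAddMonoidHom))) A (fun x => hA _)
  let D1 := D0.completion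
  have hD1 : ∀ x, D1 (φ x) = φ (D x) := by
    intro x
    exact NormedAddGroupHom.completion_coe D0 (φ0 x)
  have hleib : ∀ a b, D1 (a * b) = a • D1 b + b • D1 a := by
    intro a b
    induction a, b using UniformSpace.Completion.induction_on₂ with
    | hp =>
      apply isClosed_eq
      · exact D1.continuous.comp continuous_mul
      · simp only [smul_eq_mul]
        have := D1.continuous
        fun_prop
    | ih a b =>
      obtain ⟨a, rfl⟩ := (WithAbs.equiv v).symm.surjective a
      obtain ⟨b, rfl⟩ := (WithAbs.equiv v).symm.surjective b
      change D1 (φ a * φ b) = φ a • D1 (φ b) + φ b • D1 (φ a)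
      rw [← map_mul, hD1, hD1, hD1]
      simp
  have hus : IsUltrametricDist v.Completion := by
    apply IsUltrametricDist.isUltrametricDist_of_isNonarchimedean_norm
    intro x y
    induction x, y using UniformSpace.Completion.induction_on₂ with
    | hp =>
      apply isClosed_le <;> fun_prop
    | ih a b =>
      obtain ⟨a, rfl⟩ := (WithAbs.equiv v).symm.surjective a
      obtain ⟨b, rfl⟩ := (WithAbs.equiv v).symm.surjective b
      change ‖φ a + φ b‖ ≤ max ‖φ a‖ ‖φ b‖
      rw [← map_add, hφn, hφn, hφn]
      exact hv a b
  let nn : NontriviallyNormedField v.Completion :=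
    { (inferInstance : NormedField v.Completion) with
      non_trivial := by
        obtain ⟨x, hx⟩ := hnt
        exact ⟨φ x, by rw [hφn]; exact hx⟩ }
  refine ⟨v.Completion, nn, inferInstance, hus, φ,
    D1.toAddMonoidHom, hleib, hφn, hdense, hD1, ?_⟩
  intro x
  change ‖D1 x‖ ≤ A * ‖x‖
  induction x using UniformSpace.Completion.induction_on with
  | hp =>
    have := D1.continuous
    apply isClosed_le <;> fun_prop
  | ih a =>
    obtain ⟨a, rfl⟩ := (WithAbs.equiv v).symm.surjective a
    change ‖D1 (φ a)‖ ≤ A * ‖φ a‖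
    rw [hD1, hφn, hφn]
    exact hA a

/-- Local algebraically closed overfield with extended absolute value and derivation. -/
structure Frame (F : Type u) [Field F] (D : Derivation ℤ F F) (v : AbsoluteValue F ℝ) where
  C : Type u
  [fld : Field C]
  [alg : Algebra F C]
  [closed : IsAlgClosed C]
  w : AbsoluteValue C ℝ
  nonarch : IsNonarchimedean w
  ext : ∀ x, w (algebraMap F C x) = v x
  B : IntermediateField F C
  algB : Algebra.IsAlgebraic B C
  inv : ∀ (τ : C ≃ₐ[B] C) (x : C), w (τ x) = w x
  dense : ∀ x ∈ B, ∀ ε > 0, ∃ a : F, w (x - algebraMap F C a) < ε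
  DC : Derivation ℤ C C
  DC_ext : ∀ x, DC (algebraMap F C x) = algebraMap F C (D x)
  DC_bdd : ∀ L : IntermediateField B C, FiniteDimensional B L →
    ∃ A' > 0, ∀ x ∈ L, w (DC x) ≤ A' * w x
  DC_bddB : ∀ A, (∀ x, v (D x) ≤ A * v x) → ∀ x ∈ B, w (DC x) ≤ A * w x

attribute [instance] Frame.fld Frame.alg Frame.closed Frame.algB

theorem bdd_finite (B : Type u) [NontriviallyNormedField B] [CompleteSpace B] [IsUltrametricDist B]
    (C : Type u) [Field C] [Algebra B C] [Algebra.IsAlgebraic B C] (DB : Derivation ℤ B B) (A : ℝ)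
    (hDB : ∀ x, ‖DB x‖ ≤ A * ‖x‖)
    (DC : Derivation ℤ C C) (hDC : ∀ x, DC (algebraMap B C x) = algebraMap B C (DB x))
    (L : IntermediateField B C) [FiniteDimensional B L] :
    ∃ A' > 0, ∀ x ∈ L, spectralNorm B C (DC x) ≤ A' * spectralNorm B C x := by
  let _ : NormedField C := spectralNorm.normedField B C
  let _ : NormedAlgebra B C := spectralNorm.normedAlgebra B C
  have hn : ∀ x : C, ‖x‖ = spectralNorm B C x := fun x => rfl
  let b := Module.finBasis B L
  have hA0 : 0 ≤ A := by
    have := hDB 1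
    simp at this
    exact this
  have hcoord : ∀ i, ∃ M ≥ 0, ∀ x : L, ‖b.coord i x‖ ≤ M * ‖x‖ := by
    intro i
    let l : L →L[B] B := LinearMap.toContinuousLinearMap (b.coord i)
    exact ⟨‖l‖, norm_nonneg _, fun x => l.le_opNorm x⟩
  choose M hM0 hM using hcoord
  refine ⟨1 + ∑ i, (A * M i * ‖(b i : C)‖ + M i * ‖DC (b i : C)‖), ?_, ?_⟩
  · have : 0 ≤ ∑ i, (A * M i * ‖(b i : C)‖ + M i * ‖DC (b i : C)‖) := by
      apply Finset.sum_nonneg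
      intro i _
      have := hM0 i
      positivity
    linarith
  intro x hx
  rw [← hn, ← hn]
  have hrep : x = ∑ i, algebraMap B C (b.coord i ⟨x, hx⟩) * (b i : C) := by
    have := congrArg (fun y : L => (y : C)) (b.sum_repr ⟨x, hx⟩)
    simp only [IntermediateField.coe_sum, Algebra.smul_def] at this
    simpa [Algebra.smul_def] using this.symm
  have h1 : DC x = ∑ i, (algebraMap B C (DB (b.coord i ⟨x, hx⟩)) * (b i : C)
      + algebraMap B C (b.coord i ⟨x, hx⟩) * DC (b i : C)) := by
    conv_lhs => rw [hrep]
    rw [map_sum]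
    apply Finset.sum_congr rfl
    intro i _
    rw [Derivation.leibniz, hDC, smul_eq_mul, smul_eq_mul]
    ring
  rw [h1, add_mul, Finset.sum_mul]
  refine (norm_sum_le _ _).trans ?_
  refine le_trans (Finset.sum_le_sum (fun i _ => ?_)) (le_add_of_nonneg_left (by positivity))
  refine (norm_add_le _ _).trans ?_
  rw [norm_mul, norm_mul, norm_algebraMap', norm_algebraMap', add_mul]
  have e1 := hM i ⟨x, hx⟩
  have e1' : ‖b.coord i ⟨x, hx⟩‖ ≤ M i * ‖x‖ := e1
  have e2 := hDB (b.coord i ⟨x, hx⟩)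
  have e3 : ‖DB (b.coord i ⟨x, hx⟩)‖ ≤ A * (M i * ‖x‖) := e2.trans (by gcongr)
  apply add_le_add
  · calc _ ≤ (A * (M i * ‖x‖)) * ‖(b i : C)‖ := by gcongr
      _ = _ := by ring
  · calc _ ≤ (M i * ‖x‖) * ‖DC (b i : C)‖ := by gcongr
      _ = _ := by ring

theorem exists_frame (F : Type u) [Field F] [CharZero F] (D : Derivation ℤ F F)
    (v : AbsoluteValue F ℝ)
    (hv : IsNonarchimedean v) (hnt : ∃ x, 1 < v x) (A : ℝ) (hA : ∀ x, v (D x) ≤ A * v x) :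
    Nonempty (Frame F D v) := by
  obtain ⟨B, i1, i2, i3, φ, DB0, hleib, hφn, hd, hDφ, hDB⟩ := exists_completion F D v hv hnt A hA
  let DB : Derivation ℤ B B := Derivation.mk' DB0.toIntLinearMap hleib
  have hDB1 : ∀ x, DB x = DB0 x := fun x => rfl
  let _ : Algebra F B := φ.toAlgebra
  have hφa : ∀ x, algebraMap F B x = φ x := fun x => rfl
  have : CharZero B := charZero_of_injective_ringHom φ.injective
  let C := AlgebraicClosure B
  have : IsScalarTower F B C := inferInstance
  obtain ⟨DC, hDC⟩ := deriv_ext_exists B C DB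
  let w : AbsoluteValue C ℝ :=
    { toFun := spectralNorm B C
      map_mul' := fun x y => spectralAlgNorm_mul x y
      nonneg' := fun x => spectralNorm_nonneg x
      eq_zero' := fun x => (map_eq_zero_iff_eq_zero (spectralMulAlgNorm B C))
      add_le' := fun x y => isNonarchimedean_spectralNorm.add_le spectralNorm_nonneg }
  have hwd : ∀ x, w x = spectralNorm B C x := fun x => rfl
  have hwB : ∀ b : B, w (algebraMap B C b) = ‖b‖ := fun b => spectralNorm_extends b
  let B' : IntermediateField F C := (IsScalarTower.toAlgHom F B C).fieldRange
  have hB' : ∀ x, x ∈ B' ↔ ∃ b : B, algebraMap B C b = x := fun x => Iff.rfl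
  let e : B →+* B' := (algebraMap B C).codRestrict B'.toSubfield (fun x => ⟨x, rfl⟩)
  let _ : Algebra B B' := e.toAlgebra
  have : IsScalarTower B B' C := IsScalarTower.of_algebraMap_eq (fun x => rfl)
  have hes : Function.Surjective e := by
    rintro ⟨x, b, rfl⟩
    exact ⟨b, rfl⟩
  refine ⟨{ C := C, w := w, nonarch := isNonarchimedean_spectralNorm, ext := ?_, B := B', algB := ?_,
            inv := ?_, dense := ?_, DC := DC, DC_ext := ?_, DC_bdd := ?_, DC_bddB := ?_ }⟩
  · intro x
    rw [IsScalarTower.algebraMap_apply F B C, hwB, hφa, hφn]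
  · exact Algebra.IsAlgebraic.tower_top (K := B) B'
  · intro τ x
    exact (spectralNorm_eq_of_equiv (τ.restrictScalars B) x).symm
  · rintro _ ⟨b, rfl⟩ ε hε
    obtain ⟨a, ha⟩ := hd.exists_dist_lt b hε
    refine ⟨a, ?_⟩
    change w (algebraMap B C b - _) < _
    rw [IsScalarTower.algebraMap_apply F B C, ← map_sub, hwB, ← dist_eq_norm]
    exact ha
  · intro x
    rw [IsScalarTower.algebraMap_apply F B C, IsScalarTower.algebraMap_apply F B C, hDC]
    congr 1
    exact hDφ x
  · intro L hL
    let L' : IntermediateField B C := L.restrictScalars B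
    have hf : Module.Finite B B' := Module.Finite.of_surjective (Algebra.linearMap B B') hes
    have : FiniteDimensional B L' := by
      change FiniteDimensional B L
      exact Module.Finite.trans (R := B) B' L
    obtain ⟨A', hA', h⟩ := bdd_finite B C DB A hDB DC hDC L'
    exact ⟨A', hA', fun x hx => h x hx⟩
  · rintro A1 hA1 _ ⟨b, rfl⟩
    change w (DC (algebraMap B C b)) ≤ A1 * w (algebraMap B C b)
    rw [hDC, hwB, hwB]
    have hcont : Continuous DB0 := by
      refine AddMonoidHomClass.continuous_of_bound DB0 A hDB
    refine hd.induction_on (p := fun b => ‖DB0 b‖ ≤ A1 * ‖b‖) b ?_ ?_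
    · apply isClosed_le <;> fun_prop
    · intro a
      rw [hDφ, hφn, hφn]
      exact hA1 a

theorem exists_abs_ext {R F : Type*} [CommRing R] [IsDomain R] [Field F] [Algebra R F]
    [IsFractionRing R F] (N : AbsoluteValue R ℝ) (hN : IsNonarchimedean N) :
    ∃ v : AbsoluteValue F ℝ, IsNonarchimedean v ∧ ∀ P, v (algebraMap R F P) = N P := by
  let NV : Valuation R NNReal :=
    { toFun := fun x => (N x).toNNReal
      map_zero' := by simp
      map_one' := by simp
      map_mul' := fun x y => by rw [map_mul, Real.toNNReal_mul (N.nonneg x)]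
      map_add_le_max' := fun x y => by
        have h := hN x y
        rcases le_total (N x) (N y) with h1 | h1
        · rw [max_eq_right h1] at h
          exact le_max_of_le_right (Real.toNNReal_le_toNNReal h)
        · rw [max_eq_left h1] at h
          exact le_max_of_le_left (Real.toNNReal_le_toNNReal h) }
  have hNV : ∀ x, ((NV x : NNReal) : ℝ) = N x := fun x => Real.coe_toNNReal _ (N.nonneg x)
  have hS : nonZeroDivisors R ≤ NV.supp.primeCompl := by
    intro x hx hx2
    have : NV x = 0 := hx2
    have h2 : N x = 0 := by rw [← hNV, this]; rfl
    rw [N.eq_zero] at h2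
    exact nonZeroDivisors.ne_zero hx h2
  let V := NV.extendToLocalization hS F
  refine ⟨{ toFun := fun x => (V x : ℝ)
            map_mul' := fun x y => by simp
            nonneg' := fun x => NNReal.coe_nonneg _
            eq_zero' := fun x => by simp
            add_le' := fun x y => by
              have := V.map_add x y
              rw [← NNReal.coe_add, NNReal.coe_le_coe]
              exact this.trans (max_le (by simp) (by simp)) }, ?_, ?_⟩
  · intro x y
    have := V.map_add x y
    exact NNReal.coe_le_coe.2 this
  · intro P
    change ((NV.extendToLocalization hS F (algebraMap R F P) : NNReal) : ℝ) = N P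
    rw [Valuation.extendToLocalization_apply_map_apply, hNV]

theorem deriv_frac_exists (k F : Type*) [Field k] [Field F] [Algebra k[X] F] [IsFractionRing k[X] F] :
    ∃ D : Derivation ℤ F F, ∀ P, D (algebraMap k[X] F P) = algebraMap k[X] F (derivative P) := by
  have : Algebra.FormallyEtale k[X] F := Algebra.FormallyEtale.of_isLocalization (nonZeroDivisors k[X])
  let D0 : Derivation ℤ k[X] k[X] :=
    Derivation.mk' (derivative (R := k)).toAddMonoidHom.toIntLinearMap (fun a b => by
      change derivative (a * b) = a • derivative b + b • derivative a
      simp; ring)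
  let D1 : Derivation ℤ k[X] F := (Algebra.linearMap k[X] F).compDer D0
  let l := D1.liftKaehlerDifferential
  let l2 := l.liftBaseChange F
  refine ⟨(l2 ∘ₗ (KaehlerDifferential.tensorKaehlerEquivOfFormallyEtale ℤ k[X] F).symm.toLinearMap).compDer
    (KaehlerDifferential.D ℤ F), fun x => ?_⟩
  simp [KaehlerDifferential.tensorKaehlerEquivOfFormallyEtale_symm_D_algebraMap, l2, l, D1]
  rfl

theorem deriv_bound_frac {k F : Type*} [Field k] [Field F] [Algebra k[X] F] [IsFractionRing k[X] F]
    (D : Derivation ℤ F F) (hD : ∀ P, D (algebraMap k[X] F P) = algebraMap k[X] F (derivative P))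
    (v : AbsoluteValue F ℝ) (hv : IsNonarchimedean v) (A : ℝ)
    (hA : ∀ P : k[X], v (algebraMap k[X] F (derivative P)) ≤ A * v (algebraMap k[X] F P)) (x : F) :
    v (D x) ≤ A * v x := by
  obtain ⟨a, b, hb, rfl⟩ := IsFractionRing.div_surjective (A := k[X]) x
  have hb0 : algebraMap k[X] F b ≠ 0 := by
    simpa using nonZeroDivisors.ne_zero hb
  set P := algebraMap k[X] F a
  set Q := algebraMap k[X] F b
  have h1 : D (P / Q) = (D P * Q + -(P * D Q)) / Q ^ 2 := by
    have : D P = D (P / Q * Q) := by rw [div_mul_cancel₀ _ hb0]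
    rw [Derivation.leibniz, smul_eq_mul, smul_eq_mul] at this
    field_simp
    rw [this]
    field_simp
    ring
  have hQ : 0 < v Q := v.pos hb0
  rw [h1, map_div₀, map_div₀, map_pow, div_le_iff₀ (by positivity)]
  refine (hv _ _).trans ?_
  rw [map_neg_eq_map, map_mul, map_mul]
  have e1 : v (D P) ≤ A * v P := by rw [hD]; exact hA a
  have e2 : v (D Q) ≤ A * v Q := by rw [hD]; exact hA b
  have : A * (v P / v Q) * v Q ^ 2 = A * v P * v Q := by field_simp
  rw [this]
  apply max_le
  · gcongr
  · calc v P * v (D Q) ≤ v P * (A * v Q) := by gcongr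
      _ = _ := by ring

/-- order of vanishing absolute value at a point -/
theorem exists_ptN (k : Type*) [Field k] (a : k) :
    ∃ N : AbsoluteValue k[X] ℝ, IsNonarchimedean N ∧
      ∀ P, P ≠ 0 → N P = (1/2) ^ (rootMultiplicity a P) := by
  classical
  have key : ∀ x y : k[X], (if x + y = 0 then 0 else (1/2) ^ (rootMultiplicity a (x+y)) : ℝ) ≤
      max (if x = 0 then 0 else (1/2) ^ (rootMultiplicity a x))
        (if y = 0 then 0 else (1/2) ^ (rootMultiplicity a y)) := by
    intro x y
    by_cases hx : x = 0
    · simp [hx]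
    by_cases hy : y = 0
    · simp [hy]
    rw [if_neg hx, if_neg hy]
    split_ifs with h
    · positivity
    · have := rootMultiplicity_add (a := a) h
      rcases min_le_iff.1 this with h | h
      · exact le_max_of_le_left (pow_le_pow_of_le_one (by norm_num) (by norm_num) h)
      · exact le_max_of_le_right (pow_le_pow_of_le_one (by norm_num) (by norm_num) h)
  refine ⟨{ toFun := fun P => if P = 0 then 0 else (1/2) ^ (rootMultiplicity a P)
            map_mul' := ?_, nonneg' := ?_, eq_zero' := ?_, add_le' := ?_ }, key, ?_⟩
  · intro x y
    by_cases hx : x = 0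
    · simp [hx]
    by_cases hy : y = 0
    · simp [hy]
    simp [hx, hy, rootMultiplicity_mul (mul_ne_zero hx hy), pow_add]
  · intro x
    split_ifs <;> positivity
  · intro x
    simp
  · intro x y
    refine (key x y).trans (max_le ?_ ?_)
    · apply le_add_of_nonneg_right
      split_ifs <;> positivity
    · apply le_add_of_nonneg_left
      split_ifs <;> positivity
  · intro P hP
    change (if P = 0 then 0 else (1/2) ^ (rootMultiplicity a P) : ℝ) = _
    rw [if_neg hP]

theorem exists_inftyN (k : Type*) [Field k] :
    ∃ N : AbsoluteValue k[X] ℝ, IsNonarchimedean N ∧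
      ∀ P, P ≠ 0 → N P = 2 ^ (natDegree P) := by
  classical
  have key : ∀ x y : k[X], (if x + y = 0 then 0 else 2 ^ (natDegree (x+y)) : ℝ) ≤
      max (if x = 0 then 0 else 2 ^ (natDegree x))
        (if y = 0 then 0 else 2 ^ (natDegree y)) := by
    intro x y
    by_cases hx : x = 0
    · simp [hx]
    by_cases hy : y = 0
    · simp [hy]
    rw [if_neg hx, if_neg hy]
    split_ifs with h
    · positivity
    · have := natDegree_add_le x y
      rcases le_max_iff.1 this with h | h
      · exact le_max_of_le_left (pow_le_pow_right₀ (by norm_num) h)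
      · exact le_max_of_le_right (pow_le_pow_right₀ (by norm_num) h)
  refine ⟨{ toFun := fun P => if P = 0 then 0 else 2 ^ (natDegree P)
            map_mul' := ?_, nonneg' := ?_, eq_zero' := ?_, add_le' := ?_ }, key, ?_⟩
  · intro x y
    by_cases hx : x = 0
    · simp [hx]
    by_cases hy : y = 0
    · simp [hy]
    simp [hx, hy, natDegree_mul hx hy, pow_add]
  · intro x
    split_ifs <;> positivity
  · intro x
    simp
  · intro x y
    refine (key x y).trans (max_le ?_ ?_)
    · apply le_add_of_nonneg_right
      split_ifs <;> positivity
    · apply le_add_of_nonneg_left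
      split_ifs <;> positivity
  · intro P hP
    change (if P = 0 then 0 else 2 ^ (natDegree P) : ℝ) = _
    rw [if_neg hP]

theorem exists_gaussN (k : Type*) [Field k] (vk : AbsoluteValue k ℝ) (hvk : IsNonarchimedean vk) :
    ∃ N : AbsoluteValue k[X] ℝ, IsNonarchimedean N ∧
      (∀ P, ∃ i, N P = vk (P.coeff i)) ∧ (∀ P i, vk (P.coeff i) ≤ N P) := by
  have h1 := gaussNorm_isAbsoluteValue (v := vk) hvk (c := 1) one_pos
  have h2 := isNonarchimedean_gaussNorm (v := vk) hvk (c := 1) zero_le_one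
  refine ⟨⟨⟨fun P => P.gaussNorm vk 1, h1.abv_mul⟩, h1.abv_nonneg, fun x => h1.abv_eq_zero,
    h1.abv_add⟩, h2, ?_, ?_⟩
  · intro P
    obtain ⟨i, hi⟩ := exists_eq_gaussNorm vk 1 P
    exact ⟨i, by simpa using hi⟩
  · intro P i
    simpa using le_gaussNorm vk P zero_le_one i

section na
variable {C : Type*} [Field C] (w : AbsoluteValue C ℝ) (hw : IsNonarchimedean w)
include hw

theorem na_sub (x y : C) : w (x - y) ≤ max (w x) (w y) := by
  rw [sub_eq_add_neg]
  refine (hw x (-y)).trans ?_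
  rw [map_neg_eq_map]

theorem na_eq_of_lt {x y : C} (h : w (x - y) < w x) : w y = w x := by
  apply le_antisymm
  · have := na_sub w hw x (x - y)
    rw [sub_sub_cancel] at this
    exact this.trans (max_le le_rfl h.le)
  · have := hw (x - y) y
    rw [sub_add_cancel] at this
    rcases le_max_iff.1 this with h1 | h1
    · linarith
    · exact h1

theorem na_add_eq {x y : C} (h : w y < w x) : w (x + y) = w x := by
  apply na_eq_of_lt w hw
  simpa using h

theorem na_sum_le {ι : Type*} (s : Finset ι) (f : ι → C) (M : ℝ) (hM : 0 ≤ M)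
    (h : ∀ i ∈ s, w (f i) ≤ M) : w (∑ i ∈ s, f i) ≤ M := by
  classical
  induction s using Finset.induction_on with
  | empty => simpa using hM
  | insert a s ha ih =>
    rw [Finset.sum_insert ha]
    refine (hw _ _).trans (max_le (h a (by simp)) (ih fun i hi => h i (by simp [hi])))

theorem na_natCast_le (n : ℕ) : w n ≤ 1 := by
  induction n with
  | zero => simp
  | succ n ih =>
    push_cast
    exact (hw _ _).trans (max_le ih (by simp))

theorem na_sum_lt {ι : Type*} (s : Finset ι) (f : ι → C) (M : ℝ) (hM : 0 < M)
    (h : ∀ i ∈ s, w (f i) < M) : w (∑ i ∈ s, f i) < M := by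
  classical
  induction s using Finset.induction_on with
  | empty => simpa using hM
  | insert a s ha ih =>
    rw [Finset.sum_insert ha]
    refine (hw _ _).trans_lt (max_lt (h a (by simp)) (ih fun i hi => h i (by simp [hi])))

theorem na_coeff_le (S : Multiset C) (hS : ∀ y ∈ S, w y ≤ 1) (i : ℕ) :
    w (((S.map fun y => X - Polynomial.C y).prod).coeff i) ≤ 1 := by
  obtain ⟨N, hN, hN1, hN2⟩ := exists_gaussN C w hw
  refine (hN2 _ i).trans ?_
  induction S using Multiset.induction_on with
  | empty => simp
  | cons a S ih =>
    rw [Multiset.map_cons, Multiset.prod_cons, map_mul]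
    refine mul_le_one₀ ?_ (N.nonneg _) (ih fun y hy => hS y (by simp [hy]))
    obtain ⟨j, hj⟩ := hN1 (X - Polynomial.C a)
    rw [hj, coeff_sub, coeff_X, coeff_C]
    refine (na_sub w hw _ _).trans (max_le ?_ ?_)
    · split_ifs <;> simp
    · split_ifs
      · exact hS a (by simp)
      · simp

theorem na_root_le (P : C[X]) (hP : P.Monic) (hc : ∀ i, w (P.coeff i) ≤ 1) (x : C)
    (hx : P.eval x = 0) : w x ≤ 1 := by
  by_contra! hlt
  have hd : P.natDegree ≠ 0 := by
    intro h0
    rw [hP.natDegree_eq_zero.1 h0] at hx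
    simp at hx
  rw [eval_eq_sum_range, Finset.sum_range_succ, hP.coeff_natDegree, one_mul] at hx
  have h1 : x ^ P.natDegree = - ∑ i ∈ Finset.range P.natDegree, P.coeff i * x ^ i := by
    linear_combination hx
  have h2 : w (x ^ P.natDegree) ≤ w x ^ (P.natDegree - 1) := by
    rw [h1, map_neg_eq_map]
    apply na_sum_le w hw _ _ _ (by positivity)
    intro i hi
    rw [map_mul, map_pow]
    have : i ≤ P.natDegree - 1 := by have := Finset.mem_range.1 hi; omega
    calc _ ≤ 1 * w x ^ i := by gcongr; exact hc i
      _ ≤ _ := by rw [one_mul]; exact pow_le_pow_right₀ hlt.le this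
  rw [map_pow] at h2
  have h3 : w x ^ (P.natDegree - 1) < w x ^ P.natDegree := pow_lt_pow_right₀ hlt (by omega)
  linarith
end na

section frame
variable {F : Type u} [Field F] {D : Derivation ℤ F F} {v : AbsoluteValue F ℝ} (fr : Frame F D v)
include fr

instance Frame.isAlgClosure : IsAlgClosure fr.B fr.C := ⟨fr.closed, fr.algB⟩

instance Frame.normal : Normal fr.B fr.C := IsAlgClosure.normal fr.B fr.C

theorem Frame.val_B {x : fr.C} (hx : x ∈ fr.B) (h0 : x ≠ 0) : ∃ a : F, a ≠ 0 ∧ fr.w x = v a := by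
  obtain ⟨a, ha⟩ := fr.dense x hx (fr.w x) (fr.w.pos h0)
  have h1 := na_eq_of_lt fr.w fr.nonarch ha
  rw [fr.ext] at h1
  refine ⟨a, ?_, h1.symm⟩
  rintro rfl
  rw [map_zero] at h1
  exact h0 (fr.w.eq_zero.1 h1.symm)

theorem Frame.charZero [CharZero F] : CharZero fr.C :=
  charZero_of_injective_ringHom (algebraMap F fr.C).injective

theorem Frame.mem_B [CharZero F] {x : fr.C} (h : ∀ τ : fr.C ≃ₐ[fr.B] fr.C, τ x = x) : x ∈ fr.B := by
  have := fr.charZero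
  have : IsGalois fr.B fr.C := ⟨⟩
  obtain ⟨b, hb⟩ := (InfiniteGalois.mem_bot_iff_fixed x).2 h
  rw [← hb]
  exact b.2

theorem Frame.coeff_le [CharZero F] (x : fr.C) (hx : fr.w x ≤ 1) (i : ℕ) :
    fr.w ((minpoly fr.B x).coeff i : fr.C) ≤ 1 := by
  have hs : ((minpoly fr.B x).map (algebraMap fr.B fr.C)).Splits := IsAlgClosed.splits _
  have hm : ((minpoly fr.B x).map (algebraMap fr.B fr.C)).Monic :=
    (minpoly.monic (Algebra.IsIntegral.isIntegral x)).map _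
  have h1 := hs.eq_prod_roots_of_monic hm
  have h2 : ((minpoly fr.B x).coeff i : fr.C) =
    ((minpoly fr.B x).map (algebraMap fr.B fr.C)).coeff i := by rw [coeff_map]; rfl
  rw [h2, h1]
  apply na_coeff_le fr.w fr.nonarch
  intro y hy
  rw [mem_roots hm.ne_zero, IsRoot.def, eval_map_algebraMap] at hy
  have hc : IsConjRoot fr.B x y := by
    rw [isConjRoot_iff_aeval_eq_zero (Algebra.IsIntegral.isIntegral x)]
    exact hy
  obtain ⟨τ, hτ⟩ := (isConjRoot_iff_exists_algEquiv).1 hc.symm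
  rw [← hτ, fr.inv]
  exact hx
end frame

section places
variable (k : Type*) (F : Type u) [Field k] [CharZero k] [Field F] [CharZero F] [Algebra k[X] F]
  [IsFractionRing k[X] F]

/-- the derivation d/dX on the function field -/
noncomputable def dF : Derivation ℤ F F := (deriv_frac_exists k F).choose

/-- constants -/
noncomputable def kF : k →+* F := (algebraMap k[X] F).comp Polynomial.C

theorem dF_poly (P : k[X]) : dF k F (algebraMap k[X] F P) = algebraMap k[X] F (derivative P) :=
  (deriv_frac_exists k F).choose_spec P

theorem dF_const (a : k) : dF k F (kF k F a) = 0 := by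
  simp [kF, dF_poly]

/-- absolute value at infinity -/
noncomputable def vinf : AbsoluteValue F ℝ :=
  (exists_abs_ext (F := F) (exists_inftyN k).choose (exists_inftyN k).choose_spec.1).choose

theorem vinf_na : IsNonarchimedean (vinf k F) :=
  (exists_abs_ext (F := F) (exists_inftyN k).choose (exists_inftyN k).choose_spec.1).choose_spec.1

theorem vinf_poly (P : k[X]) (hP : P ≠ 0) : vinf k F (algebraMap k[X] F P) = 2 ^ P.natDegree := by
  rw [vinf, (exists_abs_ext (F := F) (exists_inftyN k).choose
    (exists_inftyN k).choose_spec.1).choose_spec.2, (exists_inftyN k).choose_spec.2 P hP]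

theorem vinf_deriv (x : F) : vinf k F (dF k F x) ≤ 1 * vinf k F x := by
  apply deriv_bound_frac (dF k F) (dF_poly k F) _ (vinf_na k F)
  intro P
  by_cases hP : P = 0
  · simp [hP]
  by_cases hP' : derivative P = 0
  · simp [hP']
  rw [vinf_poly _ _ _ hP, vinf_poly _ _ _ hP', one_mul]
  apply pow_le_pow_right₀ (by norm_num)
  exact (natDegree_derivative_le P).trans (by omega)

variable {k}
/-- absolute value at a finite point -/
noncomputable def vpt (a : k) : AbsoluteValue F ℝ :=
  (exists_abs_ext (F := F) (exists_ptN k a).choose (exists_ptN k a).choose_spec.1).choose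

variable (a : k)
theorem vpt_na : IsNonarchimedean (vpt F a) :=
  (exists_abs_ext (F := F) (exists_ptN k a).choose (exists_ptN k a).choose_spec.1).choose_spec.1

theorem vpt_poly (P : k[X]) (hP : P ≠ 0) :
    vpt F a (algebraMap k[X] F P) = (1/2) ^ rootMultiplicity a P := by
  rw [vpt, (exists_abs_ext (F := F) (exists_ptN k a).choose
    (exists_ptN k a).choose_spec.1).choose_spec.2, (exists_ptN k a).choose_spec.2 P hP]

theorem vpt_poly_le (P : k[X]) : vpt F a (algebraMap k[X] F P) ≤ 1 := by
  by_cases hP : P = 0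
  · simp [hP]
  rw [vpt_poly _ _ _ hP]
  exact pow_le_one₀ (by norm_num) (by norm_num)

theorem vpt_poly_eq (P : k[X]) (h : P.eval a ≠ 0) : vpt F a (algebraMap k[X] F P) = 1 := by
  have hP : P ≠ 0 := by rintro rfl; simp at h
  rw [vpt_poly _ _ _ hP, rootMultiplicity_eq_zero (by simpa using h)]
  simp

theorem vpt_poly_lt (P : k[X]) (h : P.eval a = 0) : vpt F a (algebraMap k[X] F P) < 1 := by
  by_cases hP : P = 0
  · simp [hP]
  rw [vpt_poly _ _ _ hP]
  apply pow_lt_one₀ (by norm_num) (by norm_num)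
  exact ((rootMultiplicity_pos hP).2 h).ne'

theorem vpt_const (b : k) (hb : b ≠ 0) : vpt F a (kF k F b) = 1 := by
  apply vpt_poly_eq
  simpa using hb

theorem vpt_X_sub : vpt F a (algebraMap k[X] F (X - C a)) = 1/2 := by
  rw [vpt_poly _ _ _ (X_sub_C_ne_zero a), rootMultiplicity_X_sub_C_self]
  simp

theorem vpt_deriv (x : F) : vpt F a (dF k F x) ≤ 2 * vpt F a x := by
  apply deriv_bound_frac (dF k F) (dF_poly k F) _ (vpt_na F a)
  intro P
  by_cases hP : P = 0
  · simp [hP]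
  by_cases hP' : derivative P = 0
  · simp [hP']
  rw [vpt_poly _ _ _ hP, vpt_poly _ _ _ hP']
  have := rootMultiplicity_sub_one_le_derivative_rootMultiplicity P a
  calc ((1:ℝ)/2) ^ rootMultiplicity a (derivative P) ≤ (1/2) ^ (rootMultiplicity a P - 1) :=
        pow_le_pow_of_le_one (by norm_num) (by norm_num) this
    _ ≤ 2 * (1/2) ^ (rootMultiplicity a P) := by
      rcases Nat.eq_zero_or_pos (rootMultiplicity a P) with h | h
      · rw [h]; norm_num
      · obtain ⟨m, hm⟩ := Nat.exists_eq_succ_of_ne_zero h.ne'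
        rw [hm, Nat.succ_sub_one, pow_succ]
        linarith

theorem vpt_val (x : F) (hx : x ≠ 0) : ∃ n : ℤ, vpt F a x = 2 ^ n := by
  obtain ⟨P, Q, hQ, rfl⟩ := IsFractionRing.div_surjective (A := k[X]) x
  have hQ0 : Q ≠ 0 := nonZeroDivisors.ne_zero hQ
  have hP0 : P ≠ 0 := by rintro rfl; simp at hx
  rw [map_div₀, vpt_poly _ _ _ hP0, vpt_poly _ _ _ hQ0]
  refine ⟨(rootMultiplicity a Q : ℤ) - rootMultiplicity a P, ?_⟩
  rw [zpow_sub₀ (by norm_num)]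
  simp
  field_simp

theorem frac_reduced (x : F) : ∃ P Q : k[X], Q ≠ 0 ∧ IsCoprime P Q ∧
    x = algebraMap k[X] F P / algebraMap k[X] F Q := by
  obtain ⟨P, Q, h, hx⟩ := IsFractionRing.exists_reduced_fraction k[X] x
  refine ⟨P, Q, nonZeroDivisors.ne_zero Q.2, h.isCoprime, ?_⟩
  rw [← hx, IsFractionRing.mk'_eq_div]

theorem vpt_le_one_frac (P Q : k[X]) (hPQ : IsCoprime P Q)
    (h : vpt F a (algebraMap k[X] F P / algebraMap k[X] F Q) ≤ 1) (hQ0 : Q ≠ 0) : Q.eval a ≠ 0 := by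
  intro hQ
  have hP : P.eval a ≠ 0 := by
    intro hP
    obtain ⟨u, v, huv⟩ := hPQ
    have := congrArg (eval a) huv
    simp [hP, hQ] at this
  rw [map_div₀, vpt_poly_eq _ _ _ hP] at h
  have h2 := vpt_poly_lt F a Q hQ
  have h3 : 0 < vpt F a (algebraMap k[X] F Q) := (vpt F a).pos (by simpa using hQ0)
  rw [div_le_one h3] at h
  linarith

theorem vpt_res (x : F) (hx : vpt F a x ≤ 1) : ∃ b : k, vpt F a (x - kF k F b) < 1 := by
  obtain ⟨P, Q, hQ0, hPQ, rfl⟩ := frac_reduced (k := k) F x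
  have hQ := vpt_le_one_frac F a P Q hPQ hx hQ0
  refine ⟨P.eval a / Q.eval a, ?_⟩
  have h1 : algebraMap k[X] F P / algebraMap k[X] F Q - kF k F (P.eval a / Q.eval a) =
      algebraMap k[X] F (P - C (P.eval a / Q.eval a) * Q) / algebraMap k[X] F Q := by
    have : algebraMap k[X] F Q ≠ 0 := by simpa using hQ0
    rw [map_sub, map_mul]
    field_simp
    rfl
  rw [h1, map_div₀, vpt_poly_eq F a Q hQ, div_one]
  apply vpt_poly_lt
  simp
  field_simp
  ring

theorem vpt_deriv_int (x : F) (hx : vpt F a x ≤ 1) : vpt F a (dF k F x) ≤ 1 := by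
  obtain ⟨P, Q, hQ0, hPQ, rfl⟩ := frac_reduced (k := k) F x
  have hQ := vpt_le_one_frac F a P Q hPQ hx hQ0
  have hQF : algebraMap k[X] F Q ≠ 0 := by simpa using hQ0
  have h1 : dF k F (algebraMap k[X] F P / algebraMap k[X] F Q) =
      algebraMap k[X] F (derivative P * Q - P * derivative Q) / algebraMap k[X] F Q ^ 2 := by
    have : dF k F (algebraMap k[X] F P) =
        dF k F (algebraMap k[X] F P / algebraMap k[X] F Q * algebraMap k[X] F Q) := by
      rw [div_mul_cancel₀ _ hQF]
    rw [Derivation.leibniz, smul_eq_mul, smul_eq_mul, dF_poly, dF_poly] at this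
    rw [map_sub, map_mul, map_mul, this]
    field_simp
    ring
  rw [h1, map_div₀, map_pow, vpt_poly_eq F a Q hQ, one_pow, div_one]
  exact vpt_poly_le F a _

theorem vpt_all_le [IsAlgClosed k] (x : F) (hx : ∀ a : k, vpt F a x ≤ 1) :
    ∃ P : k[X], x = algebraMap k[X] F P := by
  obtain ⟨P, Q, hQ0, hPQ, rfl⟩ := frac_reduced (k := k) F x
  have hQ : ∀ a, Q.eval a ≠ 0 := fun a => vpt_le_one_frac F a P Q hPQ (hx a) hQ0
  have hd : Q.degree = 0 := by
    by_contra h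
    obtain ⟨a, ha⟩ := IsAlgClosed.exists_root Q h
    exact hQ a ha
  rw [eq_C_of_degree_eq_zero hd] at hQ0 ⊢
  have hq : Q.coeff 0 ≠ 0 := by simpa using hQ0
  refine ⟨P * C (Q.coeff 0)⁻¹, ?_⟩
  have h3 : algebraMap k[X] F (C (Q.coeff 0)) ≠ 0 := by simpa using hq
  rw [div_eq_iff h3, ← map_mul, mul_assoc, ← C_mul, inv_mul_cancel₀ hq]
  simp

/-- an element of `F` is integral at all but finitely many points -/
theorem vpt_fin (x : F) : ∃ S : Finset k, ∀ a ∉ S, vpt F a x ≤ 1 := by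
  classical
  obtain ⟨P, Q, hQ0, hPQ, rfl⟩ := frac_reduced (k := k) F x
  refine ⟨Q.roots.toFinset, fun a ha => ?_⟩
  have : Q.eval a ≠ 0 := by
    intro h
    apply ha
    simp [hQ0, h]
  rw [map_div₀, vpt_poly_eq F a Q this, div_one]
  exact vpt_poly_le F a P

variable (k) in
theorem exists_frInf : Nonempty (Frame F (dF k F) (vinf k F)) := by
  refine exists_frame F _ _ (vinf_na k F) ⟨algebraMap k[X] F X, ?_⟩ 1 (vinf_deriv k F)
  rw [vinf_poly _ _ _ X_ne_zero]
  norm_num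

theorem exists_frPt : Nonempty (Frame F (dF k F) (vpt F a)) := by
  refine exists_frame F _ _ (vpt_na F a) ⟨(algebraMap k[X] F (X - C a))⁻¹, ?_⟩ 2 (vpt_deriv F a)
  rw [map_inv₀, vpt_X_sub]
  norm_num

variable (k) in
/-- frame at infinity -/
noncomputable def frInf : Frame F (dF k F) (vinf k F) := (exists_frInf k F).some
/-- frame at a finite point -/
noncomputable def frPt : Frame F (dF k F) (vpt F a) := (exists_frPt F a).some

theorem frPt_val {x : (frPt F a).C} (hx : x ∈ (frPt F a).B) (h0 : x ≠ 0) :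
    ∃ n : ℤ, (frPt F a).w x = 2 ^ n := by
  obtain ⟨b, hb, h⟩ := (frPt F a).val_B hx h0
  rw [h]
  exact vpt_val F a b hb

theorem frPt_deriv_int {x : (frPt F a).C} (hx : x ∈ (frPt F a).B) (h : (frPt F a).w x ≤ 1) :
    (frPt F a).w ((frPt F a).DC x) ≤ 1 := by
  obtain ⟨b, hb⟩ := (frPt F a).dense x hx (1/2) (by norm_num)
  have h1 : vpt F a b ≤ 1 := by
    rw [← (frPt F a).ext]
    have := na_sub _ (frPt F a).nonarch x (x - algebraMap F _ b)
    rw [sub_sub_cancel] at this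
    exact this.trans (max_le h (by linarith))
  have h2 : x = (x - algebraMap F _ b) + algebraMap F _ b := by ring
  rw [h2, map_add, (frPt F a).DC_ext]
  refine ((frPt F a).nonarch _ _).trans (max_le ?_ ?_)
  · refine ((frPt F a).DC_bddB 2 (vpt_deriv F a) _ (sub_mem hx ((frPt F a).B.algebraMap_mem b))).trans ?_
    linarith
  · rw [(frPt F a).ext]
    exact vpt_deriv_int F a b h1

theorem frame_res [IsAlgClosed k] (fr : Frame F (dF k F) (vpt F a)) (x : fr.C) (h : fr.w x ≤ 1) :
    ∃ b : k, fr.w (x - algebraMap F _ (kF k F b)) < 1 := by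
  set m := minpoly fr.B x
  have hm : m.Monic := minpoly.monic (Algebra.IsIntegral.isIntegral x)
  have hres : ∀ i, ∃ b : k, fr.w ((m.coeff i : fr.C) - algebraMap F _ (kF k F b)) < 1 := by
    intro i
    have h1 := fr.coeff_le x h i
    obtain ⟨c, hc⟩ := fr.dense (m.coeff i : fr.C) (m.coeff i).2 1 one_pos
    have h2 : vpt F a c ≤ 1 := by
      rw [← fr.ext]
      have := na_sub _ fr.nonarch (m.coeff i : fr.C) ((m.coeff i : fr.C) - algebraMap F _ c)
      rw [sub_sub_cancel] at this
      exact this.trans (max_le h1 hc.le)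
    obtain ⟨b, hb⟩ := vpt_res F a c h2
    refine ⟨b, ?_⟩
    have e : (m.coeff i : fr.C) - algebraMap F _ (kF k F b) =
      ((m.coeff i : fr.C) - algebraMap F _ c) + algebraMap F _ (c - kF k F b) := by
      rw [map_sub]; ring
    rw [e]
    refine (fr.nonarch _ _).trans_lt (max_lt hc ?_)
    rw [fr.ext]; exact hb
  choose b hb using hres
  let κ : k →+* fr.C := (algebraMap F fr.C).comp (kF k F)
  let g : k[X] := X ^ m.natDegree + ∑ i ∈ Finset.range m.natDegree, C (b i) * X ^ i
  have hdeg : (∑ i ∈ Finset.range m.natDegree, C (b i) * X ^ i : k[X]).degree < (m.natDegree : WithBot ℕ) := by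
    refine (degree_sum_le _ _).trans_lt ?_
    rw [Finset.sup_lt_iff (by exact_mod_cast WithBot.bot_lt_coe _)]
    intro i hi
    exact (degree_C_mul_X_pow_le i (b i)).trans_lt (by exact_mod_cast Finset.mem_range.1 hi)
  have hg : g.Monic := monic_X_pow_add hdeg
  have hgx : fr.w (g.eval₂ κ x) < 1 := by
    have h0 : (m.map (algebraMap fr.B fr.C)).eval x = 0 := by
      rw [eval_map_algebraMap]; exact minpoly.aeval _ _
    rw [eval_map, eval₂_eq_sum_range, Finset.sum_range_succ, hm.coeff_natDegree, map_one, one_mul] at h0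
    have h1 : g.eval₂ κ x = - ∑ i ∈ Finset.range m.natDegree, ((m.coeff i : fr.C) - κ (b i)) * x ^ i := by
      simp only [g, eval₂_add, eval₂_pow, eval₂_X, eval₂_finsetSum, eval₂_mul, eval₂_C, sub_mul,
        Finset.sum_sub_distrib]
      have : ∑ i ∈ Finset.range m.natDegree, algebraMap fr.B fr.C (m.coeff i) * x ^ i =
        ∑ i ∈ Finset.range m.natDegree, (m.coeff i : fr.C) * x ^ i := rfl
      linear_combination h0 - this
    rw [h1, map_neg_eq_map]
    apply na_sum_lt fr.w fr.nonarch _ _ _ one_pos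
    intro i _
    rw [map_mul, map_pow]
    calc _ ≤ fr.w ((m.coeff i : fr.C) - κ (b i)) * 1 := by
          gcongr; exact pow_le_one₀ (fr.w.nonneg _) h
      _ < 1 := by rw [mul_one]; exact hb i
  have hs : g = (g.roots.map fun r => X - C r).prod :=
    (IsAlgClosed.splits g).eq_prod_roots_of_monic hg
  by_contra! hall
  rw [hs, eval₂_multiset_prod, Multiset.map_map, map_multiset_prod, Multiset.map_map] at hgx
  refine absurd hgx (not_lt.2 ?_)
  apply Multiset.one_le_prod
  intro y hy
  obtain ⟨r, _, rfl⟩ := Multiset.mem_map.1 hy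
  simpa [κ] using hall r

theorem frPt_res [IsAlgClosed k] (x : (frPt F a).C) (h : (frPt F a).w x ≤ 1) :
    ∃ b : k, (frPt F a).w (x - algebraMap F _ (kF k F b)) < 1 := frame_res F a _ x h

theorem frPt_mem [IsAlgClosed k] (x : (frPt F a).C) (h : (frPt F a).w x ≤ 1)
    (hτ : ∀ τ : (frPt F a).C ≃ₐ[(frPt F a).B] (frPt F a).C, (frPt F a).w (x - τ x) < 1 → τ x = x) :
    x ∈ (frPt F a).B := by
  obtain ⟨b, hb⟩ := frPt_res F a x h
  apply Frame.mem_B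
  intro τ
  apply hτ
  set z := algebraMap F (frPt F a).C (kF k F b) with hz
  have h1 : τ z = z := by
    have : z = algebraMap (frPt F a).B (frPt F a).C (algebraMap F (frPt F a).B (kF k F b)) := rfl
    rw [this, AlgEquiv.commutes]
  have h2 : (frPt F a).w (τ x - z) < 1 := by
    rw [← (frPt F a).inv τ, map_sub, h1] at hb
    exact hb
  have h3 : x - τ x = (x - z) - (τ x - z) := by ring
  rw [h3]
  exact (na_sub _ (frPt F a).nonarch _ _).trans_lt (max_lt hb h2)
end places

theorem exists_gaussR (k : Type*) [Field k] (vk : AbsoluteValue k ℝ) (hvk : IsNonarchimedean vk)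
    (ρ : ℝ) (hρ : 0 < ρ) :
    ∃ N : AbsoluteValue k[X] ℝ, IsNonarchimedean N ∧ (∀ P i, vk (P.coeff i) * ρ ^ i ≤ N P) ∧
      (∀ a, N (Polynomial.C a) ≤ vk a) ∧ N X ≤ ρ := by
  have := gaussNorm_isAbsoluteValue hvk (c := ρ) hρ
  let N : AbsoluteValue k[X] ℝ := IsAbsoluteValue.toAbsoluteValue (gaussNorm vk ρ)
  refine ⟨N, isNonarchimedean_gaussNorm (v := vk) hvk hρ.le, fun P i => le_gaussNorm vk P hρ.le i, ?_, ?_⟩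
  · intro a
    obtain ⟨i, hi⟩ := exists_eq_gaussNorm vk ρ (Polynomial.C a)
    change gaussNorm vk ρ (Polynomial.C a) ≤ _
    rw [hi, coeff_C]
    split_ifs with h
    · simp [h]
    · simp
  · obtain ⟨i, hi⟩ := exists_eq_gaussNorm vk ρ (X : k[X])
    change gaussNorm vk ρ X ≤ _
    rw [hi, coeff_X]
    split_ifs with h
    · simp [← h]
    · simpa using hρ.le

theorem na_natCast_coprime {C : Type*} [Field C] (w : AbsoluteValue C ℝ) (hw : IsNonarchimedean w)
    (p d : ℕ) (hp : w p < 1) (h : Nat.Coprime d p) : w (d : C) = 1 := by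
  apply le_antisymm (na_natCast_le w hw d)
  have hb := Nat.gcd_eq_gcd_ab d p
  rw [h] at hb
  have hb' : (1 : C) = d * (Nat.gcdA d p : ℤ) + p * (Nat.gcdB d p : ℤ) := by exact_mod_cast congrArg (Int.cast : ℤ → C) hb
  have hIntg : ∀ z : ℤ, w (z : C) ≤ 1 := by
    intro z
    rcases Int.eq_nat_or_neg z with ⟨n, rfl | rfl⟩
    · simpa using na_natCast_le w hw n
    · simpa using na_natCast_le w hw n
  by_contra! hlt
  have : w (1 : C) < 1 := by
    rw [hb']
    refine (hw _ _).trans_lt (max_lt ?_ ?_)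
    · rw [map_mul]; exact (mul_le_of_le_one_right (w.nonneg _) (hIntg _)).trans_lt hlt
    · rw [map_mul]; exact (mul_le_of_le_one_right (w.nonneg _) (hIntg _)).trans_lt hp
  simp at this

theorem na_pow_sub_le {C : Type*} [Field C] (w : AbsoluteValue C ℝ) (hw : IsNonarchimedean w)
    (x y : C) (hx : w x ≤ 1) (hy : w y ≤ 1) (n : ℕ) : w (x ^ n - y ^ n) ≤ w (x - y) := by
  rw [← Commute.geom_sum₂_mul (Commute.all x y), map_mul]
  refine mul_le_of_le_one_left (w.nonneg _) (na_sum_le w hw _ _ 1 zero_le_one fun i _ => ?_)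
  rw [map_mul, map_pow, map_pow]
  exact mul_le_one₀ (pow_le_one₀ (w.nonneg _) hx) (pow_nonneg (w.nonneg _) _) (pow_le_one₀ (w.nonneg _) hy)

theorem na_sub' {R : Type*} [CommRing R] (w : AbsoluteValue R ℝ) (hw : IsNonarchimedean w)
    (x y : R) : w (x - y) ≤ max (w x) (w y) := by
  rw [sub_eq_add_neg]
  refine (hw x (-y)).trans ?_
  rw [map_neg_eq_map]

section step
variable {E M : Type*} [Field E] [Field M] [Algebra E M] [Algebra.IsAlgebraic E M] [IsAlgClosed M]
  [CharZero M]
  (w : AbsoluteValue M ℝ) (hw : IsNonarchimedean w) (inv : ∀ (τ : M ≃ₐ[E] M) x, w (τ x) = w x)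
  (p : ℕ) (hp : p.Prime) (hp1 : w p < 1)
  (hζ : ∀ ζ : M, ζ ^ p = 1 → ∃ e : E, algebraMap E M e = ζ)

theorem step_fix (x θ : M) (h : ∀ τ : M ≃ₐ[E] M, τ θ = θ → τ x = x) :
    x ∈ IntermediateField.adjoin E {θ} := by
  have hc : CharZero E := (RingHom.charZero_iff (algebraMap E M).injective).2 inferInstance
  have : IsAlgClosure E M := ⟨inferInstance, inferInstance⟩
  have : Normal E M := IsAlgClosure.normal E M
  have : IsGalois E M := ⟨⟩
  let L := IntermediateField.adjoin E {θ}
  have : Algebra.IsAlgebraic L M := Algebra.IsAlgebraic.tower_top (K := E) L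
  have : IsGalois L M := inferInstance
  obtain ⟨b, hb⟩ := (InfiniteGalois.mem_bot_iff_fixed (k := L) x).2 (fun τ => by
    refine h (τ.restrictScalars E) ?_
    exact τ.commutes ⟨θ, IntermediateField.mem_adjoin_simple_self E θ⟩)
  rw [← hb]
  exact b.2

theorem step_conj (x y : M) (h : (minpoly E x).aeval y = 0) : ∃ τ : M ≃ₐ[E] M, τ x = y := by
  have : IsAlgClosure E M := ⟨inferInstance, inferInstance⟩
  have : Normal E M := IsAlgClosure.normal E M
  have := minpoly.eq_of_root (Algebra.IsAlgebraic.isAlgebraic x) h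
  obtain ⟨τ, hτ⟩ := (Normal.minpoly_eq_iff_mem_orbit (F := E) M).1 this
  exact ⟨τ, hτ⟩

include hp hζ in
theorem step_irr (x : M) (b : E) (hx : x ^ p = algebraMap E M b) (hnx : ∀ e : E, algebraMap E M e ≠ x) :
    minpoly E x = X ^ p - Polynomial.C b := by
  symm
  refine minpoly.eq_of_irreducible_of_monic ?_ ?_ (monic_X_pow_sub_C b hp.ne_zero)
  · refine X_pow_sub_C_irreducible_of_prime hp ?_
    intro e he
    have hx0 : x ≠ 0 := fun h => hnx 0 (by simp [h])
    have h1 : (algebraMap E M e / x) ^ p = 1 := by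
      rw [div_pow, hx, ← map_pow, he, div_self]
      rw [← hx]; exact pow_ne_zero _ hx0
    obtain ⟨z, hz⟩ := hζ _ h1
    have hz0 : z ≠ 0 := by
      rintro rfl
      rw [← hz, map_zero, zero_pow hp.ne_zero] at h1
      exact zero_ne_one h1
    apply hnx (e / z)
    rw [map_div₀, hz]
    have : algebraMap E M e ≠ 0 := by
      intro h; rw [h, zero_div, zero_pow hp.ne_zero] at h1; exact zero_ne_one h1
    field_simp
  · simp [hx]

include hw inv hp hp1 hζ in
theorem step_far (x : M) (b : E) (hx : x ^ p = algebraMap E M b)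
    (hnx : ∀ e : E, algebraMap E M e ≠ x) (δ : ℝ) (hδ : 0 < δ)
    (hle : ∀ e, δ ≤ w (x - algebraMap E M e)) (θ : M) (hd : (minpoly E θ).natDegree < p) :
    δ ≤ w (x - θ) := by
  have hmin := step_irr p hp hζ x b hx hnx
  have hx0 : x ≠ 0 := fun h => hnx 0 (by simp [h])
  by_contra! hlt
  have hroot : ∀ τ : M ≃ₐ[E] M, ∃ ζ : M, ζ ^ p = 1 ∧ τ x = ζ * x := by
    intro τ
    refine ⟨τ x / x, ?_, by field_simp⟩
    rw [div_pow, ← map_pow, hx, τ.commutes, div_self]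
    rw [← hx]; exact pow_ne_zero _ hx0
  by_cases hcase : ∀ ζ : M, ζ ^ p = 1 → w (ζ * x - x) < δ
  · -- averaging
    set m := minpoly E θ with hm
    have hmm : m.Monic := minpoly.monic (Algebra.IsIntegral.isIntegral θ)
    set P := m.map (algebraMap E M) with hP
    have hPs : P.Splits := IsAlgClosed.splits _
    have hPm : P.Monic := hmm.map _
    have h1 := hPs.nextCoeff_eq_neg_sum_roots_of_monic hPm
    have hcard : P.roots.card = m.natDegree := by
      rw [← hPs.natDegree_eq_card_roots, hP, natDegree_map]
    have hd0 : 0 < m.natDegree := minpoly.natDegree_pos (Algebra.IsIntegral.isIntegral θ)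
    have hwd : w (m.natDegree : M) = 1 := by
      refine na_natCast_coprime w hw p _ hp1 ?_
      exact (Nat.coprime_of_lt_prime hd0.ne' hd hp).symm
    have hfar : ∀ y ∈ P.roots, w (x - y) < δ := by
      intro y hy
      have hy' : aeval y m = 0 := by
        have := (mem_roots'.1 hy).2
        rwa [IsRoot.def, hP, eval_map_algebraMap] at this
      obtain ⟨τ, rfl⟩ := step_conj θ y hy'
      obtain ⟨ζ, hζ1, hζ2⟩ := hroot τ.symm
      have : w (x - τ θ) = w ((ζ * x - x) + (x - θ)) := by
        rw [← inv τ.symm]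
        simp [hζ2]
      rw [this]
      exact (hw _ _).trans_lt (max_lt (hcase ζ hζ1) hlt)
    have hsum : ∀ S : Multiset M, (∀ y ∈ S, w (x - y) < δ) → w (S.card * x - S.sum) < δ := by
      intro S
      induction S using Multiset.induction_on with
      | empty => intro _; simpa using hδ
      | cons a S ih =>
        intro h
        have : ((a ::ₘ S).card : M) * x - (a ::ₘ S).sum = (x - a) + (S.card * x - S.sum) := by
          simp; ring
        rw [this]
        exact (hw _ _).trans_lt (max_lt (h a (by simp)) (ih fun y hy => h y (by simp [hy])))
    have h2 := hsum _ hfar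
    rw [hcard] at h2
    have hdne : (m.natDegree : M) ≠ 0 := Nat.cast_ne_zero.2 hd0.ne'
    have h3 := hle (-(m.nextCoeff) / m.natDegree)
    have h4 : (m.natDegree : M) * x - P.roots.sum =
        m.natDegree * (x - algebraMap E M (-(m.nextCoeff) / m.natDegree)) := by
      rw [map_div₀, map_neg, map_natCast, ← nextCoeff_map (algebraMap E M).injective, ← hP, h1]
      field_simp
    rw [h4, map_mul, hwd, one_mul] at h2
    exact absurd h2 (not_lt.2 h3)
  · push Not at hcase
    obtain ⟨ζ0, hζ0, hζδ⟩ := hcase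
    have hfix : ∀ τ : M ≃ₐ[E] M, τ θ = θ → τ x = x := by
      intro τ hτ
      by_contra hne
      obtain ⟨ζ, h1, h2⟩ := hroot τ
      have hζ1 : ζ ≠ 1 := by rintro rfl; exact hne (by simpa using h2)
      have hprim : IsPrimitiveRoot ζ p := by
        have : Fact p.Prime := ⟨hp⟩
        rw [← orderOf_eq_prime h1 hζ1]; exact IsPrimitiveRoot.orderOf ζ
      have : NeZero p := ⟨hp.ne_zero⟩
      obtain ⟨i, -, hi⟩ := hprim.eq_pow_of_pow_eq_one hζ0
      have hwζ : w ζ = 1 := by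
        have : w ζ ^ p = 1 := by rw [← map_pow, h1, map_one]
        exact (pow_eq_one_iff_of_nonneg (w.nonneg _) hp.ne_zero).1 this
      have h3 : w (ζ0 * x - x) ≤ w (ζ * x - x) := by
        rw [← sub_one_mul, ← sub_one_mul, map_mul, map_mul, ← hi]
        gcongr
        have := na_pow_sub_le w hw ζ 1 hwζ.le (by simp) i
        simpa using this
      have h4 : w (ζ * x - x) ≤ w (x - θ) := by
        rw [← h2]
        have : τ x - x = τ (x - θ) - (x - θ) := by rw [map_sub, hτ]; ring
        rw [this]
        refine (na_sub w hw _ _).trans ?_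
        rw [inv, max_self]
      exact absurd (hζδ.trans (h3.trans h4)) (not_le.2 hlt)
    have hmem := step_fix x θ hfix
    have hfin : FiniteDimensional E (IntermediateField.adjoin E {θ}) :=
      IntermediateField.adjoin.finiteDimensional (Algebra.IsIntegral.isIntegral θ)
    have h5 : (minpoly E x).natDegree ≤ Module.finrank E (IntermediateField.adjoin E {θ}) := by
      have := minpoly.natDegree_le (A := E) (⟨x, hmem⟩ : IntermediateField.adjoin E {θ})
      rwa [← minpoly.algebraMap_eq (algebraMap (IntermediateField.adjoin E {θ}) M).injective] at this
    rw [IntermediateField.adjoin.finrank (Algebra.IsIntegral.isIntegral θ), hmin, natDegree_X_pow_sub_C] at h5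
    omega

include hw inv hp hp1 hζ in
theorem step_main1 (D : Derivation ℤ M M) (A : ℝ) (hA0 : 0 ≤ A)
    (hA : ∀ e : E, w (D (algebraMap E M e)) ≤ A * w (algebraMap E M e))
    (x : M) (b : E) (hx : x ^ p = algebraMap E M b)
    (hnx : ∀ e : E, algebraMap E M e ≠ x) (hx1 : w x = 1) (g : E[X]) :
    w (D (aeval x g)) ≤ A / w p * w (aeval x g) := by
  have hmin := step_irr p hp hζ x b hx hnx
  have hx0 : x ≠ 0 := fun h => hnx 0 (by simp [h])
  have hwp : 0 < w p := w.pos (Nat.cast_ne_zero.2 hp.ne_zero)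
  have hAp : A ≤ A / w p := le_div_self hA0 hwp hp1.le
  have hAp0 : 0 ≤ A / w p := hA0.trans hAp
  -- the distance to `E` is positive
  obtain ⟨δ, hδ, hδle, hδinf⟩ : ∃ δ : ℝ, 0 < δ ∧ (∀ e, δ ≤ w (x - algebraMap E M e)) ∧
      ∀ m : ℝ, δ < m → ∃ e, w (x - algebraMap E M e) < m := by
    obtain ⟨ζ, hζp⟩ : ∃ ζ : M, IsPrimitiveRoot ζ p := by
      have : NeZero (p : M) := ⟨Nat.cast_ne_zero.2 hp.ne_zero⟩
      exact HasEnoughRootsOfUnity.exists_primitiveRoot M p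
    have hζx : ζ * x ≠ x := by
      intro h
      exact hζp.ne_one hp.one_lt (mul_right_cancel₀ hx0 (by rw [h, one_mul]))
    obtain ⟨τ, hτ⟩ := step_conj (E := E) x (ζ * x) (by
      rw [hmin]; simp [mul_pow, hζp.pow_eq_one, hx])
    have hlow : ∀ e, w (ζ * x - x) ≤ w (x - algebraMap E M e) := by
      intro e
      have : ζ * x - x = τ (x - algebraMap E M e) - (x - algebraMap E M e) := by
        rw [map_sub, hτ, τ.commutes]; ring
      rw [this]
      refine (na_sub w hw _ _).trans ?_
      rw [inv, max_self]
    refine ⟨⨅ e : E, w (x - algebraMap E M e), ?_, ?_, ?_⟩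
    · exact (w.pos (sub_ne_zero.2 hζx)).trans_le (le_ciInf hlow)
    · intro e
      exact ciInf_le ⟨_, Set.forall_mem_range.2 hlow⟩ e
    · intro m hm
      exact exists_lt_of_ciInf_lt hm
  -- reduce the degree
  obtain ⟨g', hg', hdeg⟩ : ∃ g' : E[X], aeval x g' = aeval x g ∧ g'.natDegree < p := by
    have hmon : (X ^ p - Polynomial.C b).Monic := monic_X_pow_sub_C b hp.ne_zero
    refine ⟨g %ₘ (X ^ p - Polynomial.C b), ?_, ?_⟩
    · refine aeval_modByMonic_eq_self_of_root ?_
      simp [hx]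
    · have := natDegree_modByMonic_lt g hmon (by
        intro h
        have := congrArg natDegree h
        rw [natDegree_X_pow_sub_C, natDegree_one] at this
        exact hp.ne_zero this)
      rwa [natDegree_X_pow_sub_C] at this
  rw [← hg']
  -- main estimate with a parameter
  have key : ∀ m : ℝ, 1 < m → w (D (aeval x g')) ≤ A / w p * (m ^ p * w (aeval x g')) := by
    intro m hm
    obtain ⟨a, ha1, ha2⟩ : ∃ a, w (x - algebraMap E M a) ≤ m * δ ∧ w (x - algebraMap E M a) ≤ 1 := by
      obtain ⟨a, ha⟩ := hδinf (m * δ) (lt_mul_of_one_lt_left hδ hm)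
      by_cases h : w (x - algebraMap E M a) ≤ 1
      · exact ⟨a, ha.le, h⟩
      · refine ⟨0, ?_, ?_⟩
        · simp only [map_zero, sub_zero, hx1]
          push Not at h
          exact (h.trans ha).le
        · simp [hx1]
    set u := x - algebraMap E M a with hu
    have hwu : 0 < w u := w.pos (sub_ne_zero.2 (hnx a).symm)
    have hwa : w (algebraMap E M a) ≤ 1 := by
      have : algebraMap E M a = x - u := by rw [hu]; ring
      rw [this]
      exact (na_sub w hw _ _).trans (max_le hx1.le ha2)
    have hDu : w (D u) ≤ A / w p * w u := by
      have h1 : (p : M) * x ^ (p - 1) * D u = D (algebraMap E M (b - a ^ p)) +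
          p * (algebraMap E M a ^ (p - 1) - x ^ (p - 1)) * D (algebraMap E M a) := by
        have h2 : D (x ^ p) = D (algebraMap E M b) := by rw [hx]
        rw [Derivation.leibniz_pow] at h2
        rw [hu, map_sub (algebraMap E M), map_pow, map_sub D, map_sub D, Derivation.leibniz_pow, ← h2]
        simp only [nsmul_eq_mul, smul_eq_mul]
        ring
      have h3 : w ((p : M) * x ^ (p - 1) * D u) = w p * w (D u) := by
        rw [map_mul, map_mul, map_pow, hx1, one_pow, mul_one]
      rw [h1] at h3
      have h4 : w p * w (D u) ≤ A * w u := by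
        rw [← h3]
        refine (hw _ _).trans (max_le ?_ ?_)
        · refine (hA _).trans ?_
          gcongr
          rw [map_sub, ← hx, map_pow]
          exact na_pow_sub_le w hw _ _ hx1.le hwa p
        · rw [map_mul, map_mul]
          have h5 := na_pow_sub_le w hw _ _ hwa hx1.le (p - 1)
          rw [w.map_sub (algebraMap E M a) x, ← hu] at h5
          have h6 : w (D (algebraMap E M a)) ≤ A :=
            (hA a).trans (mul_le_of_le_one_right hA0 hwa)
          calc w p * w (algebraMap E M a ^ (p - 1) - x ^ (p - 1)) * w (D (algebraMap E M a))
              ≤ 1 * w u * A := by gcongr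
            _ = A * w u := by ring
      rw [div_mul_eq_mul_div, le_div_iff₀ hwp, mul_comm]
      exact h4
    -- expand in `u`
    set h := g'.comp (X + Polynomial.C a) with hh
    have hhu : aeval u h = aeval x g' := by
      rw [hh, aeval_comp]; congr 1; simp [hu]
    have hhd : h.natDegree < p := by
      rw [hh, natDegree_comp]; simpa using hdeg
    rw [← hhu]
    by_cases hh0 : h = 0
    · simp [hh0]
    obtain ⟨N, hN1, hN2, hN3, hN4⟩ := exists_gaussR M w hw (w u) hwu
    have hNh : N (h.map (algebraMap E M)) ≤ m ^ p * w (aeval u h) := by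
      set P := h.map (algebraMap E M) with hP
      have hPs : P.Splits := IsAlgClosed.splits _
      have hP0 : P ≠ 0 := (Polynomial.map_ne_zero_iff (algebraMap E M).injective).2 hh0
      have hroots : ∀ y ∈ P.roots, N (X - Polynomial.C y) ≤ m * w (u - y) := by
        intro y hy
        have hyh : aeval y h = 0 := by
          have := (mem_roots'.1 hy).2
          rwa [IsRoot.def, hP, eval_map_algebraMap] at this
        have hyg : aeval (y + algebraMap E M a) g' = 0 := by
          rw [hh, aeval_comp] at hyh; simpa using hyh
        have hg0 : g' ≠ 0 := by
          rintro rfl; exact hh0 (by simp [hh])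
        have hfar := step_far w hw inv p hp hp1 hζ x b hx hnx δ hδ hδle (y + algebraMap E M a)
          ((natDegree_le_of_dvd (minpoly.dvd E _ hyg) hg0).trans_lt hdeg)
        have heq : x - (y + algebraMap E M a) = u - y := by rw [hu]; ring
        rw [heq] at hfar
        have hu' : w u ≤ m * w (u - y) := ha1.trans (by gcongr)
        have hy' : w y ≤ m * w (u - y) := by
          have : y = u - (u - y) := by ring
          calc w y = w (u - (u - y)) := by rw [← this]
            _ ≤ _ := na_sub w hw _ _
            _ ≤ _ := max_le hu' (le_mul_of_one_le_left (w.nonneg _) hm.le)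
        exact (na_sub' N hN1 _ _).trans (max_le (hN4.trans hu') ((hN3 _).trans hy'))
      have hprod : ∀ S : Multiset M, (∀ y ∈ S, N (X - Polynomial.C y) ≤ m * w (u - y)) →
          N ((S.map fun y => X - Polynomial.C y).prod) ≤
            m ^ S.card * w ((S.map fun y => X - Polynomial.C y).prod.eval u) := by
        intro S
        induction S using Multiset.induction_on with
        | empty => intro _; simp
        | cons y S ih =>
          intro hS
          have h1 := ih fun z hz => hS z (by simp [hz])
          have h2 := hS y (by simp)
          simp only [Multiset.map_cons, Multiset.prod_cons, map_mul, Multiset.card_cons, eval_mul]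
          have h3 : w (eval u (X - Polynomial.C y)) = w (u - y) := by simp
          rw [h3]
          calc _ ≤ (m * w (u - y)) * (m ^ S.card * w ((S.map fun y => X - Polynomial.C y).prod.eval u)) := by
                gcongr
            _ = _ := by ring
      have hcard : P.roots.card ≤ p := by
        rw [← hPs.natDegree_eq_card_roots, hP, natDegree_map]; exact hhd.le
      have h1 := hprod _ hroots
      have h2 := hPs.eq_prod_roots
      have h3 : aeval u h = P.eval u := by rw [hP, eval_map_algebraMap]
      rw [h3, h2, map_mul, eval_mul, map_mul, eval_C]
      calc _ ≤ w P.leadingCoeff * (m ^ P.roots.card * w ((P.roots.map fun y => X - Polynomial.C y).prod.eval u)) := by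
            gcongr
            exact hN3 _
        _ ≤ w P.leadingCoeff * (m ^ p * w ((P.roots.map fun y => X - Polynomial.C y).prod.eval u)) := by
            gcongr
            exact hm.le
        _ = _ := by ring
    have hterm : ∀ i, w (algebraMap E M (h.coeff i)) * w u ^ i ≤ m ^ p * w (aeval u h) := by
      intro i
      have := hN2 (h.map (algebraMap E M)) i
      rw [coeff_map] at this
      exact this.trans hNh
    rw [aeval_eq_sum_range, map_sum]
    rw [← aeval_eq_sum_range]
    refine na_sum_le w hw _ _ _ (by positivity) fun i _ => ?_
    rw [Algebra.smul_def, Derivation.leibniz, Derivation.leibniz_pow]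
    refine (hw _ _).trans (max_le ?_ ?_)
    · simp only [smul_eq_mul, nsmul_eq_mul, map_mul, map_pow]
      rcases Nat.eq_zero_or_pos i with rfl | hi
      · simp; positivity
      · calc _ ≤ w (algebraMap E M (h.coeff i)) * (1 * (w u ^ (i - 1) * (A / w p * w u))) := by
              gcongr
              exact na_natCast_le w hw i
          _ = A / w p * (w (algebraMap E M (h.coeff i)) * (w u ^ (i - 1) * w u)) := by ring
          _ ≤ _ := by
              rw [← pow_succ, Nat.sub_add_cancel hi]
              exact mul_le_mul_of_nonneg_left (hterm i) hAp0
    · simp only [smul_eq_mul, map_mul, map_pow]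
      calc _ ≤ w u ^ i * (A / w p * w (algebraMap E M (h.coeff i))) := by
            gcongr
            exact (hA _).trans (by gcongr)
        _ = A / w p * (w (algebraMap E M (h.coeff i)) * w u ^ i) := by ring
        _ ≤ _ := mul_le_mul_of_nonneg_left (hterm i) hAp0
  have htend : Filter.Tendsto (fun m : ℝ => A / w p * (m ^ p * w (aeval x g'))) (nhdsWithin 1 (Set.Ioi 1))
      (nhds (A / w p * (1 ^ p * w (aeval x g')))) := by
    apply tendsto_nhdsWithin_of_tendsto_nhds
    apply Continuous.tendsto
    fun_prop
  have := ge_of_tendsto htend (Filter.eventually_of_mem self_mem_nhdsWithin fun m hm => key m hm)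
  simpa using this

include hw inv hp hp1 hζ in
theorem step_main (D : Derivation ℤ M M) (A : ℝ) (hA0 : 0 ≤ A)
    (hA : ∀ e : E, w (D (algebraMap E M e)) ≤ A * w (algebraMap E M e))
    (hval : ∀ x : M, x ≠ 0 → ∃ a : E, w (algebraMap E M a) = w x)
    (x : M) (b : E) (hx : x ^ p = algebraMap E M b) (g : E[X]) :
    w (D (aeval x g)) ≤ A / w p * w (aeval x g) := by
  have hwp : 0 < w p := w.pos (Nat.cast_ne_zero.2 hp.ne_zero)
  have hAp : A ≤ A / w p := le_div_self hA0 hwp hp1.le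
  by_cases hnx : ∀ e : E, algebraMap E M e ≠ x
  · have hx0 : x ≠ 0 := fun h => hnx 0 (by simp [h])
    obtain ⟨a, ha⟩ := hval x hx0
    have ha0 : algebraMap E M a ≠ 0 := by
      intro h; rw [h, map_zero] at ha; exact hx0 (w.eq_zero.1 ha.symm)
    have h1 : aeval x g = aeval (x / algebraMap E M a) (g.comp (Polynomial.C a * X)) := by
      rw [aeval_comp]; congr 1; simp; field_simp
    rw [h1]
    refine step_main1 w hw inv p hp hp1 hζ D A hA0 hA _ (b / a ^ p) ?_ ?_ ?_ _
    · rw [div_pow, hx, map_div₀, map_pow]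
    · intro e he
      apply hnx (e * a)
      rw [map_mul, he]; field_simp
    · rw [map_div₀, ha, div_self (w.ne_zero hx0)]
  · push Not at hnx
    obtain ⟨e, rfl⟩ := hnx
    rw [aeval_algebraMap_apply]
    exact (hA _).trans (by gcongr)
end step

section bd
variable {B M : Type*} [Field B] [Field M] [Algebra B M] [Algebra.IsAlgebraic B M] [IsAlgClosed M]
  [CharZero M]
  (w : AbsoluteValue M ℝ) (hw : IsNonarchimedean w) (inv : ∀ (τ : M ≃ₐ[B] M) x, w (τ x) = w x)
  (p : ℕ) (hp : p.Prime) (hp1 : w p < 1)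
  (hζ : ∀ ζ : M, ζ ^ p = 1 → ∃ e : B, algebraMap B M e = ζ)
  (D : Derivation ℤ M M)
  (hval : ∀ x : M, x ≠ 0 → ∃ a : B, w (algebraMap B M a) = w x)

include hw inv hp hp1 hζ hval in
theorem bd_step (E : IntermediateField B M) (A : ℝ) (hA0 : 0 ≤ A)
    (hA : ∀ e ∈ E, w (D e) ≤ A * w e) (x : M) (hx : x ^ p ∈ E) :
    ∀ y ∈ E ⊔ IntermediateField.adjoin B {x}, w (D y) ≤ A / w p * w y := by
  intro y hy
  have : Algebra.IsAlgebraic E M := Algebra.IsAlgebraic.tower_top (K := B) E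
  rw [← IntermediateField.restrictScalars_adjoin_eq_sup] at hy
  have hy' : y ∈ IntermediateField.adjoin E {x} := hy
  rw [← IntermediateField.mem_toSubalgebra, IntermediateField.adjoin_toSubalgebra_of_isAlgebraic
    (fun z _ => Algebra.IsAlgebraic.isAlgebraic z), Algebra.adjoin_singleton_eq_range_aeval] at hy'
  obtain ⟨g, rfl⟩ := hy'
  refine step_main (E := E) w hw ?_ p hp hp1 ?_ D A hA0 ?_ ?_ x ⟨_, hx⟩ rfl g
  · intro τ z
    exact inv (τ.restrictScalars B) z
  · intro ζ h
    obtain ⟨e, he⟩ := hζ ζ h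
    exact ⟨algebraMap B E e, he⟩
  · intro e; exact hA e e.2
  · intro z hz
    obtain ⟨a, ha⟩ := hval z hz
    exact ⟨algebraMap B E a, ha⟩

include hw inv hp hp1 hζ hval in
theorem bd_iter (E : IntermediateField B M) (A : ℝ) (hA0 : 0 ≤ A)
    (hA : ∀ e ∈ E, w (D e) ≤ A * w e) (m : ℕ) (x : M) (hx : x ^ p ^ m ∈ E) :
    ∀ y ∈ E ⊔ IntermediateField.adjoin B {x}, w (D y) ≤ A / w p ^ m * w y := by
  induction m generalizing x with
  | zero =>
    intro y hy
    have : IntermediateField.adjoin B {x} ≤ E := by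
      rw [IntermediateField.adjoin_simple_le_iff]; simpa using hx
    rw [sup_eq_left.2 this] at hy
    simpa using hA y hy
  | succ m ih =>
    intro y hy
    have hx' : (x ^ p) ^ p ^ m ∈ E := by rwa [← pow_mul, ← pow_succ']
    have h1 := ih (x ^ p) hx'
    have h2 := bd_step w hw inv p hp hp1 hζ D hval (E ⊔ IntermediateField.adjoin B {x ^ p})
      (A / w p ^ m) (by positivity) h1 x
      (le_sup_right (a := E) (IntermediateField.mem_adjoin_simple_self B (x ^ p))) y
      ((sup_le_sup_right (le_sup_left : E ≤ E ⊔ IntermediateField.adjoin B {x ^ p}) _ :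
        E ⊔ IntermediateField.adjoin B {x} ≤ _) hy)
    rwa [div_div, ← pow_succ] at h2
end bd

def NonSplit (K : Type*) {Ω : Type*} [Field K] [Field Ω] [Algebra K Ω] (q : ℕ) (c α : Ω) : Prop :=
  ∀ x y : Ω, x ^ q + c = α → y ^ q + c = α → ∃ τ : Ω ≃ₐ[K] Ω, τ x = y

theorem restr_aut {K Ω M : Type*} [Field K] [Field Ω] [Field M] [Algebra K Ω] [Normal K Ω]
    (ι : Ω →+* M) (τ : M ≃+* M) (h : ∀ a : K, τ (ι (algebraMap K Ω a)) = ι (algebraMap K Ω a)) :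
    ∃ τ' : Ω ≃ₐ[K] Ω, ∀ x, ι (τ' x) = τ (ι x) := by
  letI : Algebra Ω M := ι.toAlgebra
  letI : Algebra K M := (ι.comp (algebraMap K Ω)).toAlgebra
  haveI : IsScalarTower K Ω M := IsScalarTower.of_algebraMap_eq fun _ => rfl
  let τK : M ≃ₐ[K] M := AlgEquiv.ofRingEquiv (f := τ) h
  exact ⟨τK.restrictNormal Ω, fun x => τK.restrictNormal_commutes Ω x⟩

theorem NonSplit.of_primitive {K Ω : Type*} [Field K] [Field Ω] [Algebra K Ω]
    (q : ℕ) (hq : 0 < q) (c : Ω) (x ζ : Ω) (hζ : IsPrimitiveRoot ζ q)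
    (hζK : ζ ∈ (algebraMap K Ω).range) (τ : Ω ≃ₐ[K] Ω) (hτ : τ x = ζ * x) :
    NonSplit K q c (x ^ q + c) := by
  obtain ⟨z, rfl⟩ := hζK
  by_cases hx0 : x = 0
  · intro y y' hy hy'
    subst hx0
    rw [zero_pow hq.ne', zero_add] at hy hy'
    have h1 : y = 0 := by
      have := add_eq_right.1 hy
      exact pow_eq_zero_iff hq.ne' |>.1 this
    have h2 : y' = 0 := by
      have := add_eq_right.1 hy'
      exact pow_eq_zero_iff hq.ne' |>.1 this
    exact ⟨AlgEquiv.refl, by simp [h1, h2]⟩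
  have hpow : ∀ i : ℕ, (τ ^ i) x = algebraMap K Ω z ^ i * x := by
    intro i
    induction i with
    | zero => simp
    | succ i ih =>
      rw [pow_succ', AlgEquiv.mul_apply, ih, map_mul, map_pow, τ.commutes, hτ]; ring
  have hall : ∀ y : Ω, y ^ q + c = x ^ q + c → ∃ σ : Ω ≃ₐ[K] Ω, σ x = y := by
    intro y hy
    have h1 : (y / x) ^ q = 1 := by
      rw [div_pow, add_right_cancel hy, div_self (pow_ne_zero _ hx0)]
    have : NeZero q := ⟨hq.ne'⟩
    obtain ⟨i, -, hi⟩ := hζ.eq_pow_of_pow_eq_one h1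
    refine ⟨τ ^ i, ?_⟩
    rw [hpow, hi]; field_simp
  intro y y' hy hy'
  obtain ⟨σ, rfl⟩ := hall y hy
  obtain ⟨σ', rfl⟩ := hall y' hy'
  exact ⟨σ' * σ.symm, by simp⟩

theorem NonSplit.conj {K Ω : Type*} [Field K] [Field Ω] [Algebra K Ω] {q : ℕ} {c α : Ω}
    (h : NonSplit K q c α) (σ : Ω ≃ₐ[K] Ω) (hc : σ c = c) : NonSplit K q c (σ α) := by
  intro x y hx hy
  have hc' : σ.symm c = c := by rw [AlgEquiv.symm_apply_eq, hc]
  have key : ∀ z, z ^ q + c = σ α → (σ.symm z) ^ q + c = α := by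
    intro z hz
    apply σ.injective
    rw [map_add, map_pow, hc, σ.apply_symm_apply, hz]
  obtain ⟨τ, hτ⟩ := h (σ.symm x) (σ.symm y) (key x hx) (key y hy)
  exact ⟨σ * τ * σ.symm, by simp [hτ]⟩

theorem split_pow {K Ω B M : Type*} [Field K] [Field Ω] [Algebra K Ω] [Normal K Ω]
    [Field B] [Field M] [Algebra B M] [Algebra.IsAlgebraic B M] [IsAlgClosed M] [CharZero M]
    (ι : Ω →+* M) (E : IntermediateField B M) (hKE : ∀ a : K, ι (algebraMap K Ω a) ∈ E)
    (p r : ℕ) (hp : p.Prime) (hr : 1 ≤ r)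
    (hζ : ∀ ζ : Ω, ζ ^ p ^ r = 1 → ζ ∈ (algebraMap K Ω).range)
    (c : K) (x : Ω) (hE : ι (x ^ p ^ r + algebraMap K Ω c) ∈ E)
    (hs : ¬ NonSplit K (p ^ r) (algebraMap K Ω c) (x ^ p ^ r + algebraMap K Ω c)) :
    ι x ^ p ^ (r - 1) ∈ E := by
  have : Algebra.IsAlgebraic E M := Algebra.IsAlgebraic.tower_top (K := B) E
  by_cases hx0 : x = 0
  · rw [hx0, map_zero, zero_pow (pow_ne_zero _ hp.ne_zero)]; exact zero_mem _
  have hq : 0 < p ^ r := pow_pos hp.pos _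
  have hmem := step_fix (E := E) (ι x ^ p ^ (r - 1)) (0 : M) (by
    intro τ _
    obtain ⟨τ', hτ'⟩ := restr_aut (K := K) ι τ.toRingEquiv (fun a => τ.commutes ⟨_, hKE a⟩)
    have h1 : (τ' x) ^ p ^ r = x ^ p ^ r := by
      apply ι.injective
      have h2 : ι (x ^ p ^ r) ∈ E := by
        have : x ^ p ^ r = (x ^ p ^ r + algebraMap K Ω c) - algebraMap K Ω c := by ring
        rw [this, map_sub]
        exact sub_mem hE (hKE c)
      rw [map_pow, hτ', ← map_pow, ← map_pow]
      exact τ.commutes ⟨_, h2⟩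
    have h3 : (τ' x / x) ^ p ^ r = 1 := by
      rw [div_pow, h1, div_self (pow_ne_zero _ hx0)]
    have h4 : (τ' x / x) ^ p ^ (r - 1) = 1 := by
      by_contra hne
      have : Fact p.Prime := ⟨hp⟩
      have hr' : r - 1 + 1 = r := Nat.sub_add_cancel hr
      have hord : orderOf (τ' x / x) = p ^ (r - 1 + 1) := orderOf_eq_prime_pow hne (by rwa [hr'])
      rw [hr'] at hord
      have hprim : IsPrimitiveRoot (τ' x / x) (p ^ r) := by
        rw [← hord]; exact IsPrimitiveRoot.orderOf _
      exact hs (NonSplit.of_primitive (p ^ r) hq _ x _ hprim (hζ _ h3) τ' (by field_simp))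
    have h5 : (τ' x) ^ p ^ (r - 1) = x ^ p ^ (r - 1) := by
      rw [div_pow] at h4
      exact eq_of_div_eq_one h4
    have h6 := congrArg ι h5
    rw [map_pow, map_pow, hτ'] at h6
    rw [map_pow]
    exact h6)
  have h0 : IntermediateField.adjoin E {(0 : M)} = ⊥ := by simp
  rw [h0, IntermediateField.mem_bot] at hmem
  obtain ⟨e, he⟩ := hmem
  rw [← he]; exact e.2

section gaussframe
variable (k : Type*) (F : Type u) [Field k] [CharZero k] [IsAlgClosed k] [Field F] [CharZero F]
  [Algebra k[X] F] [IsFractionRing k[X] F]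

theorem exists_gauss_frame (vk : AbsoluteValue k ℝ) (hvk : IsNonarchimedean vk)
    (hnt : ∃ x, 1 < vk x) :
    ∃ v : AbsoluteValue F ℝ, ∃ fr : Frame F (dF k F) v,
      v (algebraMap k[X] F X) = 1 ∧ (∀ a : k, v (kF k F a) = vk a) ∧
      (∀ x : fr.C, x ≠ 0 → ∃ a : k, fr.w x = vk a) ∧
      ∀ x : fr.C, x ∈ fr.B → fr.w (fr.DC x) ≤ 1 * fr.w x := by
  obtain ⟨N, hN, hN1, hN2⟩ := exists_gaussN k vk hvk
  obtain ⟨v, hv, hvN⟩ := exists_abs_ext (F := F) N hN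
  have hconst : ∀ a : k, v (kF k F a) = vk a := by
    intro a
    change v (algebraMap k[X] F (Polynomial.C a)) = _
    rw [hvN]
    apply le_antisymm
    · obtain ⟨i, hi⟩ := hN1 (Polynomial.C a)
      rw [hi, coeff_C]
      split_ifs <;> simp
    · simpa using hN2 (Polynomial.C a) 0
  have hD : ∀ x, v (dF k F x) ≤ 1 * v x := by
    apply deriv_bound_frac (dF k F) (dF_poly k F) _ hv
    intro P
    rw [hvN, hvN, one_mul]
    obtain ⟨i, hi⟩ := hN1 (derivative P)
    rw [hi, coeff_derivative, map_mul]
    have h1 : vk ((i : k) + 1) ≤ 1 := by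
      have := na_natCast_le vk hvk (i + 1)
      push_cast at this; exact this
    calc _ ≤ vk (P.coeff (i + 1)) * 1 := by gcongr
      _ ≤ _ := by rw [mul_one]; exact hN2 _ _
  have hX : v (algebraMap k[X] F X) = 1 := by
    rw [hvN]
    apply le_antisymm
    · obtain ⟨i, hi⟩ := hN1 X
      rw [hi, coeff_X]
      split_ifs <;> simp
    · simpa using hN2 X 1
  obtain ⟨x0, hx0⟩ := hnt
  obtain ⟨fr⟩ := exists_frame F (dF k F) v hv ⟨kF k F x0, by rwa [hconst]⟩ 1 hD
  refine ⟨v, fr, hX, hconst, ?_, fr.DC_bddB 1 hD⟩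
  have hvF : ∀ x : F, ∃ a : k, v x = vk a := by
    intro x
    obtain ⟨P, Q, hQ, rfl⟩ := IsFractionRing.div_surjective (A := k[X]) x
    obtain ⟨i, hi⟩ := hN1 P
    obtain ⟨j, hj⟩ := hN1 Q
    refine ⟨P.coeff i / Q.coeff j, ?_⟩
    rw [map_div₀, map_div₀, hvN, hvN, hi, hj]
  intro x hx
  have := fr.charZero
  set m := minpoly fr.B x with hm
  set P := m.map (algebraMap fr.B fr.C) with hP
  have hs : P.Splits := IsAlgClosed.splits _
  have hmon : m.Monic := minpoly.monic (Algebra.IsIntegral.isIntegral x)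
  have hPm : P.Monic := hmon.map _
  have h1 := hs.coeff_zero_eq_prod_roots_of_monic hPm
  have hprod : ∀ S : Multiset fr.C, (∀ y ∈ S, fr.w y = fr.w x) → fr.w S.prod = fr.w x ^ S.card := by
    intro S
    induction S using Multiset.induction_on with
    | empty => simp
    | cons y S ih =>
      intro h
      rw [Multiset.prod_cons, map_mul, h y (by simp), ih fun z hz => h z (by simp [hz]),
        Multiset.card_cons, pow_succ']
  have h2 := hprod P.roots (by
    intro y hy
    have hy' : aeval y m = 0 := by
      have := (mem_roots'.1 hy).2
      rwa [IsRoot.def, hP, eval_map_algebraMap] at this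
    obtain ⟨τ, rfl⟩ := step_conj x y hy'
    exact fr.inv τ x)
  rw [← hs.natDegree_eq_card_roots] at h2
  have h3 : fr.w (P.coeff 0) = fr.w x ^ P.natDegree := by
    rw [h1, map_mul, map_pow, h2]; simp
  have hd : P.natDegree ≠ 0 := by
    rw [hP, natDegree_map]; exact (minpoly.natDegree_pos (Algebra.IsIntegral.isIntegral x)).ne'
  have hc : (m.coeff 0 : fr.C) ≠ 0 := by
    intro h
    rw [hP, coeff_map] at h3
    have h4 : algebraMap fr.B fr.C (m.coeff 0) = (m.coeff 0 : fr.C) := rfl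
    rw [h4, h, map_zero] at h3
    exact pow_ne_zero _ (fr.w.ne_zero hx) h3.symm
  obtain ⟨a, -, ha⟩ := fr.val_B (m.coeff 0).2 hc
  obtain ⟨a', ha'⟩ := hvF a
  obtain ⟨z, hz⟩ := IsAlgClosed.exists_pow_nat_eq a' (Nat.pos_of_ne_zero hd)
  refine ⟨z, ?_⟩
  have h5 : fr.w x ^ P.natDegree = vk z ^ P.natDegree := by
    rw [← h3, ← map_pow, hz, ← ha', ← ha, hP, coeff_map]; rfl
  exact (pow_left_inj₀ (fr.w.nonneg _) (vk.nonneg _) hd).1 h5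
end gaussframe

def IsPath {Ω : Type*} [Field Ω] (q : ℕ) (c : Ω) (α : ℕ → Ω) : Prop :=
  ∀ n, α (n + 1) ^ q + c = α n

/-- lower bound for `ζ - 1` -/
theorem na_zeta {M : Type*} [Field M] [CharZero M] (w : AbsoluteValue M ℝ) (hw : IsNonarchimedean w)
    (p r : ℕ) (hp : p.Prime) (ζ : M) (hζ : ζ ^ p ^ r = 1) (h1 : ζ ≠ 1) :
    w p ≤ w (ζ - 1) ^ (p - 1) := by
  have hwζ : w ζ = 1 := by
    have : w ζ ^ p ^ r = 1 := by rw [← map_pow, hζ, map_one]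
    exact (pow_eq_one_iff_of_nonneg (w.nonneg _) (pow_ne_zero _ hp.ne_zero)).1 this
  obtain ⟨i, hi⟩ : ∃ i, IsPrimitiveRoot (ζ ^ i) p := by
    obtain ⟨s, hs, hs'⟩ := (Nat.dvd_prime_pow hp).1 (orderOf_dvd_of_pow_eq_one hζ)
    have hprim : IsPrimitiveRoot ζ (p ^ s) := by rw [← hs']; exact IsPrimitiveRoot.orderOf _
    have hs0 : s ≠ 0 := by
      rintro rfl
      rw [pow_zero] at hprim
      exact h1 (by simpa using hprim.pow_eq_one)
    obtain ⟨t, rfl⟩ := Nat.exists_eq_succ_of_ne_zero hs0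
    refine ⟨p ^ t, hprim.pow (pow_pos hp.pos _) (by rw [Nat.succ_eq_add_one, pow_succ])⟩
  have h2 : w (ζ ^ i - 1) ≤ w (ζ - 1) := by
    simpa using na_pow_sub_le w hw ζ 1 hwζ.le (by simp) i
  set ξ := ζ ^ i with hξ
  have hwξ : w ξ = 1 := by rw [hξ, map_pow, hwζ, one_pow]
  have : Fact p.Prime := ⟨hp⟩
  have h3 : (p : M) = ∏ μ ∈ primitiveRoots p M, (1 - μ) := by
    have h4 := eval_one_cyclotomic_prime (R := M) (p := p)
    rw [cyclotomic_eq_prod_X_sub_primitiveRoots hi, eval_prod] at h4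
    rw [← h4]
    simp
  have h5 : (primitiveRoots p M).card = p - 1 := by
    rw [hi.card_primitiveRoots, Nat.totient_prime hp]
  rw [h3, map_prod, ← h5]
  rw [← Finset.prod_const]
  refine Finset.prod_le_prod (fun _ _ => w.nonneg _) ?_
  intro μ hμ
  have : NeZero p := ⟨hp.ne_zero⟩
  obtain ⟨j, -, rfl⟩ := hi.eq_pow_of_pow_eq_one ((mem_primitiveRoots hp.pos).1 hμ).pow_eq_one
  refine le_trans ?_ h2
  have := na_pow_sub_le w hw ξ 1 hwξ.le (by simp) j
  rw [w.map_sub]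
  simpa using this

section path
variable {M : Type*} [Field M] [CharZero M] (w : AbsoluteValue M ℝ) (hw : IsNonarchimedean w)
  (p r : ℕ) (hp : p.Prime) (hr : 1 ≤ r) (hp1 : w p < 1) (D : Derivation ℤ M M) (c : M)
  (hc : w c ≤ 1) (hDc : D c = 1)

include hw hp hc in
theorem path_max (α : ℕ → M) (hα : IsPath (p ^ r) c α) (n : ℕ) :
    max 1 (w (α (n + 1))) ^ p ^ r ≤ max 1 (w (α n)) := by
  rcases le_total (w (α (n + 1))) 1 with h | h
  · rw [max_eq_left h, one_pow]; exact le_max_left _ _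
  · rw [max_eq_right h, ← map_pow, show α (n + 1) ^ p ^ r = α n - c by rw [← hα n]; ring, max_comm]
    exact (na_sub w hw _ _).trans (max_le_max le_rfl hc)

include hw hp hc in
theorem path_max_pow (α : ℕ → M) (hα : IsPath (p ^ r) c α) (n : ℕ) :
    max 1 (w (α n)) ^ (p ^ r) ^ n ≤ max 1 (w (α 0)) := by
  induction n with
  | zero => simp
  | succ n ih =>
    refine le_trans ?_ ih
    rw [pow_succ', pow_mul]
    gcongr
    exact path_max w hw p r hp c hc α hα n

include hw hp hc hr hp1 in
theorem path_n0 (R : ℝ) : ∃ n0, ∀ α : ℕ → M, IsPath (p ^ r) c α → w (α 0) ≤ R → ∀ n ≥ n0,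
    w p * max 1 (w (α n)) ^ 2 < 1 := by
  have hwp : 0 < w p := w.pos (Nat.cast_ne_zero.2 hp.ne_zero)
  have h1 : 1 < (w p)⁻¹ := (one_lt_inv₀ hwp).2 hp1
  obtain ⟨n0, hn0⟩ := pow_unbounded_of_one_lt (max 1 R ^ 2) h1
  refine ⟨n0, fun α hα hR n hn => ?_⟩
  by_contra! hge
  have h2 := path_max_pow w hw p r hp c hc α hα n
  have h3 : (w p)⁻¹ ≤ max 1 (w (α n)) ^ 2 := by
    rwa [inv_le_iff_one_le_mul₀' hwp]
  have h4 : (w p)⁻¹ ^ (p ^ r) ^ n ≤ max 1 R ^ 2 := by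
    calc _ ≤ (max 1 (w (α n)) ^ 2) ^ (p ^ r) ^ n := by gcongr
      _ = (max 1 (w (α n)) ^ (p ^ r) ^ n) ^ 2 := by ring
      _ ≤ (max 1 (w (α 0))) ^ 2 := by gcongr
      _ ≤ _ := by gcongr
  have h5 : n0 ≤ (p ^ r) ^ n :=
    hn.trans (Nat.lt_pow_self (Nat.one_lt_pow (by omega) hp.one_lt)).le
  have h6 : (w p)⁻¹ ^ n0 ≤ (w p)⁻¹ ^ (p ^ r) ^ n := pow_le_pow_right₀ h1.le h5
  linarith

include hDc in
theorem path_deriv (α : ℕ → M) (hα : IsPath (p ^ r) c α) (n : ℕ) :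
    D (α n) - 1 = (p : M) ^ r * α (n + 1) ^ (p ^ r - 1) * D (α (n + 1)) := by
  rw [← hα n, map_add, hDc, Derivation.leibniz_pow]
  simp only [nsmul_eq_mul, smul_eq_mul]
  push_cast
  ring

include hw hp hc hr hp1 hDc in
theorem path_growth (α : ℕ → M) (hα : IsPath (p ^ r) c α) (n0 : ℕ)
    (hn0 : ∀ n ≥ n0, w p * max 1 (w (α n)) ^ 2 < 1) (N : ℕ) (hN : n0 ≤ N) (hbig : 1 < w (D (α N))) :
    ∃ g > 0, ∀ j, g ≤ (w p ^ r) ^ j * w (D (α (N + j))) := by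
  have hwp : 0 < w p := w.pos (Nat.cast_ne_zero.2 hp.ne_zero)
  have hwq : w p ^ r ≤ w p := pow_le_of_le_one hwp.le hp1.le (by omega)
  have hm1 : ∀ n, 1 ≤ max 1 (w (α n)) := fun n => le_max_left _ _
  have hstep : ∀ n ≥ n0, 1 < w (D (α n)) → 1 < w (D (α (n + 1))) ∧
      w (D (α n)) / max 1 (w (α n)) ≤ w p ^ r * (w (D (α (n + 1))) / max 1 (w (α (n + 1)))) := by
    intro n hn hb
    have h1 : w (D (α n) - 1) = w (D (α n)) := by
      rw [sub_eq_add_neg]; apply na_add_eq w hw; simpa using hb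
    rw [path_deriv p r D c hDc α hα n, map_mul, map_mul, map_pow, map_pow] at h1
    have h2 := path_max w hw p r hp c hc α hα n
    have h3 := hn0 n hn
    set m := max 1 (w (α n))
    set m' := max 1 (w (α (n + 1)))
    have hm' : 0 < m' := one_pos.trans_le (hm1 _)
    have hm : 0 < m := one_pos.trans_le (hm1 _)
    have h4 : w (α (n + 1)) ^ (p ^ r - 1) * m' ≤ m := by
      refine le_trans ?_ h2
      calc _ ≤ m' ^ (p ^ r - 1) * m' := by gcongr; exact le_max_right _ _
        _ = _ := by rw [← pow_succ, Nat.sub_add_cancel (Nat.one_le_pow _ _ hp.pos)]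
    have h5 : w (D (α n)) * m' ≤ w p ^ r * m * w (D (α (n + 1))) := by
      calc _ = w p ^ r * (w (α (n + 1)) ^ (p ^ r - 1) * m') * w (D (α (n + 1))) := by rw [← h1]; ring
        _ ≤ _ := by gcongr
    have h6 : w p ^ r * m < 1 := by
      refine lt_of_le_of_lt ?_ h3
      rw [pow_two]
      have : m ≤ m * m := le_mul_of_one_le_left hm.le (hm1 _)
      gcongr
    constructor
    · by_contra! hle
      have : w p ^ r * m * w (D (α (n + 1))) ≤ 1 := mul_le_one₀ h6.le (w.nonneg _) hle
      have h7 : w (D (α n)) ≤ w (D (α n)) * m' := le_mul_of_one_le_right (w.nonneg _) (hm1 _)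
      linarith
    · rw [div_le_iff₀ hm, mul_div_assoc', div_mul_eq_mul_div, le_div_iff₀ hm']
      linarith
  refine ⟨w (D (α N)) / max 1 (w (α N)), by have := hm1 N; positivity, ?_⟩
  have key : ∀ j, 1 < w (D (α (N + j))) ∧ w (D (α N)) / max 1 (w (α N)) ≤
      (w p ^ r) ^ j * (w (D (α (N + j))) / max 1 (w (α (N + j)))) := by
    intro j
    induction j with
    | zero => simpa using hbig
    | succ j ih =>
      obtain ⟨h1, h2⟩ := hstep (N + j) (by omega) ih.1
      refine ⟨h1, ih.2.trans ?_⟩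
      rw [pow_succ, mul_assoc]
      gcongr
      exact h2
  intro j
  refine (key j).2.trans ?_
  gcongr
  exact div_le_self (w.nonneg _) (hm1 _)

include hw hp hc hr hp1 hDc in
theorem path_unique (α α' : ℕ → M) (hα : IsPath (p ^ r) c α) (hα' : IsPath (p ^ r) c α') (n0 : ℕ)
    (hn0 : ∀ n ≥ n0, w p * max 1 (w (α n)) ^ 2 < 1)
    (hn0' : ∀ n ≥ n0, w p * max 1 (w (α' n)) ^ 2 < 1)
    (hb : ∀ n ≥ n0, w (D (α n)) ≤ 1) (hb' : ∀ n ≥ n0, w (D (α' n)) ≤ 1)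
    (h0 : α n0 = α' n0) : ∀ n ≥ n0, α n = α' n := by
  intro n hn
  induction n, hn using Nat.le_induction with
  | base => exact h0
  | succ n hn ih =>
    by_contra hne
    have hwp : 0 < w p := w.pos (Nat.cast_ne_zero.2 hp.ne_zero)
    have hq0 : p ^ r ≠ 0 := pow_ne_zero _ hp.ne_zero
    have hpow : α (n + 1) ^ p ^ r = α' (n + 1) ^ p ^ r := by
      have h1 := hα n; have h2 := hα' n
      rw [ih, ← h2] at h1
      exact add_right_cancel h1
    have hx0 : α (n + 1) ≠ 0 := by
      intro h
      apply hne
      rw [h, zero_pow hq0] at hpow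
      rw [h, (pow_eq_zero_iff hq0).1 hpow.symm]
    obtain ⟨ζ, hζα⟩ : ∃ ζ, α' (n + 1) = ζ * α (n + 1) := ⟨α' (n + 1) / α (n + 1), by field_simp⟩
    have hζ : ζ ^ p ^ r = 1 := by
      rw [hζα, mul_pow] at hpow
      exact mul_right_cancel₀ (pow_ne_zero _ hx0) (by rw [← hpow, one_mul])
    have hζ1 : ζ ≠ 1 := by rintro rfl; exact hne (by rw [hζα, one_mul])
    have hpr : p ^ r - 1 + 1 = p ^ r := Nat.sub_add_cancel (Nat.one_le_pow _ _ hp.pos)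
    have hD' : D (α' (n + 1)) = ζ * D (α (n + 1)) := by
      have h1 := path_deriv p r D c hDc α hα n
      have h2 := path_deriv p r D c hDc α' hα' n
      rw [← ih, h1, hζα, mul_pow] at h2
      have h3 : (p : M) ^ r * α (n + 1) ^ (p ^ r - 1) ≠ 0 :=
        mul_ne_zero (pow_ne_zero _ (Nat.cast_ne_zero.2 hp.ne_zero)) (pow_ne_zero _ hx0)
      have h4 : ζ ^ (p ^ r - 1) * ζ = 1 := by rw [← pow_succ, hpr, hζ]
      rw [hζα]
      apply mul_left_cancel₀ h3
      linear_combination (-ζ) * h2 - (p : M) ^ r * α (n + 1) ^ (p ^ r - 1) * D (ζ * α (n + 1)) * h4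
    set e := D (α (n + 1)) with he
    -- estimates
    have hm1 : ∀ n, 1 ≤ max 1 (w (α n)) := fun n => le_max_left _ _
    have hest : ∀ γ : ℕ → M, IsPath (p ^ r) c γ → (∀ n ≥ n0, w (D (γ n)) ≤ 1) → ∀ i ≥ n0,
        w (D (γ i) - 1) ≤ w p ^ r * max 1 (w (γ i)) := by
      intro γ hγ hbγ i hi
      rw [path_deriv p r D c hDc γ hγ i, map_mul, map_mul, map_pow, map_pow]
      have h2 := path_max w hw p r hp c hc γ hγ i
      have h3 : w (γ (i + 1)) ^ (p ^ r - 1) ≤ max 1 (w (γ i)) := by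
        refine le_trans ?_ h2
        calc _ ≤ max 1 (w (γ (i + 1))) ^ (p ^ r - 1) := by gcongr; exact le_max_right _ _
          _ ≤ _ := pow_le_pow_right₀ (le_max_left _ _) (by omega)
      calc _ ≤ w p ^ r * max 1 (w (γ i)) * 1 := by gcongr; exact hbγ _ (by omega)
        _ = _ := mul_one _
    have hwζ : w ζ = 1 := by
      have : w ζ ^ p ^ r = 1 := by rw [← map_pow, hζ, map_one]
      exact (pow_eq_one_iff_of_nonneg (w.nonneg _) hq0).1 this
    have hwα' : w (α' (n + 1)) = w (α (n + 1)) := by rw [hζα, map_mul, hwζ, one_mul]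
    have e1 := hest α hα hb (n + 1) (by omega)
    have e2 := hest α' hα' hb' (n + 1) (by omega)
    rw [hwα', hD'] at e2
    have hlt := hn0 (n + 1) (by omega)
    set m := max 1 (w (α (n + 1))) with hm
    have hm1 : 1 ≤ m := le_max_left _ _
    have hm0 : 0 < m := one_pos.trans_le hm1
    have hwm : w p * m < 1 := by
      refine lt_of_le_of_lt ?_ hlt
      gcongr
      nlinarith
    have hwr : w p ^ r ≤ w p := pow_le_of_le_one hwp.le hp1.le (by omega)
    have hwrm : w p ^ r * m ≤ w p * m := by gcongr
    have hwe : w e = 1 := by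
      have h1 : w (1 - e) < w (1 : M) := by rw [w.map_sub, map_one]; linarith
      rw [na_eq_of_lt w hw h1, map_one]
    have hwz : w (ζ - 1) ≤ w p ^ r * m := by
      have h1 : w (ζ - 1) = w ((ζ * e - 1) - ζ * (e - 1)) := by ring_nf
      rw [h1]
      refine (na_sub w hw _ _).trans (max_le e2 ?_)
      rw [map_mul, hwζ, one_mul]; exact e1
    have hlow := na_zeta w hw p r hp ζ hζ hζ1
    by_cases hp2 : 3 ≤ p
    · have h1 : w (ζ - 1) ^ (p - 1) ≤ (w p * m) ^ 2 := by
        calc _ ≤ (w p * m) ^ (p - 1) := by gcongr; linarith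
          _ ≤ _ := pow_le_pow_of_le_one (by positivity) hwm.le (by omega)
      nlinarith
    · have hp2 : p = 2 := by have := hp.two_le; omega
      by_cases hr2 : 2 ≤ r
      · have h1 : w p ^ r ≤ w p ^ 2 := pow_le_pow_of_le_one hwp.le hp1.le hr2
        have h2 : w p ≤ w p ^ 2 * m := by
          calc w p ≤ w (ζ - 1) ^ (p - 1) := hlow
            _ = w (ζ - 1) := by rw [hp2]; simp
            _ ≤ w p ^ r * m := hwz
            _ ≤ _ := by gcongr
        nlinarith
      · have hr1 : r = 1 := by omega
        subst hr1 hp2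
        have hζn : ζ = -1 := by
          have : (ζ - 1) * (ζ + 1) = 0 := by ring_nf; rw [pow_one] at hζ; rw [hζ]; ring
          rcases mul_eq_zero.1 this with h | h
          · exact absurd (sub_eq_zero.1 h) hζ1
          · exact eq_neg_of_add_eq_zero_left h
        subst hζn
        have d1 := path_deriv 2 1 D c hDc α hα (n + 1)
        have d2 := path_deriv 2 1 D c hDc α' hα' (n + 1)
        rw [hD'] at d2
        simp only [pow_one, Nat.add_one_sub_one, Nat.cast_ofNat] at d1 d2
        rw [← he] at d1
        set x := α (n + 1 + 1) with hx
        set x' := α' (n + 1 + 1) with hx'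
        have f1 := hest α hα hb (n + 1 + 1) (by omega)
        have f2 := hest α' hα' hb' (n + 1 + 1) (by omega)
        rw [← hx] at f1
        rw [← hx'] at f2
        have g1 := path_max w hw 2 1 hp c hc α hα (n + 1)
        have g2 := path_max w hw 2 1 hp c hc α' hα' (n + 1)
        rw [hwα'] at g2
        rw [← hm, ← hx] at g1
        rw [← hm, ← hx'] at g2
        simp only [pow_one, Nat.cast_ofNat] at f1 f2 g1 g2 hlt hwm hp1
        have s1 : (1 : M) + x * D x + x' * D x' = 0 := by
          have h2 : (2 : M) ≠ 0 := two_ne_zero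
          apply mul_left_cancel₀ h2
          linear_combination -d1 - d2
        have hle : ∀ y : M, max 1 (w y) ^ 2 ≤ m → w y ≤ max 1 (w y) ∧ max 1 (w y) ≤ m := by
          intro y hy
          refine ⟨le_max_right _ _, le_trans ?_ hy⟩
          have : 1 ≤ max 1 (w y) := le_max_left _ _
          nlinarith
        have k1 := hle x g1
        have k2 := hle x' g2
        have hterm : ∀ y : M, w (D y - 1) ≤ w 2 * max 1 (w y) → max 1 (w y) ^ 2 ≤ m →
            w (y * (D y - 1)) < 1 := by
          intro y h1 h2
          rw [map_mul]
          calc _ ≤ max 1 (w y) * (w 2 * max 1 (w y)) := by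
                gcongr
                exact le_max_right _ _
            _ = w 2 * max 1 (w y) ^ 2 := by ring
            _ ≤ w 2 * m := by gcongr
            _ < 1 := hwm
        have s2 : w (1 + (x + x')) < 1 := by
          have : (1 : M) + (x + x') = -(x * (D x - 1) + x' * (D x' - 1)) := by
            linear_combination s1
          rw [this, map_neg_eq_map]
          exact (hw _ _).trans_lt (max_lt (hterm x f1 g1) (hterm x' f2 g2))
        have s3 : w (x + x') = 1 := by
          have h1 : w (1 - -(x + x')) < w (1 : M) := by rw [sub_neg_eq_add, map_one]; exact s2
          have h2 := na_eq_of_lt w hw h1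
          rwa [map_neg_eq_map, map_one] at h2
        have s4 : (x + x') ^ 2 = 2 * (x * x' - c) := by
          have h1 := hα (n + 1); have h2 := hα' (n + 1)
          rw [hζα] at h2
          rw [← hx, pow_one] at h1
          rw [← hx', pow_one] at h2
          linear_combination h1 + h2
        have s5 : w ((x + x') ^ 2) < 1 := by
          rw [s4, map_mul]
          have : w (x * x' - c) ≤ m ^ 2 := by
            refine (na_sub w hw _ _).trans (max_le ?_ (hc.trans (one_le_pow₀ hm1)))
            rw [map_mul, pow_two]
            gcongr
            · exact k1.1.trans k1.2
            · exact k2.1.trans k2.2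
          calc _ ≤ w 2 * m ^ 2 := by gcongr
            _ < 1 := hlt
        rw [map_pow, s3, one_pow] at s5
        exact lt_irrefl _ s5
end path

theorem root_unity_lift {k M : Type*} [Field k] [IsAlgClosed k] [CharZero k] [Field M] (φ : k →+* M)
    (n : ℕ) (hn : 0 < n) (ζ : M) (h : ζ ^ n = 1) : ∃ z : k, z ^ n = 1 ∧ φ z = ζ := by
  have : NeZero (n : k) := ⟨Nat.cast_ne_zero.2 hn.ne'⟩
  obtain ⟨z, hz⟩ := HasEnoughRootsOfUnity.exists_primitiveRoot k n
  have hz' := hz.map_of_injective φ.injective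
  have : NeZero n := ⟨hn.ne'⟩
  obtain ⟨i, -, hi⟩ := hz'.eq_pow_of_pow_eq_one h
  refine ⟨z ^ i, ?_, by rw [map_pow, hi]⟩
  rw [← pow_mul, mul_comm, pow_mul, hz.pow_eq_one, one_pow]

/-- the parameter -/
noncomputable def cF (k F : Type*) [Field k] [Field F] [Algebra k[X] F] : F := algebraMap k[X] F X

section badpath
variable (k : Type*) (F : Type u) [Field k] [CharZero k] [IsAlgClosed k] [Field F] [CharZero F]
  [Algebra k[X] F] [IsFractionRing k[X] F]
  {K Ω : Type*} [Field K] [Field Ω] [Algebra F K] [FiniteDimensional F K] [Algebra K Ω]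
  [IsAlgClosure K Ω] [Algebra F Ω] [IsScalarTower F K Ω]

theorem finite_image_field {B M : Type*} [Field B] [Field M] [Algebra F B] [Algebra F M] [Algebra B M]
    [IsScalarTower F B M] [Algebra.IsAlgebraic B M] (φ : K →ₐ[F] M) :
    ∃ E : IntermediateField B M, FiniteDimensional B E ∧ ∀ a, φ a ∈ E := by
  let b := Module.finBasis F K
  let S : Set M := Set.range fun i => φ (b i)
  have hS : S.Finite := Set.finite_range _
  refine ⟨IntermediateField.adjoin B S, ?_, ?_⟩
  · have := hS.to_subtype
    exact IntermediateField.finiteDimensional_adjoin fun x _ => Algebra.IsIntegral.isIntegral x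
  · intro a
    rw [← b.sum_repr a, map_sum]
    refine sum_mem fun i _ => ?_
    rw [map_smul, Algebra.smul_def, IsScalarTower.algebraMap_apply F B M]
    exact mul_mem (IntermediateField.algebraMap_mem _ _) (IntermediateField.subset_adjoin _ _ ⟨i, rfl⟩)

theorem bad_path (p r : ℕ) (hp : p.Prime) (hr : 1 ≤ r) (vk : AbsoluteValue k ℝ)
    (hvk : IsNonarchimedean vk) (hvp : vk p < 1) (β : K) (α : ℕ → Ω)
    (hα : IsPath (p ^ r) (algebraMap F Ω (cF k F)) α) (h0 : α 0 = algebraMap K Ω β)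
    (hs : ∀ m, ∃ n ≥ m, ¬ NonSplit K (p ^ r) (algebraMap F Ω (cF k F)) (α n)) :
    ∃ n0, ∀ n ≥ n0, α n ∈ IntermediateField.adjoin K {α n0} := by
  have hvp0 : 0 < vk p := vk.pos (Nat.cast_ne_zero.2 hp.ne_zero)
  obtain ⟨v, fr, hX, hconst, hval, hDB⟩ := exists_gauss_frame k F vk hvk
    ⟨(p : k)⁻¹, by rw [map_inv₀]; exact (one_lt_inv₀ hvp0).2 hvp⟩
  have := fr.charZero
  have hKΩ : Algebra.IsAlgebraic K Ω := IsAlgClosure.isAlgebraic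
  have hΩcl : IsAlgClosed Ω := IsAlgClosure.isAlgClosed K
  have : Algebra.IsAlgebraic F Ω := Algebra.IsAlgebraic.trans F K Ω
  have hnorm : Normal K Ω := IsAlgClosure.normal K Ω
  let ι : Ω →ₐ[F] fr.C := IsAlgClosed.lift
  set cM : fr.C := algebraMap F fr.C (cF k F) with hcM
  have hιc : ι (algebraMap F Ω (cF k F)) = cM := ι.commutes _
  have hwc : fr.w cM ≤ 1 := by rw [hcM, fr.ext]; exact hX.le
  have hDc : fr.DC cM = 1 := by
    rw [hcM, fr.DC_ext, cF, dF_poly]; simp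
  have hwnat : fr.w (p : fr.C) = vk p := by
    have : (p : fr.C) = algebraMap F fr.C (kF k F p) := by simp
    rw [this, fr.ext, hconst]
  have hwp1 : fr.w (p : fr.C) < 1 := by rwa [hwnat]
  have hwp0 : 0 < fr.w (p : fr.C) := by rwa [hwnat]
  have hcK : algebraMap F Ω (cF k F) = algebraMap K Ω (algebraMap F K (cF k F)) :=
    IsScalarTower.algebraMap_apply F K Ω _
  have hpath : ∀ γ : ℕ → Ω, IsPath (p ^ r) (algebraMap F Ω (cF k F)) γ →
      IsPath (p ^ r) cM (fun n => ι (γ n)) := by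
    intro γ hγ n
    change ι (γ (n + 1)) ^ p ^ r + cM = ι (γ n)
    rw [← hγ n, map_add, map_pow, hιc]
  obtain ⟨n0, hn0⟩ := path_n0 fr.w fr.nonarch p r hp hr hwp1 cM hwc (fr.w (ι (algebraMap K Ω β)))
  have hζB : ∀ ζ : fr.C, ζ ^ p = 1 → ∃ e : fr.B, algebraMap fr.B fr.C e = ζ := by
    intro ζ hζ
    obtain ⟨z, -, hz⟩ := root_unity_lift ((algebraMap F fr.C).comp (kF k F)) p hp.pos ζ hζ
    exact ⟨algebraMap F fr.B (kF k F z), hz⟩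
  have hvalB : ∀ x : fr.C, x ≠ 0 → ∃ a : fr.B, fr.w (algebraMap fr.B fr.C a) = fr.w x := by
    intro x hx
    obtain ⟨a, ha⟩ := hval x hx
    refine ⟨algebraMap F fr.B (kF k F a), ?_⟩
    rw [ha, ← hconst, ← fr.ext]; rfl
  have hζK : ∀ ζ : Ω, ζ ^ p ^ r = 1 → ζ ∈ (algebraMap K Ω).range := by
    intro ζ hζ
    obtain ⟨z, -, hz⟩ := root_unity_lift ((algebraMap F Ω).comp (kF k F)) (p ^ r) (pow_pos hp.pos _) ζ hζ
    refine ⟨algebraMap F K (kF k F z), ?_⟩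
    rw [← IsScalarTower.algebraMap_apply F K Ω]; exact hz
  have hbad : ∀ γ : ℕ → Ω, IsPath (p ^ r) (algebraMap F Ω (cF k F)) γ → γ 0 = algebraMap K Ω β →
      (∀ m, ∃ n ≥ m, ¬ NonSplit K (p ^ r) (algebraMap F Ω (cF k F)) (γ n)) →
      ∀ n ≥ n0, fr.w (fr.DC (ι (γ n))) ≤ 1 := by
    intro γ hγ hγ0 hγs N hN
    by_contra! hbig
    obtain ⟨g, hg, hgj⟩ := path_growth fr.w fr.nonarch p r hp hr hwp1 fr.DC cM hwc hDc
      (fun n => ι (γ n)) (hpath γ hγ) n0 (fun n hn => hn0 _ (hpath γ hγ) (by simp [hγ0]) n hn)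
      N hN hbig
    obtain ⟨E0, hE0f, hE0⟩ := finite_image_field F (K := K) (B := fr.B)
      (ι.comp (IsScalarTower.toAlgHom F K Ω))
    have hE0' : ∀ a : K, ι (algebraMap K Ω a) ∈ E0 := hE0
    obtain ⟨A0, hA0, hbd0⟩ := fr.DC_bdd E0 hE0f
    classical
    let E : ℕ → IntermediateField fr.B fr.C := fun n => Nat.rec E0
      (fun n En => En ⊔ IntermediateField.adjoin fr.B {ι (γ (n + 1))}) n
    have hE_succ : ∀ n, E (n + 1) = E n ⊔ IntermediateField.adjoin fr.B {ι (γ (n + 1))} := fun n => rfl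
    have hE_K : ∀ n, E0 ≤ E n := by
      intro n
      induction n with
      | zero => exact le_rfl
      | succ n ih => rw [hE_succ]; exact ih.trans le_sup_left
    have hE_γ : ∀ n, ι (γ n) ∈ E n := by
      intro n
      cases n with
      | zero => rw [hγ0]; exact hE0' β
      | succ n =>
        rw [hE_succ]
        exact (le_sup_right : _ ≤ E n ⊔ _) (IntermediateField.mem_adjoin_simple_self _ _)
    let J : ℕ → ℕ := fun n => ((Finset.range n).filter fun i =>
      ¬ NonSplit K (p ^ r) (algebraMap F Ω (cF k F)) (γ i)).card
    have hbd : ∀ n, ∀ y ∈ E n, fr.w (fr.DC y) ≤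
        (A0 * fr.w (p : fr.C) ^ J n / (fr.w (p : fr.C) ^ r) ^ n) * fr.w y := by
      intro n
      induction n with
      | zero =>
        intro y hy
        simpa [J] using hbd0 y hy
      | succ n ih =>
        intro y hy
        rw [hE_succ] at hy
        have hpow : ι (γ (n + 1)) ^ p ^ r ∈ E n := by
          have : ι (γ (n + 1)) ^ p ^ r = ι (γ n) - ι (algebraMap K Ω (algebraMap F K (cF k F))) := by
            rw [← hcK, ← hγ n, map_add, map_pow]; ring
          rw [this]
          exact sub_mem (hE_γ n) (hE_K n (hE0' _))
        by_cases hspl : NonSplit K (p ^ r) (algebraMap F Ω (cF k F)) (γ n)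
        · have hJ : J (n + 1) = J n := by
            simp only [J]
            rw [Finset.range_add_one, Finset.filter_insert, if_neg (not_not.2 hspl)]
          have := bd_iter fr.w fr.nonarch fr.inv p hp hwp1 hζB fr.DC hvalB (E n) _ (by positivity)
            ih r (ι (γ (n + 1))) hpow y hy
          rwa [div_div, ← pow_succ, ← hJ] at this
        · have hJ : J (n + 1) = J n + 1 := by
            simp only [J]
            rw [Finset.range_add_one, Finset.filter_insert, if_pos hspl,
              Finset.card_insert_of_notMem (by simp)]
          have hsp := split_pow (K := K) (ι : Ω →+* fr.C) (E n) (fun a => hE_K n (hE0' a)) p r hp hr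
            hζK (algebraMap F K (cF k F)) (γ (n + 1)) (by rw [← hcK, hγ n]; exact hE_γ n)
            (by rw [← hcK, hγ n]; exact hspl)
          have := bd_iter fr.w fr.nonarch fr.inv p hp hwp1 hζB fr.DC hvalB (E n) _ (by positivity)
            ih (r - 1) (ι (γ (n + 1))) hsp y hy
          refine this.trans (le_of_eq ?_)
          congr 1
          rw [hJ]
          have hr' : fr.w (p : fr.C) ^ r = fr.w (p : fr.C) ^ (r - 1) * fr.w (p : fr.C) := by
            rw [← pow_succ, Nat.sub_add_cancel hr]
          rw [pow_succ _ n, hr', pow_succ]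
          field_simp
    have hJmono : Monotone J := by
      intro a b hab
      exact Finset.card_le_card (Finset.filter_subset_filter _ (Finset.range_mono hab))
    have hJunb : ∀ m, ∃ n, m ≤ J n := by
      intro m
      induction m with
      | zero => exact ⟨0, Nat.zero_le _⟩
      | succ m ih =>
        obtain ⟨n, hn⟩ := ih
        obtain ⟨n', hn', hsp⟩ := hγs n
        refine ⟨n' + 1, ?_⟩
        have h1 := hJmono hn'
        have h2 : J (n' + 1) = J n' + 1 := by
          simp only [J]
          rw [Finset.range_add_one, Finset.filter_insert, if_pos hsp,
            Finset.card_insert_of_notMem (by simp)]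
        omega
    set R := max 1 (fr.w (ι (γ 0))) with hR
    have hR0 : 0 < R := one_pos.trans_le (le_max_left _ _)
    have hwγ : ∀ n, fr.w (ι (γ n)) ≤ R := by
      intro n
      have h1 := path_max_pow fr.w fr.nonarch p r hp cM hwc _ (hpath γ hγ) n
      refine (le_max_right 1 _).trans (le_trans ?_ h1)
      exact le_self_pow₀ (le_max_left _ _) (pow_ne_zero _ (pow_ne_zero _ hp.ne_zero))
    have hT : 0 < A0 * R / (fr.w (p : fr.C) ^ r) ^ N := by positivity
    obtain ⟨m, hm⟩ := exists_pow_lt_of_lt_one (div_pos hg hT) hwp1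
    obtain ⟨n, hn⟩ := hJunb m
    have h1 := hgj n
    have h2 := hbd (N + n) _ (hE_γ (N + n))
    have h3 : fr.w (p : fr.C) ^ J (N + n) ≤ fr.w (p : fr.C) ^ m :=
      pow_le_pow_of_le_one hwp0.le hwp1.le (hn.trans (hJmono (by omega)))
    have h4 : g ≤ A0 * R / (fr.w (p : fr.C) ^ r) ^ N * fr.w (p : fr.C) ^ m := by
      calc g ≤ (fr.w (p : fr.C) ^ r) ^ n * fr.w (fr.DC (ι (γ (N + n)))) := h1
        _ ≤ (fr.w (p : fr.C) ^ r) ^ n * (A0 * fr.w (p : fr.C) ^ m / (fr.w (p : fr.C) ^ r) ^ (N + n) * R) := by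
          gcongr
          refine h2.trans ?_
          gcongr
          exact hwγ _
        _ = _ := by
          rw [pow_add]; field_simp
    rw [lt_div_iff₀ hT] at hm
    linarith
  refine ⟨n0, fun n hn => ?_⟩
  have hΩ0 : CharZero Ω := charZero_of_injective_ringHom (algebraMap F Ω).injective
  refine step_fix (E := K) _ _ fun τ hτ => ?_
  have hτc : τ (algebraMap F Ω (cF k F)) = algebraMap F Ω (cF k F) := by rw [hcK]; exact τ.commutes _
  have hτα : IsPath (p ^ r) (algebraMap F Ω (cF k F)) (fun n => τ (α n)) := by
    intro n
    change τ (α (n + 1)) ^ p ^ r + _ = τ (α n)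
    rw [← hα n, map_add, map_pow, hτc]
  have hτ0 : τ (α 0) = algebraMap K Ω β := by rw [h0]; exact τ.commutes _
  have hτs : ∀ m, ∃ n ≥ m, ¬ NonSplit K (p ^ r) (algebraMap F Ω (cF k F)) (τ (α n)) := by
    intro m
    obtain ⟨n, hn, h⟩ := hs m
    refine ⟨n, hn, fun h' => h ?_⟩
    have := h'.conj τ.symm (by rw [AlgEquiv.symm_apply_eq, hτc])
    rwa [τ.symm_apply_apply] at this
  have := path_unique fr.w fr.nonarch p r hp hr hwp1 fr.DC cM hwc hDc (fun n => ι (α n))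
    (fun n => ι (τ (α n))) (hpath _ hα) (hpath _ hτα) n0
    (fun n hn => hn0 _ (hpath _ hα) (by simp [h0]) n hn)
    (fun n hn => hn0 _ (hpath _ hτα) (by simp [h0]) n hn)
    (hbad α hα h0 hs) (hbad _ hτα hτ0 hτs) (by simp only [hτ]) n hn
  exact (ι.injective this).symm
end badpath

section places
variable (k : Type*) (F : Type u) [Field k] [CharZero k] [IsAlgClosed k] [Field F] [CharZero F]
  [Algebra k[X] F] [IsFractionRing k[X] F]
  (L : Type*) [Field L] [Algebra F L] [FiniteDimensional F L]

/-- a polynomial in the parameter, as an element of `L` -/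
noncomputable def pol (F L : Type*) [Field F] [Algebra k[X] F] [Field L] [Algebra F L] : k[X] →+* L :=
  (algebraMap F L).comp (algebraMap k[X] F)

theorem pol_ne {P : k[X]} (hP : P ≠ 0) : pol k F L P ≠ 0 := by
  simp only [pol, RingHom.comp_apply]
  rw [map_ne_zero_iff _ (algebraMap F L).injective, map_ne_zero_iff _ (IsFractionRing.injective k[X] F)]
  exact hP

theorem pol_map {M : Type*} [Field M] [Algebra F M] (σ : L →ₐ[F] M) (P : k[X]) :
    σ (pol k F L P) = algebraMap F M (algebraMap k[X] F P) := by
  simp [pol]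

variable {L}
/-- local integrality at all finite points -/
def LInt (x : L) : Prop := ∀ (a : k) (σ : L →ₐ[F] (frPt F a).C), (frPt F a).w (σ x) ≤ 1

variable {k F}
theorem LInt.mul {x y : L} (hx : LInt k F x) (hy : LInt k F y) : LInt k F (x * y) := by
  intro a σ
  rw [map_mul, map_mul]
  exact mul_le_one₀ (hx a σ) ((frPt F a).w.nonneg _) (hy a σ)

theorem LInt.add {x y : L} (hx : LInt k F x) (hy : LInt k F y) : LInt k F (x + y) := by
  intro a σ
  rw [map_add]
  exact ((frPt F a).nonarch _ _).trans (max_le (hx a σ) (hy a σ))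

theorem LInt.sub {x y : L} (hx : LInt k F x) (hy : LInt k F y) : LInt k F (x - y) := by
  intro a σ
  rw [map_sub]
  exact (na_sub _ (frPt F a).nonarch _ _).trans (max_le (hx a σ) (hy a σ))

theorem LInt.pow {x : L} (hx : LInt k F x) (n : ℕ) : LInt k F (x ^ n) := by
  intro a σ
  rw [map_pow, map_pow]
  exact pow_le_one₀ ((frPt F a).w.nonneg _) (hx a σ)

theorem LInt.pol (P : k[X]) : LInt k F (pol k F L P) := by
  intro a σ
  rw [pol_map, (frPt F a).ext]
  exact vpt_poly_le F a P

variable (k F)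
theorem lint_of_integral (x : L) (h : (pol k F L).IsIntegralElem x) : LInt k F x := by
  obtain ⟨P, hP, hx⟩ := h
  intro a σ
  have hm : (P.map ((algebraMap F (frPt F a).C).comp (algebraMap k[X] F))).Monic := hP.map _
  refine na_root_le _ (frPt F a).nonarch _ hm ?_ (σ x) ?_
  · intro i
    rw [coeff_map, RingHom.comp_apply, (frPt F a).ext]
    exact vpt_poly_le F a _
  · have := congrArg σ hx
    rw [map_zero] at this
    rw [← this, eval_map]
    change _ = (σ : L →+* (frPt F a).C) _
    rw [hom_eval₂]
    congr 1
    exact RingHom.ext fun z => by simp [pol]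

theorem exists_clear (x : L) : ∃ s : k[X], s ≠ 0 ∧ LInt k F (pol k F L s * x) := by
  letI : Algebra k[X] L := (pol k F L).toAlgebra
  haveI : IsScalarTower k[X] F L := IsScalarTower.of_algebraMap_eq fun _ => rfl
  have h1 : IsAlgebraic F x := Algebra.IsAlgebraic.isAlgebraic x
  have h2 : IsAlgebraic k[X] x := (IsFractionRing.isAlgebraic_iff k[X] F L).2 h1
  obtain ⟨s, hs, h⟩ := h2.exists_integral_multiple
  refine ⟨s, hs, lint_of_integral k F _ ?_⟩
  rw [Algebra.smul_def] at h
  exact h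

theorem exists_clear_inf (T : Set L) (hT : T.Finite) :
    ∃ s : k[X], s ≠ 0 ∧ ∀ x ∈ T, LInt k F (pol k F L s * x) := by
  induction T, hT using Set.Finite.induction_on with
  | empty => exact ⟨1, one_ne_zero, by simp⟩
  | @insert x T hx hT ih =>
    obtain ⟨s, hs, h⟩ := ih
    obtain ⟨t, ht, h'⟩ := exists_clear k F x
    refine ⟨s * t, mul_ne_zero hs ht, ?_⟩
    intro y hy
    rw [map_mul]
    rcases hy with rfl | hy
    · rw [mul_assoc]
      exact (LInt.pol s).mul h'
    · rw [mul_comm (pol k F L s), mul_assoc]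
      exact (LInt.pol t).mul (h y hy)

instance frC_charZero {D : Derivation ℤ F F} {v : AbsoluteValue F ℝ} (fr : Frame F D v) : CharZero fr.C :=
  charZero_of_injective_algebraMap (algebraMap F fr.C).injective

/-- Norm lemma -/
theorem norm_poly (x : L) (hx : x ≠ 0) (h : LInt k F x) : ∃ P : k[X], P ≠ 0 ∧
    (∀ a, (∃ σ : L →ₐ[F] (frPt F a).C, (frPt F a).w (σ x) < 1) → P.IsRoot a) ∧
    ∀ R : ℝ, (∀ σ : L →ₐ[F] (frInf k F).C, (frInf k F).w (σ x) ≤ R) →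
      (2 : ℝ) ^ P.natDegree ≤ R ^ Module.finrank F L := by
  haveI : Algebra.IsSeparable F L := inferInstance
  have hn : ∀ {D : Derivation ℤ F F} {v : AbsoluteValue F ℝ} (fr : Frame F D v),
      v (Algebra.norm F x) = ∏ σ : L →ₐ[F] fr.C, fr.w (σ x) := by
    intro D v fr
    haveI := fr.closed
    rw [← fr.ext, Algebra.norm_eq_prod_embeddings, map_prod]
  obtain ⟨P, hP⟩ := vpt_all_le (k := k) F (Algebra.norm F x) (fun a => by
    rw [hn (frPt F a)]
    exact Finset.prod_le_one (fun _ _ => (frPt F a).w.nonneg _) (fun σ _ => h a σ))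
  have hP0 : P ≠ 0 := by
    rintro rfl
    rw [map_zero] at hP
    exact hx (Algebra.norm_eq_zero_iff.1 hP)
  refine ⟨P, hP0, ?_, ?_⟩
  · rintro a ⟨σ, hσ⟩
    by_contra hr
    have h1 := vpt_poly_eq F a P hr
    rw [← hP, hn (frPt F a)] at h1
    classical
    rw [← Finset.mul_prod_erase _ _ (Finset.mem_univ σ)] at h1
    have h2 : ∏ τ ∈ Finset.univ.erase σ, (frPt F a).w (τ x) ≤ 1 :=
      Finset.prod_le_one (fun _ _ => (frPt F a).w.nonneg _) (fun σ _ => h a σ)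
    have h3 := (frPt F a).w.nonneg (σ x)
    nlinarith
  · intro R hR
    haveI := (frInf k F).closed
    rw [← vinf_poly k F P hP0, ← hP, hn (frInf k F), ← AlgHom.card F L (frInf k F).C]
    calc _ ≤ ∏ σ : L →ₐ[F] (frInf k F).C, R :=
          Finset.prod_le_prod (fun _ _ => (frInf k F).w.nonneg _) (fun σ _ => hR σ)
      _ = _ := by rw [Finset.prod_const, Finset.card_univ]

/-- a locally integral element with all infinite absolute values `< 1` is zero -/
theorem lint_eq_zero (x : L) (h : LInt k F x)
    (hR : ∀ σ : L →ₐ[F] (frInf k F).C, (frInf k F).w (σ x) < 1) : x = 0 := by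
  by_contra hx
  obtain ⟨P, hP, -, h2⟩ := norm_poly k F x hx h
  haveI := (frInf k F).closed
  haveI : Nonempty (L →ₐ[F] (frInf k F).C) := ⟨IsAlgClosed.lift⟩
  obtain ⟨σ, hσ⟩ := Finite.exists_max (fun σ : L →ₐ[F] (frInf k F).C => (frInf k F).w (σ x))
  have h3 := h2 _ hσ
  have h4 : (1:ℝ) ≤ 2 ^ P.natDegree := one_le_pow₀ (by norm_num)
  have h5 := pow_lt_one₀ ((frInf k F).w.nonneg (σ x)) (hR σ) (Module.finrank_pos (R := F) (M := L)).ne'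
  linarith

theorem fin_le (x : L) : ∃ S : Finset k, ∀ a ∉ S, ∀ σ : L →ₐ[F] (frPt F a).C, (frPt F a).w (σ x) ≤ 1 := by
  classical
  obtain ⟨s, hs, h⟩ := exists_clear k F x
  refine ⟨s.roots.toFinset, fun a ha σ => ?_⟩
  have h1 := h a σ
  have h2 : s.eval a ≠ 0 := by
    intro h2
    apply ha
    simp [hs, h2]
  rwa [map_mul, map_mul, pol_map, (frPt F a).ext, vpt_poly_eq F a s h2, one_mul] at h1

theorem fin_eq (x : L) (hx : x ≠ 0) :
    ∃ S : Finset k, ∀ a ∉ S, ∀ σ : L →ₐ[F] (frPt F a).C, (frPt F a).w (σ x) = 1 := by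
  classical
  obtain ⟨S, hS⟩ := fin_le k F x
  obtain ⟨T, hT⟩ := fin_le k F x⁻¹
  refine ⟨S ∪ T, fun a ha σ => ?_⟩
  rw [Finset.notMem_union] at ha
  refine le_antisymm (hS a ha.1 σ) ?_
  have h1 := hT a ha.2 σ
  rw [map_inv₀, map_inv₀] at h1
  have h0 : 0 < (frPt F a).w (σ x) := (frPt F a).w.pos (by simpa using hx)
  exact (inv_le_one₀ h0).1 h1

/-- finite union over a finite set -/
theorem fin_all {ι : Type*} (T : Set ι) (hT : T.Finite) (Q : ι → k → Prop)
    (h : ∀ i ∈ T, ∃ S : Finset k, ∀ a ∉ S, Q i a) : ∃ S : Finset k, ∀ a ∉ S, ∀ i ∈ T, Q i a := by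
  classical
  choose! S hS using h
  refine ⟨hT.toFinset.biUnion S, fun a ha i hi => hS i hi a ?_⟩
  intro h'
  exact ha (Finset.mem_biUnion.2 ⟨i, hT.mem_toFinset.2 hi, h'⟩)

theorem fin_mem1 (x : L) : ∃ S : Finset k, ∀ a ∉ S, ∀ σ : L →ₐ[F] (frPt F a).C, σ x ∈ (frPt F a).B := by
  classical
  let m := minpoly F x
  let M := m.SplittingField
  let T : Set M := {z | z ≠ 0 ∧ ∃ y1 ∈ m.rootSet M, ∃ y2 ∈ m.rootSet M, z = y1 - y2}
  have hT : T.Finite := by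
    refine ((m.rootSet_finite M).prod (m.rootSet_finite M) |>.image (fun y => y.1 - y.2)).subset ?_
    rintro z ⟨-, y1, h1, y2, h2, rfl⟩
    exact ⟨(y1, y2), ⟨h1, h2⟩, rfl⟩
  obtain ⟨S, hS⟩ := fin_all k T hT (fun z a => ∀ σ : M →ₐ[F] (frPt F a).C, (frPt F a).w (σ z) = 1)
    (fun z hz => fin_eq k F z hz.1)
  obtain ⟨S', hS'⟩ := fin_le k F x
  refine ⟨S ∪ S', fun a ha σ => ?_⟩
  rw [Finset.notMem_union] at ha
  haveI := (frPt F a).closed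
  refine frPt_mem F a _ (hS' a ha.2 σ) ?_
  intro τ hτ
  let ρ : M →ₐ[F] (frPt F a).C := IsAlgClosed.lift
  have hm0 : m ≠ 0 := minpoly.ne_zero (Algebra.IsIntegral.isIntegral x)
  have hsp : (m.map (algebraMap F M)).Splits := SplittingField.splits m
  have key : ∀ σ' : L →ₐ[F] (frPt F a).C, ∃ y ∈ m.rootSet M, ρ y = σ' x := by
    intro σ'
    have h1 : σ' x ∈ m.rootSet (frPt F a).C := by
      rw [mem_rootSet]
      exact ⟨hm0, by rw [aeval_algHom_apply, minpoly.aeval, map_zero]⟩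
    rw [← hsp.image_rootSet ρ] at h1
    obtain ⟨y, hy, e⟩ := h1
    exact ⟨y, hy, e⟩
  obtain ⟨y1, hy1, e1⟩ := key σ
  obtain ⟨y2, hy2, e2⟩ := key ((τ.toAlgHom.restrictScalars F).comp σ)
  have e2' : ρ y2 = τ (σ x) := e2
  by_contra hne
  have := hS a ha.1 (y1 - y2) ⟨?_, y1, hy1, y2, hy2, rfl⟩ ρ
  · rw [map_sub, e1, e2'] at this
    linarith
  · intro h
    apply hne
    rw [← e2', ← e1, sub_eq_zero.1 h]

variable (L) in
theorem fin_mem : ∃ S : Finset k, ∀ a ∉ S, ∀ σ : L →ₐ[F] (frPt F a).C, ∀ x, σ x ∈ (frPt F a).B := by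
  let b := Module.finBasis F L
  obtain ⟨S, hS⟩ := fin_all k Set.univ Set.finite_univ
    (fun i a => ∀ σ : L →ₐ[F] (frPt F a).C, σ (b i) ∈ (frPt F a).B)
    (fun i _ => fin_mem1 k F (b i))
  refine ⟨S, fun a ha σ x => ?_⟩
  rw [← b.sum_repr x, map_sum]
  refine sum_mem fun i _ => ?_
  rw [map_smul, Algebra.smul_def]
  exact mul_mem (IntermediateField.algebraMap_mem _ _) (hS a ha i trivial σ)

theorem deriv_bdd (D : Derivation ℤ L L) (hD : ∀ x, D (algebraMap F L x) = algebraMap F L (dF k F x))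
    {v : AbsoluteValue F ℝ} (fr : Frame F (dF k F) v) :
    ∃ A > 0, ∀ (σ : L →ₐ[F] fr.C) (x : L), fr.w (σ (D x)) ≤ A * fr.w (σ x) := by
  have h1 : ∀ σ : L →ₐ[F] fr.C, ∃ A > 0, ∀ x : L, fr.w (σ (D x)) ≤ A * fr.w (σ x) := by
    intro σ
    haveI := fr.algB
    obtain ⟨E, hE, h⟩ := finite_image_field F (B := fr.B) σ
    obtain ⟨A, hA, hA'⟩ := fr.DC_bdd E hE
    refine ⟨A, hA, fun x => ?_⟩
    rw [← deriv_compat (dF k F) D fr.DC hD fr.DC_ext σ x]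
    exact hA' _ (h x)
  choose A hA h using h1
  haveI := fr.closed
  haveI : Nonempty (L →ₐ[F] fr.C) := ⟨IsAlgClosed.lift⟩
  obtain ⟨σ0, h0⟩ := Finite.exists_max A
  exact ⟨A σ0, hA _, fun σ x => (h σ x).trans
    (mul_le_mul_of_nonneg_right (h0 σ) (fr.w.nonneg _))⟩

end places

section northinf
variable {M : Type*} [Field M] [CharZero M] [IsAlgClosed M] (w : AbsoluteValue M ℝ) (hw : IsNonarchimedean w)
  (q : ℕ) (hq : 2 ≤ q) (c : M) (hc : w c = 2)
  (hζ : ∀ ζ : M, ζ ^ q = 1 → ζ ≠ 1 → w (1 - ζ) = 1)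

theorem inf_event (y : ℕ → M) (hw : IsNonarchimedean w) (hq : 2 ≤ q) (hc : w c = 2) (hy : IsPath q c y) :
    ∃ n1, ∀ n ≥ n1, w (y n) ^ q = 2 := by
  have hy' : ∀ n, w (y (n + 1)) ^ q = w (c - y n) := by
    intro n
    rw [← map_pow, ← hy n, ← map_neg_eq_map]
    congr 1; ring
  by_cases h : ∃ n, w (y n) < 2
  · obtain ⟨n, hn⟩ := h
    refine ⟨n + 1, fun m hm => ?_⟩
    have step : ∀ m, w (y m) < 2 → w (y (m + 1)) ^ q = 2 := by
      intro m hm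
      rw [hy', ← hc]
      rw [sub_eq_add_neg]
      apply na_add_eq w hw
      rwa [map_neg_eq_map, hc]
    have lt : ∀ m, w (y m) ^ q = 2 → w (y m) < 2 := by
      intro m hm
      by_contra! h
      have : (2:ℝ) ^ q ≤ w (y m) ^ q := by gcongr
      have : (2:ℝ) ^ 2 ≤ 2 ^ q := pow_le_pow_right₀ (by norm_num) hq
      linarith
    induction m, hm using Nat.le_induction with
    | base => exact step n hn
    | succ m hm ih => exact step m (lt m ih)
  · push Not at h
    exfalso
    have h1 : ∀ n, w (y (n + 1)) ^ q ≤ w (y n) := by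
      intro n
      rw [hy']
      refine (na_sub w hw _ _).trans (max_le ?_ le_rfl)
      rw [hc]; exact h n
    have h2 : ∀ n, w (y n) ^ q ^ n ≤ w (y 0) := by
      intro n
      induction n with
      | zero => simp
      | succ n ih =>
        rw [pow_succ', pow_mul]
        refine le_trans ?_ ih
        exact pow_le_pow_left₀ (by positivity) (h1 n) _
    obtain ⟨n, hn⟩ := pow_unbounded_of_one_lt (w (y 0)) (show (1:ℝ) < 2 by norm_num)
    have h3 : (2:ℝ) ^ q ^ n ≤ w (y n) ^ q ^ n := pow_le_pow_left₀ (by norm_num) (h n) _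
    have h4 : (2:ℝ) ^ n ≤ 2 ^ q ^ n := pow_le_pow_right₀ (by norm_num) (Nat.lt_pow_self (by omega)).le
    linarith [h2 n]

theorem pow_sub_prod (x y : M) (hq : 0 < q) : x ^ q - y ^ q = ∏ ζ ∈ nthRootsFinset q (1 : M), (x - ζ * y) := by
  have : NeZero (q : M) := ⟨Nat.cast_ne_zero.2 hq.ne'⟩
  obtain ⟨z, hz⟩ := HasEnoughRootsOfUnity.exists_primitiveRoot M q
  exact hz.pow_sub_pow_eq_prod_sub_mul _ _ hq

theorem card_roots1 (hq : 0 < q) : (nthRootsFinset q (1 : M)).card = q := by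
  have : NeZero (q : M) := ⟨Nat.cast_ne_zero.2 hq.ne'⟩
  obtain ⟨z, hz⟩ := HasEnoughRootsOfUnity.exists_primitiveRoot M q
  exact hz.card_nthRootsFinset

theorem w_zeta (hq : 2 ≤ q) {ζ : M} (h : ζ ∈ nthRootsFinset q (1 : M)) : w ζ = 1 := by
  rw [mem_nthRootsFinset (by omega)] at h
  have : w ζ ^ q = 1 := by rw [← map_pow, h, map_one]
  exact (pow_eq_one_iff_of_nonneg (w.nonneg _) (by omega)).1 this

theorem inf_sym (hw : IsNonarchimedean w) (hq : 2 ≤ q) (ρ : M) (hρ : ρ ^ q = -c) (hc : w c = 2) (y : M)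
    (hy : w y ^ q = 2) (hy' : w (y ^ q + c) = w ρ) :
    ∃ ζ : nthRootsFinset q (1 : M), w (y - ζ * ρ) < w ρ := by
  by_contra! hcon
  have hR : w ρ ^ q = 2 := by rw [← map_pow, hρ, map_neg_eq_map, hc]
  have hyρ : w y = w ρ := (pow_left_inj₀ (w.nonneg _) (w.nonneg _) (by omega : q ≠ 0)).1 (hy.trans hR.symm)
  have h1 : ∀ ζ ∈ nthRootsFinset q (1 : M), w (y - ζ * ρ) = w ρ := by
    intro ζ h
    refine le_antisymm ?_ (hcon ⟨ζ, h⟩)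
    refine (na_sub w hw _ _).trans (max_le hyρ.le ?_)
    rw [map_mul, w_zeta w q hq h, one_mul]
  have h2 : y ^ q + c = ∏ ζ ∈ nthRootsFinset q (1 : M), (y - ζ * ρ) := by
    rw [← pow_sub_prod q y ρ (by omega), hρ, sub_neg_eq_add]
  rw [h2, map_prod, Finset.prod_congr rfl h1, Finset.prod_const, card_roots1 q (by omega), hR] at hy'
  rw [← hy'] at hR
  have : (2:ℝ) ^ 2 ≤ 2 ^ q := pow_le_pow_right₀ (by norm_num) hq
  linarith

theorem inf_contr (hw : IsNonarchimedean w) (hq : 2 ≤ q) (hζ : ∀ ζ : M, ζ ^ q = 1 → ζ ≠ 1 → w (1 - ζ) = 1)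
    (R : ℝ) (y z : M) (hz : w z = R) (h : w (y - z) < R) :
    w (y ^ q - z ^ q) = w (y - z) * R ^ (q - 1) := by
  classical
  have h1 : (1 : M) ∈ nthRootsFinset q (1 : M) := by
    rw [mem_nthRootsFinset (by omega)]; simp
  rw [pow_sub_prod q y z (by omega), map_prod, ← Finset.mul_prod_erase _ _ h1, one_mul]
  congr 1
  have : ∀ ζ ∈ (nthRootsFinset q (1 : M)).erase 1, w (y - ζ * z) = R := by
    intro ζ h'
    rw [Finset.mem_erase, mem_nthRootsFinset (by omega)] at h'
    have h2 : w ((1 - ζ) * z) = R := by rw [map_mul, hζ ζ h'.2 h'.1, one_mul, hz]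
    rw [← h2, show y - ζ * z = (1 - ζ) * z + (y - z) by ring]
    apply na_add_eq w hw
    rwa [h2]
  rw [Finset.prod_congr rfl this, Finset.prod_const, Finset.card_erase_of_mem h1, card_roots1 q (by omega)]

/-- approach along equal symbols -/
theorem inf_close (hw : IsNonarchimedean w) (hq : 2 ≤ q) (hζ : ∀ ζ : M, ζ ^ q = 1 → ζ ≠ 1 → w (1 - ζ) = 1)
    (R : ℝ) (y z : ℕ → M) (hy : IsPath q c y) (hz : IsPath q c z) (hyR : ∀ n, w (y n) = R)
    (hzR : ∀ n, w (z n) = R) (m : ℕ) (h : ∀ i < m, w (y (i + 1) - z (i + 1)) < R) :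
    w (y m - z m) * (R ^ (q - 1)) ^ m ≤ R := by
  induction m with
  | zero =>
    simp only [pow_zero, mul_one]
    refine (na_sub w hw _ _).trans ?_
    rw [hyR, hzR, max_self]
  | succ m ih =>
    have h1 := inf_contr w q hw hq hζ R (y (m + 1)) (z (m + 1)) (hzR _) (h m (by omega))
    have h2 : y (m + 1) ^ q - z (m + 1) ^ q = y m - z m := by
      rw [← hy m, ← hz m]; ring
    rw [h2] at h1
    rw [pow_succ', ← mul_assoc, ← h1]
    exact ih fun i hi => h i (by omega)
end northinf

section northcott
variable (k : Type*) (F : Type u) [Field k] [CharZero k] [IsAlgClosed k] [Field F] [CharZero F]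
  [Algebra k[X] F] [IsFractionRing k[X] F]
  {L : Type*} [Field L] [Algebra F L] [FiniteDimensional F L]

theorem frInf_zeta (q : ℕ) (hq : 0 < q) (ζ : (frInf k F).C) (h : ζ ^ q = 1) (h1 : ζ ≠ 1) :
    (frInf k F).w (1 - ζ) = 1 := by
  obtain ⟨z, hz, rfl⟩ := root_unity_lift ((algebraMap F (frInf k F).C).comp (kF k F)) q hq ζ h
  rw [← map_one ((algebraMap F (frInf k F).C).comp (kF k F)), ← map_sub, RingHom.comp_apply, (frInf k F).ext]
  have hz1 : 1 - z ≠ 0 := by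
    intro h
    apply h1
    rw [← sub_eq_zero.1 h, map_one]
  rw [kF, RingHom.comp_apply, vinf_poly k F _ (C_ne_zero.2 hz1)]
  simp

theorem frInf_c : (frInf k F).w (algebraMap F (frInf k F).C (cF k F)) = 2 := by
  rw [(frInf k F).ext, cF, vinf_poly _ _ _ X_ne_zero]
  simp

theorem frPt_c_le (a : k) : (frPt F a).w (algebraMap F (frPt F a).C (cF k F)) ≤ 1 := by
  rw [(frPt F a).ext, cF]
  exact vpt_poly_le F a X

theorem path_map {A B : Type*} [Field A] [Field B] (σ : A →+* B) {q : ℕ} {c : A} {y : ℕ → A} (h : IsPath q c y) :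
    IsPath q (σ c) (fun n => σ (y n)) := by
  intro n
  have := congrArg σ (h n)
  simpa using this

theorem northcott (q : ℕ) (hq : 2 ≤ q) (x : ℕ → L) (hx : IsPath q (algebraMap F L (cF k F)) x) :
    ∃ n m, n ≠ m ∧ x n = x m := by
  obtain ⟨s, hs, hsx⟩ := exists_clear k F (x 0)
  have hall : ∀ n, LInt k F (pol k F L s * x n) := by
    intro n a σ
    have h1 : ∀ n, (frPt F a).w (σ (x n)) ≤ max 1 ((frPt F a).w (σ (x 0))) := by
      intro n
      induction n with
      | zero => exact le_max_right _ _
      | succ n ih =>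
        set Mx := max 1 ((frPt F a).w (σ (x 0)))
        have hM : 1 ≤ Mx := le_max_left _ _
        have h2 : (frPt F a).w (σ (x (n + 1))) ^ q ≤ Mx := by
          have h3 : σ (x (n + 1)) ^ q = σ (x n) - algebraMap F _ (cF k F) := by
            rw [← hx n]; simp
          rw [← map_pow, h3]
          exact (na_sub _ (frPt F a).nonarch _ _).trans (max_le ih ((frPt_c_le k F a).trans hM))
        have h4 : (frPt F a).w (σ (x (n + 1))) ^ q ≤ Mx ^ q := h2.trans (le_self_pow₀ hM (by omega))
        exact (pow_le_pow_iff_left₀ ((frPt F a).w.nonneg _) (by linarith) (by omega)).1 h4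
    have h5 := hsx a σ
    have h6 := LInt.pol (F := F) (L := L) s a σ
    rw [map_mul, map_mul] at h5 ⊢
    calc _ ≤ (frPt F a).w (σ (pol k F L s)) * max 1 ((frPt F a).w (σ (x 0))) :=
          mul_le_mul_of_nonneg_left (h1 n) ((frPt F a).w.nonneg _)
      _ = max _ _ := mul_max_of_nonneg _ _ ((frPt F a).w.nonneg _)
      _ ≤ 1 := max_le (by simpa using h6) h5
  set fr := frInf k F
  haveI := fr.closed
  obtain ⟨ρ, hρ⟩ := IsAlgClosed.exists_pow_nat_eq (-(algebraMap F fr.C (cF k F))) (show 0 < q by omega)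
  set R := fr.w ρ
  have hc := frInf_c k F
  have hR : R ^ q = 2 := by
    change fr.w ρ ^ q = 2
    rw [← map_pow, hρ, map_neg_eq_map]; exact hc
  have hR0 : 0 ≤ R := fr.w.nonneg _
  have hR1 : 1 < R := by
    by_contra! h
    have := pow_le_one₀ (n := q) hR0 h
    linarith
  have hpath : ∀ σ : L →ₐ[F] fr.C, IsPath q (algebraMap F fr.C (cF k F)) (fun n => σ (x n)) := by
    intro σ
    have := path_map (σ : L →+* fr.C) hx
    simpa using this
  have hev : ∀ σ : L →ₐ[F] fr.C, ∃ n1, ∀ n ≥ n1, fr.w (σ (x n)) = R := by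
    intro σ
    obtain ⟨n1, h⟩ := inf_event fr.w q _ _ fr.nonarch hq hc (hpath σ)
    exact ⟨n1, fun n hn => (pow_left_inj₀ (fr.w.nonneg _) hR0 (by omega : q ≠ 0)).1 ((h n hn).trans hR.symm)⟩
  choose n1 hn1 using hev
  obtain ⟨N1, hN1⟩ : ∃ N1, ∀ σ, n1 σ ≤ N1 := by
    haveI : Nonempty (L →ₐ[F] fr.C) := ⟨IsAlgClosed.lift⟩
    obtain ⟨σ0, h⟩ := Finite.exists_max n1
    exact ⟨_, h⟩
  have hsym : ∀ (σ : L →ₐ[F] fr.C) (n : ℕ), ∃ ζ : nthRootsFinset q (1 : fr.C),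
      fr.w (σ (x (N1 + n + 1)) - ζ * ρ) < R := by
    intro σ n
    apply inf_sym fr.w q _ fr.nonarch hq ρ hρ hc
    · rw [hn1 σ _ (by have := hN1 σ; omega), hR]
    · have := hpath σ (N1 + n)
      simp only at this
      rw [this]
      exact hn1 σ _ (by have := hN1 σ; omega)
  choose sym hsym using hsym
  obtain ⟨m, hm⟩ : ∃ m : ℕ, 2 ^ s.natDegree * R < (R ^ (q - 1)) ^ m :=
    pow_unbounded_of_one_lt _ (one_lt_pow₀ hR1 (by omega))
  obtain ⟨a, b, hab, heq⟩ := Finite.exists_ne_map_eq_of_infinite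
    (fun n : ℕ => fun (σ : L →ₐ[F] fr.C) (i : Fin m) => sym σ (n + i))
  refine ⟨N1 + a + m, N1 + b + m, by omega, ?_⟩
  have h0 : pol k F L s * (x (N1 + a + m) - x (N1 + b + m)) = 0 := by
    refine lint_eq_zero k F _ ?_ ?_
    · rw [mul_sub]
      exact (hall _).sub (hall _)
    · intro σ
      have h1 := inf_close fr.w q (algebraMap F fr.C (cF k F)) fr.nonarch hq
        (frInf_zeta k F q (by omega)) R (fun n => σ (x (N1 + a + n))) (fun n => σ (x (N1 + b + n)))
        (fun n => hpath σ (N1 + a + n)) (fun n => hpath σ (N1 + b + n))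
        (fun n => hn1 σ _ (by have := hN1 σ; omega)) (fun n => hn1 σ _ (by have := hN1 σ; omega)) m ?_
      · rw [map_mul, map_mul, pol_map, fr.ext, vinf_poly k F s hs, map_sub]
        have hpos : 0 < (R ^ (q - 1)) ^ m := by positivity
        by_contra! hcon
        have h2 : 2 ^ s.natDegree * (fr.w (σ (x (N1 + a + m)) - σ (x (N1 + b + m))) * (R ^ (q - 1)) ^ m)
            ≤ 2 ^ s.natDegree * R := by gcongr
        nlinarith
      · intro i hi
        have h3 := congrFun (congrFun heq σ) ⟨i, hi⟩
        simp only at h3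
        have h4 := hsym σ (a + i)
        have h5 := hsym σ (b + i)
        rw [h3] at h4
        have h6 := na_sub fr.w fr.nonarch _ _ |>.trans_lt (max_lt h4 h5)
        rw [sub_sub_sub_cancel_right] at h6
        simpa only [add_assoc] using h6
  rcases mul_eq_zero.1 h0 with h | h
  · exact absurd h (pol_ne k F L hs)
  · exact sub_eq_zero.1 h
end northcott

/-- the map x ↦ x^q + c -/
def fmap {Ω : Type*} [Field Ω] (q : ℕ) (c : Ω) (x : Ω) : Ω := x ^ q + c

section konig
variable {K Ω : Type*} [Field K] [Field Ω] [Algebra K Ω]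

theorem path_iter {q : ℕ} {c : Ω} {α : ℕ → Ω} (h : IsPath q c α) (n m : ℕ) :
    (fmap q c)^[n] (α (m + n)) = α m := by
  induction n generalizing m with
  | zero => rfl
  | succ n ih =>
    rw [Function.iterate_succ_apply', show m + (n + 1) = (m + 1) + n by ring, ih (m + 1)]
    exact h m

theorem children_finite (q : ℕ) (hq : 0 < q) (c γ : Ω) : {x : Ω | fmap q c x = γ}.Finite := by
  classical
  have hne : (X ^ q + C (c - γ) : Polynomial Ω) ≠ 0 := X_pow_add_C_ne_zero hq _
  refine ((X ^ q + C (c - γ) : Polynomial Ω).roots.toFinset.finite_toSet).subset ?_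
  intro x hx
  have hx' : x ^ q + c = γ := hx
  simp only [Finset.mem_coe, Multiset.mem_toFinset, mem_roots hne, IsRoot.def, eval_add, eval_pow, eval_X, eval_C]
  rw [← hx']; ring

theorem konig (q : ℕ) (hq : 0 < q) (c : K) (β : Ω)
    (hbad : ∀ α : ℕ → Ω, IsPath q (algebraMap K Ω c) α → α 0 = β →
      ¬ ∀ m, ∃ n ≥ m, ¬ NonSplit K q (algebraMap K Ω c) (α n)) :
    ∃ N, ∀ n ≥ N, ∀ γ : Ω, (fmap q (algebraMap K Ω c))^[n] γ = β → NonSplit K q (algebraMap K Ω c) γ := by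
  by_contra! hcon
  set c' := algebraMap K Ω c with hc'
  let P : Ω → Prop := fun γ => ∀ j, ∃ n ≥ j, ∃ δ, (fmap q c')^[n] δ = γ ∧ ¬ NonSplit K q c' δ
  have hPβ : P β := hcon
  have hstep : ∀ γ : {γ // P γ}, ∃ γ' : {γ // P γ}, fmap q c' γ' = γ := by
    rintro ⟨γ, hγ⟩
    by_contra! hno
    have h1 : ∀ x ∈ {x : Ω | fmap q c' x = γ}, ∃ j, ∀ n ≥ j, ∀ δ, (fmap q c')^[n] δ = x → NonSplit K q c' δ := by
      intro x hx
      by_contra! h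
      exact hno ⟨x, h⟩ hx
    choose! j hj using h1
    obtain ⟨J, hJ⟩ := ((children_finite q hq c' γ).image j).bddAbove
    obtain ⟨n, hn, δ, hδ, hs⟩ := hγ (J + 1)
    obtain ⟨n, rfl⟩ : ∃ n', n = n' + 1 := ⟨n - 1, by omega⟩
    rw [Function.iterate_succ_apply'] at hδ
    refine hs (hj ((fmap q c')^[n] δ) hδ n ?_ δ rfl)
    have : j ((fmap q c')^[n] δ) ≤ J := hJ ⟨_, hδ, rfl⟩
    omega
  choose g hg using hstep
  let A : ℕ → {γ // P γ} := fun n => g^[n] ⟨β, hPβ⟩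
  let α : ℕ → Ω := fun n => A n
  have hα : IsPath q c' α := by
    intro n
    have := hg (A n)
    simp only [α, A, Function.iterate_succ_apply']
    exact this
  have := hbad α hα rfl
  push Not at this
  obtain ⟨m, hm⟩ := this
  have hconj : ∀ j δ, (fmap q c')^[j] δ = α m → ∃ τ : Ω ≃ₐ[K] Ω, τ (α (m + j)) = δ := by
    intro j
    induction j with
    | zero =>
      intro δ h
      exact ⟨AlgEquiv.refl, by simpa using h.symm⟩
    | succ j ih =>
      intro δ h
      rw [Function.iterate_succ_apply] at h
      obtain ⟨τ, hτ⟩ := ih _ h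
      have h1 : (τ.symm δ) ^ q + c' = α (m + j) := by
        apply τ.injective
        rw [hτ, map_add, map_pow, τ.apply_symm_apply, hc', τ.commutes]
        rfl
      obtain ⟨τ', h'⟩ := hm (m + j) (by omega) (α (m + j + 1)) (τ.symm δ) (hα (m + j)) h1
      refine ⟨τ'.trans τ, ?_⟩
      rw [AlgEquiv.trans_apply, ← add_assoc, h', τ.apply_symm_apply]
  obtain ⟨n, -, δ, hδ, hs⟩ := (A m).2 0
  obtain ⟨τ, rfl⟩ := hconj n δ hδ
  exact hs ((hm (m + n) (by omega)).conj τ (by rw [hc', τ.commutes]))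
end konig

section stable
variable (k : Type*) (F : Type u) [Field k] [CharZero k] [IsAlgClosed k] [Field F] [CharZero F]
  [Algebra k[X] F] [IsFractionRing k[X] F]
  {K Ω : Type*} [Field K] [Field Ω] [Algebra F K] [FiniteDimensional F K] [Algebra K Ω]
  [IsAlgClosure K Ω] [Algebra F Ω] [IsScalarTower F K Ω]

theorem stable_level (p r : ℕ) (hp : p.Prime) (hr : 1 ≤ r)
    (vk : AbsoluteValue k ℝ) (hvk : IsNonarchimedean vk) (hvp : vk p < 1) (β : K)
    (hper : ∀ n ≥ 1, (fmap (p ^ r) (algebraMap F K (cF k F)))^[n] β ≠ β) :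
    ∃ N, ∀ n ≥ N, ∀ γ : Ω, (fmap (p ^ r) (algebraMap F Ω (cF k F)))^[n] γ = algebraMap K Ω β →
      NonSplit K (p ^ r) (algebraMap F Ω (cF k F)) γ := by
  have hq : 2 ≤ p ^ r := hp.two_le.trans (Nat.le_self_pow (by omega) p)
  rw [IsScalarTower.algebraMap_apply F K Ω]
  apply konig (p ^ r) (by omega)
  rw [← IsScalarTower.algebraMap_apply F K Ω]
  intro α hα h0 hs
  obtain ⟨n0, hn0⟩ := bad_path k F p r hp hr vk hvk hvp β α hα h0 hs
  let L := IntermediateField.adjoin K {α n0}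
  haveI := IsAlgClosure.isAlgebraic (R := K) (K := Ω)
  haveI : FiniteDimensional K L := IntermediateField.adjoin.finiteDimensional (Algebra.IsIntegral.isIntegral _)
  haveI : FiniteDimensional F L := FiniteDimensional.trans F K L
  let x : ℕ → L := fun n => ⟨α (n0 + n), hn0 _ (by omega)⟩
  obtain ⟨n, m, hnm, h⟩ := northcott k F (p ^ r) hq x (by
    intro n
    apply Subtype.ext
    exact hα (n0 + n))
  have h' : α (n0 + n) = α (n0 + m) := congrArg Subtype.val h
  clear h
  have main : ∀ n m, n < m → α (n0 + n) = α (n0 + m) → False := by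
    intro n m hnm h
    have h1 := path_iter hα (n0 + n) 0
    have h2 := path_iter hα (n0 + n) (m - n)
    rw [show m - n + (n0 + n) = n0 + m by omega, ← h] at h2
    rw [zero_add, h2] at h1
    have h3 := path_iter hα (m - n) 0
    rw [zero_add, h1, h0] at h3
    apply hper (m - n) (by omega)
    apply (algebraMap K Ω).injective
    rw [← h3]
    have : Function.Semiconj (algebraMap K Ω) (fmap (p ^ r) (algebraMap F K (cF k F)))
        (fmap (p ^ r) (algebraMap F Ω (cF k F))) := by
      intro x
      simp [fmap, IsScalarTower.algebraMap_apply F K Ω]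
    rw [(this.iterate_right _).eq, h3]
  rcases lt_or_gt_of_ne hnm with h | h
  · exact main n m h h'
  · exact main m n h h'.symm
end stable

section counting
variable (k : Type*) (F : Type u) [Field k] [CharZero k] [IsAlgClosed k] [Field F] [CharZero F]
  [Algebra k[X] F] [IsFractionRing k[X] F]
  {L : Type*} [Field L] [Algebra F L] [FiniteDimensional F L]
  (D : Derivation ℤ L L) (hD : ∀ x, D (algebraMap F L x) = algebraMap F L (dF k F x))

theorem D_pol (hD : ∀ x, D (algebraMap F L x) = algebraMap F L (dF k F x)) (P : k[X]) :
    D (pol k F L P) = pol k F L (derivative P) := by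
  simp [pol, hD, dF_poly]

/-- the auxiliary element `b Dδ - q δ Db` -/
noncomputable def psi (q : ℕ) (δ : L) (b : k[X]) : L :=
  pol k F L b * D δ - q * δ * pol k F L (derivative b)

theorem psi_eq (hD : ∀ x, D (algebraMap F L x) = algebraMap F L (dF k F x)) (q : ℕ) (hq : 1 ≤ q) (δ : L) (b : k[X]) :
    psi k F D q δ b = pol k F L b * D (pol k F L b ^ q + δ) -
      q * (pol k F L b ^ q + δ) * pol k F L (derivative b) := by
  rw [psi, map_add, Derivation.leibniz_pow, D_pol k F D hD]
  obtain ⟨m, rfl⟩ : ∃ m, q = m + 1 := ⟨q - 1, by omega⟩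
  simp only [smul_eq_mul, nsmul_eq_mul, Nat.add_sub_cancel]
  ring

theorem unif_bound (x : L) {v : AbsoluteValue F ℝ} {D0 : Derivation ℤ F F} (fr : Frame F D0 v) :
    ∃ H ≥ (1:ℝ), ∀ σ : L →ₐ[F] fr.C, fr.w (σ x) ≤ H := by
  haveI := fr.closed
  haveI : Nonempty (L →ₐ[F] fr.C) := ⟨IsAlgClosed.lift⟩
  obtain ⟨σ0, h⟩ := Finite.exists_max (fun σ : L →ₐ[F] fr.C => fr.w (σ x))
  exact ⟨max 1 (fr.w (σ0 x)), le_max_left _ _, fun σ => (h σ).trans (le_max_right _ _)⟩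

/-- bound at a given bad point -/
theorem phi_bad (hD : ∀ x, D (algebraMap F L x) = algebraMap F L (dF k F x)) (q : ℕ) (hq : 1 ≤ q) (δ : L) (a : k) :
    ∃ H ≥ (1:ℝ), ∀ (b : k[X]) (σ : L →ₐ[F] (frPt F a).C),
      (frPt F a).w (σ (psi k F D q δ b ^ 2 / (pol k F L b ^ q + δ))) ≤ H := by
  obtain ⟨A, hA, hA'⟩ := deriv_bdd k F D hD (frPt F a)
  obtain ⟨H1, hH1, h1⟩ := unif_bound F δ (frPt F a)
  obtain ⟨H2, hH2, h2⟩ := unif_bound F (D δ) (frPt F a)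
  set fr := frPt F a
  refine ⟨max A 1 * (H1 * H2), ?_, ?_⟩
  · have : 1 ≤ max A 1 := le_max_right _ _
    exact one_le_mul_of_one_le_of_one_le this (one_le_mul_of_one_le_of_one_le hH1 hH2)
  intro b σ
  set y := pol k F L b ^ q + δ with hy
  have hq1 := na_natCast_le fr.w fr.nonarch q
  have hb := LInt.pol (F := F) (L := L) b a σ
  have hb' := LInt.pol (F := F) (L := L) (derivative b) a σ
  have e1 : fr.w (σ (psi k F D q δ b)) ≤ H1 * H2 := by
    rw [psi, map_sub]
    refine (na_sub _ fr.nonarch _ _).trans (max_le ?_ ?_)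
    · rw [map_mul, map_mul]
      calc _ ≤ 1 * H2 := mul_le_mul hb (h2 σ) (fr.w.nonneg _) (by norm_num)
        _ ≤ H1 * H2 := by gcongr
    · rw [map_mul, map_mul, map_mul, map_mul, map_natCast]
      calc _ ≤ (1 * H1) * 1 := by
            refine mul_le_mul (mul_le_mul hq1 (h1 σ) (fr.w.nonneg _) (by norm_num)) hb' (fr.w.nonneg _) (by positivity)
        _ ≤ H1 * H2 := by nlinarith
  have e2 : fr.w (σ (psi k F D q δ b)) ≤ max A 1 * fr.w (σ y) := by
    rw [psi_eq k F D hD q hq, map_sub]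
    refine (na_sub _ fr.nonarch _ _).trans (max_le ?_ ?_)
    · rw [map_mul, map_mul]
      calc _ ≤ 1 * (A * fr.w (σ y)) := mul_le_mul hb (hA' σ y) (fr.w.nonneg _) (by norm_num)
        _ ≤ _ := by
          rw [one_mul]
          exact mul_le_mul_of_nonneg_right (le_max_left _ _) (fr.w.nonneg _)
    · rw [map_mul, map_mul, map_mul, map_mul, map_natCast]
      calc _ ≤ (1 * fr.w (σ y)) * 1 := by
            refine mul_le_mul (mul_le_mul hq1 le_rfl (fr.w.nonneg _) (by norm_num)) hb' (fr.w.nonneg _) (mul_nonneg zero_le_one (fr.w.nonneg _))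
        _ ≤ _ := by
          rw [mul_one]
          exact mul_le_mul_of_nonneg_right (le_max_right _ _) (fr.w.nonneg _)
  rw [map_div₀, map_div₀, map_pow, map_pow]
  have h0 := fr.w.nonneg (σ y)
  have hψ := fr.w.nonneg (σ (psi k F D q δ b))
  have hm : 0 < max A 1 := lt_max_of_lt_left hA
  rcases h0.eq_or_lt with h | h
  · rw [← h, div_zero]; positivity
  · rw [div_le_iff₀ h, sq]
    calc _ ≤ (max A 1 * fr.w (σ y)) * (H1 * H2) := mul_le_mul e2 e1 hψ (by positivity)
      _ = _ := by ring

/-- bound at a good point -/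
theorem phi_good (hD : ∀ x, D (algebraMap F L x) = algebraMap F L (dF k F x)) (q : ℕ) (hq : 1 ≤ q) (δ : L) (a : k)
    (σ : L →ₐ[F] (frPt F a).C) (hσ : ∀ x, σ x ∈ (frPt F a).B) (hδ : (frPt F a).w (σ δ) ≤ 1) (b : k[X])
    (e : ℝ) (he0 : 0 ≤ e) (he1 : e ≤ 1)
    (he : (frPt F a).w (σ (pol k F L b ^ q + δ)) = 1/2 → e ≤ 1/2) :
    e * (frPt F a).w (σ (psi k F D q δ b ^ 2 / (pol k F L b ^ q + δ))) ≤ 1 := by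
  set y := pol k F L b ^ q + δ with hy
  have hq1 := na_natCast_le (frPt F a).w (frPt F a).nonarch q
  have hb := LInt.pol (F := F) (L := L) b a σ
  have hb' := LInt.pol (F := F) (L := L) (derivative b) a σ
  have hDσ : ∀ x, (frPt F a).DC (σ x) = σ (D x) := fun x => deriv_compat (dF k F) D (frPt F a).DC hD (frPt F a).DC_ext σ x
  have hDδ : (frPt F a).w (σ (D δ)) ≤ 1 := by
    rw [← hDσ]
    exact frPt_deriv_int F a (hσ δ) hδ
  have hDy : (frPt F a).w (σ (D y)) ≤ 2 * (frPt F a).w (σ y) := by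
    rw [← hDσ]
    exact (frPt F a).DC_bddB 2 (vpt_deriv F a) _ (hσ y)
  have h0 := (frPt F a).w.nonneg (σ y)
  have e1 : (frPt F a).w (σ (psi k F D q δ b)) ≤ 1 := by
    rw [psi, map_sub]
    refine (na_sub _ (frPt F a).nonarch _ _).trans (max_le ?_ ?_)
    · rw [map_mul, map_mul]
      exact mul_le_one₀ hb ((frPt F a).w.nonneg _) hDδ
    · rw [map_mul, map_mul, map_mul, map_mul, map_natCast]
      exact mul_le_one₀ (mul_le_one₀ hq1 ((frPt F a).w.nonneg _) hδ) ((frPt F a).w.nonneg _) hb'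
  have e2 : (frPt F a).w (σ (psi k F D q δ b)) ≤ 2 * (frPt F a).w (σ y) := by
    rw [psi_eq k F D hD q hq, map_sub]
    refine (na_sub _ (frPt F a).nonarch _ _).trans (max_le ?_ ?_)
    · rw [map_mul, map_mul]
      calc _ ≤ 1 * (2 * (frPt F a).w (σ y)) := mul_le_mul hb hDy ((frPt F a).w.nonneg _) (by norm_num)
        _ = _ := one_mul _
    · rw [map_mul, map_mul, map_mul, map_mul, map_natCast]
      calc _ ≤ (1 * (frPt F a).w (σ y)) * 1 := by
            refine mul_le_mul (mul_le_mul hq1 le_rfl ((frPt F a).w.nonneg _) (by norm_num)) hb' ((frPt F a).w.nonneg _) (mul_nonneg zero_le_one ((frPt F a).w.nonneg _))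
        _ ≤ _ := by linarith
  have hψ := (frPt F a).w.nonneg (σ (psi k F D q δ b))
  rw [map_div₀, map_div₀, map_pow, map_pow]
  rcases h0.eq_or_lt with h | h
  · rw [← h, div_zero, mul_zero]; norm_num
  · rw [← mul_div_assoc, div_le_one h]
    have hy0 : σ y ≠ 0 := by intro h'; rw [h', map_zero] at h; exact lt_irrefl _ h
    obtain ⟨n, hn⟩ := frPt_val F a (hσ y) hy0
    have hn' : (frPt F a).w (σ y) = 2 ^ n := hn
    by_cases hn0 : 0 ≤ n
    · have : 1 ≤ (frPt F a).w (σ y) := by rw [hn']; exact one_le_zpow₀ (by norm_num) hn0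
      have : (frPt F a).w (σ (psi k F D q δ b)) ^ 2 ≤ 1 := pow_le_one₀ hψ e1
      nlinarith
    by_cases hn1 : n = -1
    · have h2 : (frPt F a).w (σ y) = 1/2 := by rw [hn', hn1]; norm_num
      have : (frPt F a).w (σ (psi k F D q δ b)) ^ 2 ≤ 1 := pow_le_one₀ hψ e1
      have := he h2
      rw [h2]
      nlinarith
    · have h3 : (frPt F a).w (σ y) ≤ 1/4 := by
        rw [hn', show (1/4:ℝ) = 2 ^ (-2:ℤ) by norm_num]
        exact zpow_le_zpow_right₀ (by norm_num) (by omega)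
      have h4 : (frPt F a).w (σ (psi k F D q δ b)) ^ 2 ≤ (2 * (frPt F a).w (σ y)) ^ 2 := pow_le_pow_left₀ hψ e2 2
      have h5 : 0 ≤ (frPt F a).w (σ (psi k F D q δ b)) ^ 2 := by positivity
      nlinarith

/-- the polynomial vanishing on `Z` -/
noncomputable def zpoly {k : Type*} [Field k] (Z : Finset k) : k[X] := ∏ a ∈ Z, (X - C a)

theorem zpoly_ne (Z : Finset k) : zpoly Z ≠ 0 := Finset.prod_ne_zero_iff.2 fun a _ => X_sub_C_ne_zero a

theorem zpoly_lt {Z : Finset k} {a : k} (ha : a ∈ Z) : vpt F a (algebraMap k[X] F (zpoly Z)) ≤ 1/2 := by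
  classical
  rw [zpoly, ← Finset.mul_prod_erase _ _ ha, map_mul, map_mul, vpt_X_sub]
  have := vpt_poly_le F a (∏ x ∈ Z.erase a, (X - C x))
  linarith

theorem phi_int (hD : ∀ x, D (algebraMap F L x) = algebraMap F L (dF k F x)) (q : ℕ) (hq : 1 ≤ q) (δ : L) (S : Finset k) :
    ∃ s : k[X], s ≠ 0 ∧ ∀ (b : k[X]) (Z : Finset k),
      (∀ a ∉ S, ∀ σ : L →ₐ[F] (frPt F a).C, (frPt F a).w (σ (pol k F L b ^ q + δ)) = 1/2 → a ∈ Z) →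
      LInt k F (pol k F L (s * zpoly Z) * (psi k F D q δ b ^ 2 / (pol k F L b ^ q + δ))) := by
  classical
  obtain ⟨S1, hS1⟩ := fin_mem k F L
  obtain ⟨S2, hS2⟩ := fin_le k F δ
  have hbad := phi_bad k F D hD q hq δ
  choose H hH1 hH using hbad
  let T := S ∪ (S1 ∪ S2)
  obtain ⟨m, hm⟩ : ∃ m : ℕ, ∀ a ∈ T, H a ≤ 2 ^ m := by
    have : ∀ a, ∃ m : ℕ, H a ≤ 2 ^ m := fun a =>
      (pow_unbounded_of_one_lt (H a) (by norm_num : (1:ℝ) < 2)).imp fun _ h => h.le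
    choose m hm using this
    refine ⟨T.sup m, fun a ha => (hm a).trans ?_⟩
    exact pow_le_pow_right₀ (by norm_num) (Finset.le_sup ha)
  refine ⟨zpoly T ^ m, pow_ne_zero _ (zpoly_ne k T), fun b Z hZ a σ => ?_⟩
  rw [map_mul σ, map_mul (frPt F a).w, pol_map, (frPt F a).ext, map_mul, map_mul]
  have hz1 := vpt_poly_le F a (zpoly Z)
  have hz0 := (vpt F a).nonneg (algebraMap k[X] F (zpoly Z))
  have ht1 := vpt_poly_le F a (zpoly T ^ m)
  have ht0 := (vpt F a).nonneg (algebraMap k[X] F (zpoly T ^ m))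
  by_cases ha : a ∈ T
  · have h1 : vpt F a (algebraMap k[X] F (zpoly T ^ m)) ≤ (1/2) ^ m := by
      rw [map_pow, map_pow]
      exact pow_le_pow_left₀ ((vpt F a).nonneg _) (zpoly_lt k F ha) m
    have h2 := (hH a b σ).trans (hm a ha)
    have h3 := (frPt F a).w.nonneg (σ (psi k F D q δ b ^ 2 / (pol k F L b ^ q + δ)))
    calc _ ≤ ((1/2:ℝ) ^ m * 1) * 2 ^ m := by
          refine mul_le_mul (mul_le_mul h1 hz1 hz0 (by positivity)) h2 h3 (by positivity)
      _ = 1 := by rw [mul_one, ← mul_pow]; norm_num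
  · simp only [T, Finset.notMem_union] at ha
    have := phi_good k F D hD q hq δ a σ (hS1 a ha.2.1 σ) (hS2 a ha.2.2 σ) b
      (vpt F a (algebraMap k[X] F (zpoly T ^ m)) * vpt F a (algebraMap k[X] F (zpoly Z)))
      (mul_nonneg ht0 hz0) (mul_le_one₀ ht1 hz0 hz1) (fun h => by
        have := zpoly_lt k F (hZ a ha.1 σ h)
        nlinarith)
    exact this

/-- bound at infinity -/
theorem phi_inf (hD : ∀ x, D (algebraMap F L x) = algebraMap F L (dF k F x)) (q : ℕ) (hq : 1 ≤ q) (δ : L) :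
    ∃ C : ℕ, ∀ b : k[X], C ≤ b.natDegree → ∀ σ : L →ₐ[F] (frInf k F).C,
      (frInf k F).w (σ (pol k F L b ^ q + δ)) = 2 ^ (q * b.natDegree) ∧
      (frInf k F).w (σ (psi k F D q δ b)) ≤ 2 ^ (b.natDegree + C) ∧
      (frInf k F).w (σ (psi k F D q δ b ^ 2 / (pol k F L b ^ q + δ))) * 2 ^ (q * b.natDegree)
        ≤ 2 ^ (2 * (b.natDegree + C)) := by
  obtain ⟨H1, hH1, h1⟩ := unif_bound F δ (frInf k F)
  obtain ⟨H2, hH2, h2⟩ := unif_bound F (D δ) (frInf k F)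
  set fr := frInf k F
  obtain ⟨C, hC⟩ := pow_unbounded_of_one_lt (H1 * H2) (by norm_num : (1:ℝ) < 2)
  have hC1 : H1 < 2 ^ C := lt_of_le_of_lt (by nlinarith) hC
  have hC2 : H2 < 2 ^ C := lt_of_le_of_lt (by nlinarith) hC
  have hC0 : 1 ≤ C := by
    by_contra! h
    have : C = 0 := by omega
    rw [this, pow_zero] at hC1
    linarith
  refine ⟨C, fun b hb σ => ?_⟩
  have hb0 : b ≠ 0 := by rintro rfl; simp at hb; omega
  have hwb : fr.w (σ (pol k F L b)) = 2 ^ b.natDegree := by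
    rw [pol_map, fr.ext, vinf_poly k F b hb0]
  have hwb' : fr.w (σ (pol k F L (derivative b))) ≤ 2 ^ b.natDegree := by
    rw [pol_map, fr.ext, ← dF_poly]
    refine (vinf_deriv k F _).trans ?_
    rw [vinf_poly k F b hb0, one_mul]
  have hq1 := na_natCast_le fr.w fr.nonarch q
  have e1 : fr.w (σ (pol k F L b ^ q + δ)) = 2 ^ (q * b.natDegree) := by
    rw [map_add]
    rw [na_add_eq fr.w fr.nonarch, map_pow, map_pow, hwb, ← pow_mul, mul_comm]
    rw [map_pow, map_pow, hwb, ← pow_mul]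
    refine ((h1 σ).trans_lt hC1).trans_le (pow_le_pow_right₀ (by norm_num) ?_)
    nlinarith
  have e2 : fr.w (σ (psi k F D q δ b)) ≤ 2 ^ (b.natDegree + C) := by
    rw [psi, map_sub, pow_add]
    refine (na_sub _ fr.nonarch _ _).trans (max_le ?_ ?_)
    · rw [map_mul, map_mul, hwb]
      exact mul_le_mul_of_nonneg_left ((h2 σ).trans hC2.le) (by positivity)
    · rw [map_mul, map_mul, map_mul, map_mul, map_natCast, mul_comm]
      refine mul_le_mul hwb' ?_ (mul_nonneg (fr.w.nonneg _) (fr.w.nonneg _)) (by positivity)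
      calc _ ≤ 1 * (2:ℝ) ^ C := mul_le_mul hq1 ((h1 σ).trans hC1.le) (fr.w.nonneg _) (by norm_num)
        _ = _ := one_mul _
  refine ⟨e1, e2, ?_⟩
  rw [map_div₀, map_div₀, e1, div_mul_cancel₀ _ (by positivity), map_pow, map_pow, mul_comm 2 (_ + _), pow_mul]
  exact pow_le_pow_left₀ (fr.w.nonneg _) e2 2

theorem zpoly_deg (Z : Finset k) : (zpoly Z).natDegree = Z.card := by
  rw [zpoly, natDegree_prod_of_monic _ _ fun a _ => monic_X_sub_C a]
  simp

theorem exists_inf_ge (x : L) (h0 : x ≠ 0) (h : LInt k F x) :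
    ∃ σ : L →ₐ[F] (frInf k F).C, 1 ≤ (frInf k F).w (σ x) := by
  by_contra! hcon
  exact h0 (lint_eq_zero k F x h hcon)

theorem count_ge3 (hD : ∀ x, D (algebraMap F L x) = algebraMap F L (dF k F x)) (q : ℕ) (hq : 3 ≤ q) (δ : L)
    (S : Finset k) : ∃ C : ℕ, ∀ b : k[X], psi k F D q δ b ≠ 0 → C ≤ b.natDegree → ∀ Z : Finset k,
      (∀ a ∉ S, ∀ σ : L →ₐ[F] (frPt F a).C, (frPt F a).w (σ (pol k F L b ^ q + δ)) = 1/2 → a ∈ Z) →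
      b.natDegree ≤ Z.card + C := by
  obtain ⟨s, hs, h1⟩ := phi_int k F D hD q (by omega) δ S
  obtain ⟨C, hC⟩ := phi_inf k F D hD q (by omega) δ
  haveI := (frInf k F).closed
  refine ⟨2 * C + s.natDegree, fun b hψ hb Z hZ => ?_⟩
  have hi := h1 b Z hZ
  have hy : pol k F L b ^ q + δ ≠ 0 := by
    intro h
    have := (hC b (by omega) IsAlgClosed.lift).1
    rw [h, map_zero, map_zero] at this
    have h2 : (0:ℝ) < 2 ^ (q * b.natDegree) := by positivity
    linarith
  obtain ⟨σ, hσ⟩ := exists_inf_ge k F _ (mul_ne_zero (pol_ne k F L (mul_ne_zero hs (zpoly_ne k Z)))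
    (div_ne_zero (pow_ne_zero 2 hψ) hy)) hi
  obtain ⟨-, -, h3⟩ := hC b (by omega) σ
  rw [map_mul σ, map_mul, pol_map, (frInf k F).ext, vinf_poly k F _ (mul_ne_zero hs (zpoly_ne k Z)),
    natDegree_mul hs (zpoly_ne k Z), zpoly_deg] at hσ
  have h4 : (2:ℝ) ^ (q * b.natDegree) ≤ 2 ^ (s.natDegree + Z.card + 2 * (b.natDegree + C)) := by
    rw [pow_add]
    have h5 := mul_le_mul_of_nonneg_left h3 (by positivity : (0:ℝ) ≤ 2 ^ (s.natDegree + Z.card))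
    have h6 := mul_le_mul_of_nonneg_right hσ (by positivity : (0:ℝ) ≤ 2 ^ (q * b.natDegree))
    linarith
  have h5 := (pow_le_pow_iff_right₀ (by norm_num : (1:ℝ) < 2)).1 h4
  nlinarith
end counting

section counting2
variable (k : Type*) (F : Type u) [Field k] [CharZero k] [IsAlgClosed k] [Field F] [CharZero F]
  [Algebra k[X] F] [IsFractionRing k[X] F]
  {L : Type*} [Field L] [Algebra F L] [FiniteDimensional F L]
  (D : Derivation ℤ L L) (hD : ∀ x, D (algebraMap F L x) = algebraMap F L (dF k F x))

theorem psi_once (q : ℕ) (hq : 1 ≤ q) (δ : L) (hδ : δ ≠ 0) (b1 b2 : k[X]) (m1 : b1.Monic) (m2 : b2.Monic)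
    (d1 : 1 ≤ b1.natDegree) (d2 : 1 ≤ b2.natDegree)
    (h1 : psi k F D q δ b1 = 0) (h2 : psi k F D q δ b2 = 0) : b1.natDegree = b2.natDegree := by
  have hq0 : (q : L) ≠ 0 := by
    haveI : CharZero L := charZero_of_injective_algebraMap (algebraMap F L).injective
    exact Nat.cast_ne_zero.2 (by omega)
  rw [psi, sub_eq_zero] at h1 h2
  have h3 : (q * δ) * pol k F L (b1 * derivative b2) = (q * δ) * pol k F L (b2 * derivative b1) := by
    rw [map_mul, map_mul]
    linear_combination (pol k F L b2) * h1 - (pol k F L b1) * h2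
  have h4 := mul_left_cancel₀ (mul_ne_zero hq0 hδ) h3
  have h5 : b1 * derivative b2 = b2 * derivative b1 := by
    by_contra h
    have := pol_ne k F L (sub_ne_zero.2 h)
    rw [map_sub, h4, sub_self] at this
    exact this rfl
  have hc : ∀ b b' : k[X], b.Monic → b'.Monic → 1 ≤ b'.natDegree →
      (b * derivative b').coeff (b.natDegree + (b'.natDegree - 1)) = b'.natDegree := by
    intro b b' m m' d
    rw [coeff_mul_add_eq_of_natDegree_le le_rfl (natDegree_derivative_le b'), coeff_derivative,
      Nat.sub_add_cancel d, m.coeff_natDegree, m'.coeff_natDegree]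
    push_cast [Nat.cast_sub d]
    ring
  have h6 := hc b1 b2 m1 m2 d2
  have h7 := hc b2 b1 m2 m1 d1
  rw [h5, show b1.natDegree + (b2.natDegree - 1) = b2.natDegree + (b1.natDegree - 1) by omega, h7] at h6
  exact_mod_cast h6

theorem lint_natCast (n : ℕ) : LInt k F (n : L) := by
  have := LInt.pol (F := F) (L := L) (n : k[X])
  rwa [map_natCast] at this

theorem LInt.neg {x : L} (hx : LInt k F x) : LInt k F (-x) := by
  intro a σ
  rw [map_neg, map_neg_eq_map]
  exact hx a σ

theorem count_eq2 (hD : ∀ x, D (algebraMap F L x) = algebraMap F L (dF k F x)) (δ1 δ2 : L)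
    (h1 : δ1 ≠ 0) (h12 : δ1 ≠ δ2) (τ : L →ₐ[F] L) (hτ : τ δ1 = δ2)
    (S : Finset k) : ∃ C : ℕ, ∀ b : k[X], psi k F D 2 δ1 b ≠ 0 → C ≤ b.natDegree → ∀ Z : Finset k,
      (∀ a ∉ S, ∀ σ : L →ₐ[F] (frPt F a).C, (frPt F a).w (σ (pol k F L b ^ 2 + δ1)) = 1/2 → a ∈ Z) →
      b.natDegree ≤ Z.card + C := by
  classical
  have h2 : δ2 ≠ 0 := by rw [← hτ]; simpa using h1
  obtain ⟨s1, hs1, hi1⟩ := phi_int k F D hD 2 (by omega) δ1 S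
  obtain ⟨s2, hs2, hi2⟩ := phi_int k F D hD 2 (by omega) δ2 S
  obtain ⟨C1, hC1⟩ := phi_inf k F D hD 2 (by omega) δ1
  obtain ⟨C2, hC2⟩ := phi_inf k F D hD 2 (by omega) δ2
  let W := D δ1 * δ2 - D δ2 * δ1
  obtain ⟨t0, ht0, hclear⟩ := exists_clear_inf k F ({δ1, δ2, W} : Set L) (by simp)
  set t := pol k F L t0 with ht
  have htn : t ≠ 0 := pol_ne k F L ht0
  have htI : LInt k F t := LInt.pol t0
  set d1 := t * δ1 with hd1
  set d2 := t * δ2 with hd2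
  set W' := t * W with hW'
  have hd1I : LInt k F d1 := hclear _ (by simp)
  have hd2I : LInt k F d2 := hclear _ (by simp)
  have hWI : LInt k F W' := hclear _ (by simp)
  obtain ⟨m, hm⟩ : ∃ m : ℕ, ∀ σ : L →ₐ[F] (frInf k F).C, (frInf k F).w (σ d1) ≤ 2 ^ m ∧
      (frInf k F).w (σ d2) ≤ 2 ^ m ∧ (frInf k F).w (σ W') ≤ 2 ^ m := by
    obtain ⟨H1, hH1, hh1⟩ := unif_bound F d1 (frInf k F)
    obtain ⟨H2, hH2, hh2⟩ := unif_bound F d2 (frInf k F)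
    obtain ⟨H3, hH3, hh3⟩ := unif_bound F W' (frInf k F)
    obtain ⟨m, hm⟩ := pow_unbounded_of_one_lt (H1 + H2 + H3) (by norm_num : (1:ℝ) < 2)
    refine ⟨m, fun σ => ⟨?_, ?_, ?_⟩⟩
    · linarith [hh1 σ]
    · linarith [hh2 σ]
    · linarith [hh3 σ]
  haveI := (frInf k F).closed
  set s := s1 * s2 with hs
  have hsn : s ≠ 0 := mul_ne_zero hs1 hs2
  refine ⟨C1 + C2 + 2 * (C1 + C2) + s.natDegree + 6 * m + 1, fun b hψ hb Z hZ => ?_⟩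
  have hZn := zpoly_ne k Z
  set e := pol k F L (s * zpoly Z) with he
  have hen : e ≠ 0 := pol_ne k F L (mul_ne_zero hsn hZn)
  have heI : LInt k F e := LInt.pol _
  set B0 := pol k F L b with hB0
  have hbn : b ≠ 0 := by rintro rfl; simp at hb
  have hB0n : B0 ≠ 0 := pol_ne k F L hbn
  have hB0I : LInt k F B0 := LInt.pol _
  set y1 := B0 ^ 2 + δ1 with hy1
  set y2 := B0 ^ 2 + δ2 with hy2
  set ψ1 := psi k F D 2 δ1 b with hψ1
  set ψ2 := psi k F D 2 δ2 b with hψ2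
  have hZ2 : ∀ a ∉ S, ∀ σ : L →ₐ[F] (frPt F a).C, (frPt F a).w (σ y2) = 1/2 → a ∈ Z := by
    intro a ha σ h
    refine hZ a ha (σ.comp τ) ?_
    rw [← h, AlgHom.comp_apply, map_add, map_pow, hτ, hB0, pol_map]
    rfl
  have hφ1 : LInt k F (e * (ψ1 ^ 2 / y1)) := by
    have := (LInt.pol (F := F) (L := L) s2).mul (hi1 b Z hZ)
    rw [← mul_assoc, ← map_mul] at this
    rw [he, hs, show s1 * s2 * zpoly Z = s2 * (s1 * zpoly Z) by ring]
    exact this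
  have hφ2 : LInt k F (e * (ψ2 ^ 2 / y2)) := by
    have := (LInt.pol (F := F) (L := L) s1).mul (hi2 b Z hZ2)
    rw [← mul_assoc, ← map_mul] at this
    rw [he, hs, show s1 * s2 * zpoly Z = s1 * (s2 * zpoly Z) by ring]
    exact this
  have hy1n : y1 ≠ 0 := by
    intro h
    have := (hC1 b (by omega) IsAlgClosed.lift).1
    rw [← hB0, ← hy1, h, map_zero, map_zero] at this
    have h2 : (0:ℝ) < 2 ^ (2 * b.natDegree) := by positivity
    linarith
  have hy2n : y2 ≠ 0 := by
    intro h
    have := (hC2 b (by omega) IsAlgClosed.lift).1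
    rw [← hB0, ← hy2, h, map_zero, map_zero] at this
    have h2 : (0:ℝ) < 2 ^ (2 * b.natDegree) := by positivity
    linarith
  set φ1 := e * (ψ1 ^ 2 / y1) with hφ1d
  set φ2 := e * (ψ2 ^ 2 / y2) with hφ2d
  have q1 : φ1 * y1 = e * ψ1 ^ 2 := by rw [hφ1d]; field_simp
  have q2 : φ2 * y2 = e * ψ2 ^ 2 := by rw [hφ2d]; field_simp
  have hφ1n : φ1 ≠ 0 := mul_ne_zero hen (div_ne_zero (pow_ne_zero 2 hψ) hy1n)
  have hlin : d2 * ψ1 - d1 * ψ2 = B0 * W' := by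
    simp only [hψ1, hψ2, psi, hd1, hd2, hW', W, hB0]
    ring
  clear_value ψ1 ψ2 φ1 φ2
  have hd2n : d2 ≠ 0 := mul_ne_zero htn h2
  have hd1n : d1 ≠ 0 := mul_ne_zero htn h1
  set B := d2 ^ 2 * φ1 with hB
  set G := d1 ^ 2 * φ2 with hG
  have hBn : B ≠ 0 := mul_ne_zero (pow_ne_zero 2 hd2n) hφ1n
  have hBI : LInt k F B := (hd2I.pow 2).mul hφ1
  have hGI : LInt k F G := (hd1I.pow 2).mul hφ2
  set A := B - G + e * W' ^ 2 with hA
  have hAI : LInt k F A := (hBI.sub hGI).add (heI.mul (hWI.pow 2))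
  set J := B * d1 - G * d2 with hJ
  have hJI : LInt k F J := (hBI.mul hd1I).sub (hGI.mul hd2I)
  have g1 : e * (d2 * ψ1) ^ 2 = B * y1 := by
    rw [hB]; linear_combination (-d2 ^ 2) * q1
  have g2 : e * (d1 * ψ2) ^ 2 = G * y2 := by
    rw [hG]; linear_combination (-d1 ^ 2) * q2
  have i1 : (B * y1 - G * y2 + e * B0 ^ 2 * W' ^ 2) = 2 * e * (d2 * ψ1) * (B0 * W') := by
    rw [← g1, ← g2, ← hlin]
    linear_combination (-e * (d2 * ψ1 - d1 * ψ2 + B0 * W')) * hlin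
  have i2 : (B * y1 - G * y2 + e * B0 ^ 2 * W' ^ 2) ^ 2 = 4 * e * (B * y1) * (B0 * W') ^ 2 := by
    rw [i1, ← g1]; ring
  set X4 := A ^ 2 - (4 : ℕ) * (e * W' ^ 2 * B) with hX4
  set X2 := (2 : ℕ) * (A * J) - (4 : ℕ) * (e * W' ^ 2 * B * d1) with hX2
  have hX4I : LInt k F X4 := (hAI.pow 2).sub ((lint_natCast k F 4).mul ((heI.mul (hWI.pow 2)).mul hBI))
  have hX2I : LInt k F X2 := ((lint_natCast k F 2).mul (hAI.mul hJI)).sub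
    ((lint_natCast k F 4).mul (((heI.mul (hWI.pow 2)).mul hBI).mul hd1I))
  have main : t ^ 2 * X4 * B0 ^ 4 + t * X2 * B0 ^ 2 + J ^ 2 = 0 := by
    have e1 : t * (B * y1 - G * y2 + e * B0 ^ 2 * W' ^ 2) = t * A * B0 ^ 2 + J := by
      rw [hA, hJ, hy1, hy2, hd1, hd2]; ring
    have e2 : (t * A * B0 ^ 2 + J) ^ 2 = 4 * e * B * W' ^ 2 * B0 ^ 2 * (t ^ 2 * B0 ^ 2 + t * d1) := by
      rw [← e1, mul_pow, i2, hy1, hd1]; ring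
    rw [hX4, hX2]
    push_cast
    linear_combination e2
  -- bounds at infinity
  have hbound : ∀ σ : L →ₐ[F] (frInf k F).C,
      (frInf k F).w (σ e) = 2 ^ (s.natDegree + Z.card) ∧
      (frInf k F).w (σ φ1) ≤ 2 ^ (s.natDegree + Z.card + 2 * (C1 + C2)) ∧
      (frInf k F).w (σ φ2) ≤ 2 ^ (s.natDegree + Z.card + 2 * (C1 + C2)) ∧
      (frInf k F).w (σ B0) = 2 ^ b.natDegree := by
    intro σ
    have u1 : (frInf k F).w (σ e) = 2 ^ (s.natDegree + Z.card) := by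
      rw [he, pol_map, (frInf k F).ext, vinf_poly k F _ (mul_ne_zero hsn hZn), natDegree_mul hsn hZn, zpoly_deg]
    have key : ∀ (x : L) (Ci : ℕ), Ci ≤ C1 + C2 →
        (frInf k F).w (σ x) * 2 ^ (2 * b.natDegree) ≤ 2 ^ (2 * (b.natDegree + Ci)) →
        (frInf k F).w (σ (e * x)) ≤ 2 ^ (s.natDegree + Z.card + 2 * (C1 + C2)) := by
      intro x Ci hCi h
      rw [map_mul, map_mul, u1, pow_add _ (s.natDegree + Z.card) (2 * (C1 + C2))]
      refine mul_le_mul_of_nonneg_left ?_ (by positivity)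
      rw [mul_add, pow_add, mul_comm] at h
      have := le_of_mul_le_mul_left h (by positivity)
      exact this.trans (pow_le_pow_right₀ (by norm_num) (by omega))
    refine ⟨u1, ?_, ?_, ?_⟩
    · rw [hφ1d]
      exact key _ C1 (by omega) (by rw [hψ1]; exact (hC1 b (by omega) σ).2.2)
    · rw [hφ2d]
      exact key _ C2 (by omega) (by rw [hψ2]; exact (hC2 b (by omega) σ).2.2)
    · rw [hB0, pol_map, (frInf k F).ext, vinf_poly k F b hbn]
  have fin : ∀ x : L, x ≠ 0 → LInt k F (x / B0 ^ 2) →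
      (∀ σ : L →ₐ[F] (frInf k F).C, (frInf k F).w (σ x) ≤
        2 ^ (2 * (s.natDegree + Z.card + 2 * (C1 + C2)) + 6 * m)) →
      b.natDegree ≤ Z.card + (C1 + C2 + 2 * (C1 + C2) + s.natDegree + 6 * m + 1) := by
    intro x hx hI hbd
    obtain ⟨σ, hσ⟩ := exists_inf_ge k F _ (div_ne_zero hx (pow_ne_zero 2 hB0n)) hI
    obtain ⟨-, -, -, u4⟩ := hbound σ
    rw [map_div₀, map_div₀, map_pow, map_pow, u4, one_le_div (by positivity), ← pow_mul] at hσ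
    have := (pow_le_pow_iff_right₀ (by norm_num : (1:ℝ) < 2)).1 (hσ.trans (hbd σ))
    omega
  by_cases hJ0 : J = 0
  · by_cases hW0 : W' = 0
    · exfalso
      rw [hW0, mul_zero, sub_eq_zero] at hlin
      have e1 : B * y1 = G * y2 := by rw [← g1, ← g2, hlin]
      have e2 : t * (B * δ1) = t * (G * δ2) := by
        rw [hJ, hd1, hd2, sub_eq_zero] at hJ0
        linear_combination hJ0
      have e3 := mul_left_cancel₀ htn e2
      have e4 : B0 ^ 2 * B = B0 ^ 2 * G := by
        rw [hy1, hy2] at e1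
        linear_combination e1 - e3
      have e5 := mul_left_cancel₀ (pow_ne_zero 2 hB0n) e4
      rw [← e5] at e3
      exact h12 (mul_left_cancel₀ hBn e3)
    · have hX2' : X2 = -((4 : ℕ) * (e * W' ^ 2 * B * d1)) := by rw [hX2, hJ0]; ring
      have hX2n : X2 ≠ 0 := by
        haveI : CharZero L := charZero_of_injective_algebraMap (algebraMap F L).injective
        rw [hX2', neg_ne_zero]
        exact mul_ne_zero (Nat.cast_ne_zero.2 (by norm_num))
          (mul_ne_zero (mul_ne_zero (mul_ne_zero hen (pow_ne_zero 2 hW0)) hBn) hd1n)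
      refine fin X2 hX2n ?_ ?_
      · have e1 : X2 / B0 ^ 2 = -(t * X4) := by
          rw [div_eq_iff (pow_ne_zero 2 hB0n)]
          rw [hJ0] at main
          have e2 : (t * B0 ^ 2) * X2 = (t * B0 ^ 2) * (-(t * X4) * B0 ^ 2) := by
            linear_combination main
          exact mul_left_cancel₀ (mul_ne_zero htn (pow_ne_zero 2 hB0n)) e2
        rw [e1]
        exact (htI.mul hX4I).neg
      · intro σ
        obtain ⟨u1, u2, u3, u4⟩ := hbound σ
        obtain ⟨m1, m2, m3⟩ := hm σ
        have n4 := na_natCast_le (frInf k F).w (frInf k F).nonarch 4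
        rw [hX2', hB]
        simp only [map_neg, map_neg_eq_map, map_mul, map_pow, map_natCast, u1]
        have hw : ∀ z, 0 ≤ (frInf k F).w z := (frInf k F).w.nonneg
        calc _ ≤ (1:ℝ) * (2 ^ (s.natDegree + Z.card) * (2 ^ m) ^ 2 *
              ((2 ^ m) ^ 2 * 2 ^ (s.natDegree + Z.card + 2 * (C1 + C2))) * 2 ^ m) := by
              gcongr <;> first | apply hw | skip
          _ = 2 ^ (s.natDegree + Z.card + (s.natDegree + Z.card + 2 * (C1 + C2)) + 5 * m) := by ring
          _ ≤ _ := pow_le_pow_right₀ (by norm_num) (by omega)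
  · refine fin (J ^ 2) (pow_ne_zero 2 hJ0) ?_ ?_
    · have e1 : J ^ 2 / B0 ^ 2 = -(t ^ 2 * X4 * B0 ^ 2 + t * X2) := by
        rw [div_eq_iff (pow_ne_zero 2 hB0n)]
        linear_combination main
      rw [e1]
      exact ((((htI.pow 2).mul hX4I).mul (hB0I.pow 2)).add (htI.mul hX2I)).neg
    · intro σ
      obtain ⟨u1, u2, u3, u4⟩ := hbound σ
      obtain ⟨m1, m2, m3⟩ := hm σ
      have hw : ∀ z, 0 ≤ (frInf k F).w z := (frInf k F).w.nonneg
      have e1 : (frInf k F).w (σ J) ≤ 2 ^ (s.natDegree + Z.card + 2 * (C1 + C2)) * (2 ^ m) ^ 3 := by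
        rw [hJ, map_sub]
        refine (na_sub _ (frInf k F).nonarch _ _).trans (max_le ?_ ?_)
        · rw [hB]
          simp only [map_mul, map_pow]
          calc _ ≤ ((2:ℝ) ^ m) ^ 2 * 2 ^ (s.natDegree + Z.card + 2 * (C1 + C2)) * 2 ^ m := by
                gcongr <;> first | apply hw | skip
            _ = _ := by ring
        · rw [hG]
          simp only [map_mul, map_pow]
          calc _ ≤ ((2:ℝ) ^ m) ^ 2 * 2 ^ (s.natDegree + Z.card + 2 * (C1 + C2)) * 2 ^ m := by
                gcongr <;> first | apply hw | skip
            _ = _ := by ring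
      rw [map_pow, map_pow]
      calc _ ≤ (2 ^ (s.natDegree + Z.card + 2 * (C1 + C2)) * ((2:ℝ) ^ m) ^ 3) ^ 2 :=
            pow_le_pow_left₀ (hw _) e1 2
        _ = _ := by ring
end counting2

/-- critical orbit polynomials -/
noncomputable def aP (k : Type*) [Field k] (q : ℕ) : ℕ → k[X]
  | 0 => 0
  | n + 1 => aP k q n ^ q + X

theorem aP_monic (k : Type*) [Field k] (q : ℕ) (hq : 2 ≤ q) (n : ℕ) :
    (aP k q (n + 1)).Monic ∧ (aP k q (n + 1)).natDegree = q ^ n := by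
  induction n with
  | zero =>
    have : aP k q 1 = X := by simp [aP, show q ≠ 0 by omega]
    rw [zero_add, this]
    simp [monic_X]
  | succ n ih =>
    have h1 : (aP k q (n + 1) ^ q).Monic := ih.1.pow q
    have h2 : (aP k q (n + 1) ^ q).natDegree = q ^ (n + 1) := by
      rw [ih.1.natDegree_pow, ih.2, pow_succ']
    have h4 : 2 ≤ q ^ (n + 1) := hq.trans (Nat.le_self_pow (by omega) q)
    have h3 : (X : k[X]).degree < (aP k q (n + 1) ^ q).degree := by
      rw [degree_X, degree_eq_natDegree h1.ne_zero, h2]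
      exact_mod_cast (by omega : 1 < q ^ (n + 1))
    refine ⟨h1.add_of_left h3, ?_⟩
    rw [aP, natDegree_add_eq_left_of_natDegree_lt, h2]
    rw [h2, natDegree_X]; omega

theorem aP_pol (k F : Type*) [Field k] [Field F] [Algebra k[X] F] {L : Type*} [Field L] [Algebra F L]
    (q n : ℕ) : pol k F L (aP k q n) = (fmap q (algebraMap F L (cF k F)))^[n] 0 := by
  induction n with
  | zero => simp [aP]
  | succ n ih =>
    rw [Function.iterate_succ_apply', ← ih, aP, map_add, map_pow]
    rfl

theorem fmap_map {A B : Type*} [Field A] [Field B] (σ : A →+* B) (q : ℕ) (c x : A) (n : ℕ) :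
    σ ((fmap q c)^[n] x) = (fmap q (σ c))^[n] (σ x) := by
  have : Function.Semiconj σ (fmap q c) (fmap q (σ c)) := by
    intro x; simp [fmap]
  exact (this.iterate_right n).eq x

theorem iter_le {M : Type*} [Field M] (w : AbsoluteValue M ℝ) (hw : IsNonarchimedean w) (q : ℕ) (c : M)
    (hc : w c ≤ 1) (x : M) (hx : w x ≤ 1) (n : ℕ) : w ((fmap q c)^[n] x) ≤ 1 := by
  induction n with
  | zero => exact hx
  | succ n ih =>
    rw [Function.iterate_succ_apply', fmap]
    refine (hw _ _).trans (max_le ?_ hc)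
    rw [map_pow]
    exact pow_le_one₀ (w.nonneg _) ih

theorem iter_sub_le {M : Type*} [Field M] (w : AbsoluteValue M ℝ) (hw : IsNonarchimedean w) (q : ℕ) (c : M)
    (hc : w c ≤ 1) (x y : M) (hx : w x ≤ 1) (hy : w y ≤ 1) (n : ℕ) :
    w ((fmap q c)^[n] x - (fmap q c)^[n] y) ≤ w (x - y) := by
  induction n with
  | zero => exact le_rfl
  | succ n ih =>
    rw [Function.iterate_succ_apply', Function.iterate_succ_apply', fmap, fmap, add_sub_add_right_eq_sub]
    exact (na_pow_sub_le w hw _ _ (iter_le w hw q c hc x hx n) (iter_le w hw q c hc y hy n) q).trans ih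

theorem lin_lt_pow (A : ℕ) : ∃ m0, ∀ m ≥ m0, A * (m + 1) < 2 ^ m := by
  have h := tendsto_pow_const_div_const_pow_of_one_lt 1 (by norm_num : (1:ℝ) < 2)
  have h2 := (h.eventually (gt_mem_nhds (show (0:ℝ) < 1 / (2 * A + 2) by positivity))).and
    (Filter.eventually_ge_atTop 1)
  rw [Filter.eventually_atTop] at h2
  obtain ⟨m0, hm⟩ := h2
  refine ⟨m0, fun m hm' => ?_⟩
  obtain ⟨h3, h4⟩ := hm m hm'
  rw [pow_one, div_lt_div_iff₀ (by positivity) (by positivity), one_mul] at h3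
  have h5 : m * (2 * A + 2) < 2 ^ m := by exact_mod_cast h3
  nlinarith

section prim
variable (k : Type*) (F : Type u) [Field k] [CharZero k] [IsAlgClosed k] [Field F] [CharZero F]
  [Algebra k[X] F] [IsFractionRing k[X] F]
  {L : Type*} [Field L] [Algebra F L] [FiniteDimensional F L]

theorem norm_deg (x : L) (hx : x ≠ 0) (h : LInt k F x) (m : ℕ)
    (hR : ∀ σ : L →ₐ[F] (frInf k F).C, (frInf k F).w (σ x) ≤ 2 ^ m) :
    ∃ Z : Finset k, Z.card ≤ m * Module.finrank F L ∧
      ∀ a, ∀ σ : L →ₐ[F] (frPt F a).C, (frPt F a).w (σ x) < 1 → a ∈ Z := by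
  classical
  obtain ⟨P, hP, h1, h2⟩ := norm_poly k F x hx h
  refine ⟨P.roots.toFinset, ?_, fun a σ hσ => ?_⟩
  · refine (Multiset.toFinset_card_le _).trans ((card_roots' P).trans ?_)
    have := h2 _ hR
    rw [← pow_mul] at this
    exact (pow_le_pow_iff_right₀ (by norm_num : (1:ℝ) < 2)).1 this
  · simp only [Multiset.mem_toFinset, mem_roots hP]
    exact h1 a ⟨σ, hσ⟩

theorem crit_zeros (q : ℕ) (hq : 2 ≤ q) (β : L)
    (hpost : ∀ n ≥ 1, (fmap q (algebraMap F L (cF k F)))^[n] 0 ≠ β) :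
    ∃ C : ℕ, ∀ i ≥ 1, ∃ Z : Finset k, Z.card ≤ C * q ^ i ∧
      ∀ a, ∀ σ : L →ₐ[F] (frPt F a).C, (frPt F a).w (σ (pol k F L (aP k q i) - β)) < 1 → a ∈ Z := by
  obtain ⟨t, ht, htI⟩ := exists_clear k F β
  obtain ⟨H, hH, hh⟩ := unif_bound F β (frInf k F)
  obtain ⟨C, hC⟩ := pow_unbounded_of_one_lt H (by norm_num : (1:ℝ) < 2)
  refine ⟨(t.natDegree + C + 1) * Module.finrank F L, fun i hi => ?_⟩
  obtain ⟨i, rfl⟩ : ∃ j, i = j + 1 := ⟨i - 1, by omega⟩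
  have hq1 : 1 ≤ q ^ (i + 1) := Nat.one_le_pow _ _ (by omega)
  have hq2 : q ^ i ≤ q ^ (i + 1) := Nat.pow_le_pow_right (by omega) (by omega)
  obtain ⟨hm, hdeg⟩ := aP_monic k q hq i
  have main := norm_deg k F (pol k F L t * (pol k F L (aP k q (i + 1)) - β)) ?_ ?_
    (t.natDegree + (C + q ^ i)) ?_
  · obtain ⟨Z, hZ1, hZ2⟩ := main
    refine ⟨Z, hZ1.trans ?_, fun a σ hσ => hZ2 a σ ?_⟩
    · have : t.natDegree + (C + q ^ i) ≤ (t.natDegree + C + 1) * q ^ (i + 1) := by nlinarith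
      calc _ ≤ (t.natDegree + C + 1) * q ^ (i + 1) * Module.finrank F L := Nat.mul_le_mul_right _ this
        _ = _ := by ring
    · rw [map_mul, map_mul]
      have h1 := LInt.pol (F := F) (L := L) t a σ
      have h2 := (frPt F a).w.nonneg (σ (pol k F L t))
      have h3 := (frPt F a).w.nonneg (σ (pol k F L (aP k q (i + 1)) - β))
      nlinarith
  · refine mul_ne_zero (pol_ne k F L ht) ?_
    rw [aP_pol, sub_ne_zero]
    exact hpost _ hi
  · rw [mul_sub]
    exact ((LInt.pol t).mul (LInt.pol _)).sub htI
  · intro σ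
    rw [map_mul, map_mul, pow_add, pol_map, (frInf k F).ext, vinf_poly k F t ht]
    refine mul_le_mul_of_nonneg_left ?_ (by positivity)
    rw [map_sub]
    refine (na_sub _ (frInf k F).nonarch _ _).trans (max_le ?_ ?_)
    · rw [pol_map, (frInf k F).ext, vinf_poly k F _ hm.ne_zero, hdeg]
      exact pow_le_pow_right₀ (by norm_num) (by omega)
    · exact ((hh σ).trans hC.le).trans (pow_le_pow_right₀ (by norm_num) (by omega))

theorem per_zeros (q : ℕ) (hq : 2 ≤ q) (β : L)
    (hper : ∀ n ≥ 1, (fmap q (algebraMap F L (cF k F)))^[n] β ≠ β) :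
    ∃ C : ℕ, ∀ i ≥ 1, ∃ Z : Finset k, Z.card ≤ C * q ^ i ∧
      ∀ a, ∀ σ : L →ₐ[F] (frPt F a).C,
        (frPt F a).w (σ ((fmap q (algebraMap F L (cF k F)))^[i] β - β)) < 1 → a ∈ Z := by
  obtain ⟨t, ht, htI⟩ := exists_clear k F β
  obtain ⟨H, hH, hh⟩ := unif_bound F β (frInf k F)
  obtain ⟨C0, hC0⟩ := pow_unbounded_of_one_lt H (by norm_num : (1:ℝ) < 2)
  set C := C0 + 1 with hCd
  have hC : H ≤ 2 ^ C := hC0.le.trans (pow_le_pow_right₀ (by norm_num) (by omega))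
  set c := algebraMap F L (cF k F) with hc
  have hcp : c = pol k F L X := rfl
  refine ⟨(t.natDegree + C) * Module.finrank F L, fun i hi => ?_⟩
  have hInt : ∀ l, LInt k F (pol k F L t ^ q ^ l * (fmap q c)^[l] β) := by
    intro l
    induction l with
    | zero => simpa using htI
    | succ l ih =>
      rw [Function.iterate_succ_apply', fmap]
      have : pol k F L t ^ q ^ (l + 1) * ((fmap q c)^[l] β ^ q + c) =
          (pol k F L t ^ q ^ l * (fmap q c)^[l] β) ^ q + pol k F L t ^ q ^ (l + 1) * c := by
        rw [mul_pow, ← pow_mul, ← pow_succ]; ring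
      rw [this]
      exact (ih.pow q).add (((LInt.pol t).pow _).mul (by rw [hcp]; exact LInt.pol X))
  have hinf : ∀ (σ : L →ₐ[F] (frInf k F).C) (l : ℕ), (frInf k F).w (σ ((fmap q c)^[l] β)) ≤ 2 ^ (C * q ^ l) := by
    intro σ l
    induction l with
    | zero => simpa using (hh σ).trans hC
    | succ l ih =>
      rw [Function.iterate_succ_apply', fmap, map_add]
      refine ((frInf k F).nonarch _ _).trans (max_le ?_ ?_)
      · rw [map_pow, map_pow, pow_succ, ← mul_assoc, pow_mul]
        exact pow_le_pow_left₀ ((frInf k F).w.nonneg _) ih q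
      · rw [hc, AlgHom.commutes, frInf_c]
        have : 1 ≤ C * q ^ (l + 1) := Nat.mul_pos (by omega) (by positivity)
        exact le_self_pow₀ (by norm_num) (by omega)
  have hq1 : 1 ≤ q ^ i := Nat.one_le_pow _ _ (by omega)
  have main := norm_deg k F (pol k F L t ^ q ^ i * ((fmap q c)^[i] β - β)) ?_ ?_
    (t.natDegree * q ^ i + C * q ^ i) ?_
  · obtain ⟨Z, hZ1, hZ2⟩ := main
    refine ⟨Z, hZ1.trans (le_of_eq (by ring)), fun a σ hσ => hZ2 a σ ?_⟩
    rw [map_mul, map_mul, map_pow, map_pow]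
    have h1 : (frPt F a).w (σ (pol k F L t)) ^ q ^ i ≤ 1 :=
      pow_le_one₀ ((frPt F a).w.nonneg _) (LInt.pol (F := F) (L := L) t a σ)
    have h2 : 0 ≤ (frPt F a).w (σ (pol k F L t)) ^ q ^ i := pow_nonneg ((frPt F a).w.nonneg _) _
    have h3 := (frPt F a).w.nonneg (σ ((fmap q c)^[i] β - β))
    nlinarith
  · exact mul_ne_zero (pow_ne_zero _ (pol_ne k F L ht)) (sub_ne_zero.2 (hper i hi))
  · rw [mul_sub]
    refine (hInt i).sub ?_
    obtain ⟨j, hj⟩ : ∃ j, q ^ i = j + 1 := ⟨q ^ i - 1, by omega⟩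
    rw [hj, pow_succ, mul_assoc]
    exact ((LInt.pol t).pow j).mul htI
  · intro σ
    rw [map_mul, map_mul, pow_add, map_pow, map_pow, pol_map, (frInf k F).ext, vinf_poly k F t ht, ← pow_mul]
    refine mul_le_mul_of_nonneg_left ?_ (by positivity)
    rw [map_sub]
    refine (na_sub _ (frInf k F).nonarch _ _).trans (max_le (hinf σ i) ?_)
    exact ((hh σ).trans hC).trans (pow_le_pow_right₀ (by norm_num) (by nlinarith))

theorem count_all (q : ℕ) (hq : 2 ≤ q) (γ : L) (hγ : algebraMap F L (cF k F) - γ ≠ 0) (hγ0 : γ ≠ 0)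
    (hτ : q = 2 → ∃ τ : L →ₐ[F] L, τ γ = -γ) (S : Finset k) :
    ∃ C : ℕ, ∀ j ≥ C, ∀ Z : Finset k,
      (∀ a ∉ S, ∀ σ : L →ₐ[F] (frPt F a).C, (frPt F a).w (σ (pol k F L (aP k q (j + 2)) - γ)) = 1/2 → a ∈ Z) →
      q ^ j ≤ Z.card + C := by
  haveI : CharZero L := charZero_of_injective_algebraMap (algebraMap F L).injective
  obtain ⟨D, hD⟩ := deriv_ext_exists F L (dF k F)
  set c := algebraMap F L (cF k F) with hc
  have hcount : ∃ C : ℕ, ∀ b : k[X], psi k F D q (c - γ) b ≠ 0 → C ≤ b.natDegree → ∀ Z : Finset k,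
      (∀ a ∉ S, ∀ σ : L →ₐ[F] (frPt F a).C, (frPt F a).w (σ (pol k F L b ^ q + (c - γ))) = 1/2 → a ∈ Z) →
      b.natDegree ≤ Z.card + C := by
    by_cases h3 : 3 ≤ q
    · exact count_ge3 k F D hD q h3 _ S
    · have h2 : q = 2 := by omega
      obtain ⟨τ, hτ'⟩ := hτ h2
      subst h2
      refine count_eq2 k F D hD (c - γ) (c + γ) hγ ?_ τ ?_ S
      · intro h
        apply hγ0
        have : 2 * γ = 0 := by linear_combination -h
        simpa using this
      · rw [map_sub, hτ', hc, AlgHom.commutes, sub_neg_eq_add]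
  obtain ⟨C, hC⟩ := hcount
  have hpsi : ∃ j0, ∀ j ≥ j0, psi k F D q (c - γ) (aP k q (j + 1)) ≠ 0 := by
    by_contra! h
    obtain ⟨j1, hj1, h1⟩ := h 0
    obtain ⟨j2, hj2, h2⟩ := h (j1 + 1)
    obtain ⟨m1, d1⟩ := aP_monic k q hq j1
    obtain ⟨m2, d2⟩ := aP_monic k q hq j2
    have := psi_once k F D q (by omega) (c - γ) hγ _ _ m1 m2
      (by rw [d1]; exact Nat.one_le_pow _ _ (by omega)) (by rw [d2]; exact Nat.one_le_pow _ _ (by omega)) h1 h2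
    rw [d1, d2] at this
    have := Nat.pow_right_injective hq this
    omega
  obtain ⟨j0, hj0⟩ := hpsi
  refine ⟨C + j0, fun j hj Z hZ => ?_⟩
  obtain ⟨m1, d1⟩ := aP_monic k q hq j
  have h1 : j < q ^ j := Nat.lt_pow_self (by omega)
  have := hC (aP k q (j + 1)) (hj0 j (by omega)) (by omega) Z (by
    intro a ha σ h
    apply hZ a ha σ
    rw [← h, show aP k q (j + 2) = aP k q (j + 1) ^ q + X from rfl, map_add (pol k F L), map_pow (pol k F L),
      add_sub_assoc]
    rfl)
  omega

theorem prim_zero (q : ℕ) (hq : 2 ≤ q) (N : ℕ) (hN : 1 ≤ N) (β γ : L)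
    (hγβ : (fmap q (algebraMap F L (cF k F)))^[N] γ = β)
    (hper : ∀ n ≥ 1, (fmap q (algebraMap F L (cF k F)))^[n] β ≠ β)
    (hpost : ∀ n ≥ 1, (fmap q (algebraMap F L (cF k F)))^[n] 0 ≠ β)
    (hτ : q = 2 → ∃ τ : L →ₐ[F] L, τ γ = -γ) (S : Finset k) :
    ∃ n0, ∀ n ≥ n0, ∃ a ∉ S, ∃ σ : L →ₐ[F] (frPt F a).C,
      (frPt F a).w (σ (pol k F L (aP k q (n + 1 - N)) - γ)) = 1/2 ∧
      ∀ i, 1 ≤ i → i ≤ n → (frPt F a).w (σ (pol k F L (aP k q i) - β)) = 1 := by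
  classical
  set c := algebraMap F L (cF k F) with hc
  obtain ⟨S1, hS1⟩ := fin_le k F γ
  have hγ0 : γ ≠ 0 := by
    rintro rfl
    exact hpost N hN hγβ
  have hγc : c - γ ≠ 0 := by
    intro h
    apply hpost (N + 1) (by omega)
    rw [Function.iterate_succ_apply, ← hγβ, ← sub_eq_zero.1 h, fmap, zero_pow (by omega), zero_add]
  obtain ⟨C, hC⟩ := count_all k F q hq γ hγc hγ0 hτ (S ∪ S1)
  obtain ⟨C1, hC1⟩ := crit_zeros k F q hq β hpost
  obtain ⟨C2, hC2⟩ := per_zeros k F q hq β hper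
  choose! Z1 hZ1 hZ1' using hC1
  choose! Z2 hZ2 hZ2' using hC2
  obtain ⟨m0, hm0⟩ := lin_lt_pow (((C1 + C2 + C) * q ^ 2) * 2 ^ (N + 1))
  refine ⟨2 * (m0 + N + C + 2), fun n hn => ?_⟩
  set m := n / 2 with hm
  have hmm : m0 + N + C + 2 ≤ m := by omega
  let Z := (Finset.Icc 1 (m + 1)).biUnion Z1 ∪ (Finset.Icc 1 (m + 1)).biUnion Z2
  have hq0 : 0 < q := by omega
  have hcard : ∀ (Zi : ℕ → Finset k) (Ci : ℕ), (∀ i ≥ 1, (Zi i).card ≤ Ci * q ^ i) →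
      ((Finset.Icc 1 (m + 1)).biUnion Zi).card ≤ (m + 1) * (Ci * q ^ (m + 1)) := by
    intro Zi Ci h
    refine Finset.card_biUnion_le.trans ?_
    calc _ ≤ ∑ i ∈ Finset.Icc 1 (m + 1), Ci * q ^ (m + 1) := by
          refine Finset.sum_le_sum fun i hi => ?_
          rw [Finset.mem_Icc] at hi
          exact (h i hi.1).trans (Nat.mul_le_mul_left _ (Nat.pow_le_pow_right hq0 hi.2))
      _ = _ := by simp
  have hZc : Z.card ≤ (m + 1) * ((C1 + C2) * q ^ (m + 1)) := by
    refine (Finset.card_union_le _ _).trans ((Nat.add_le_add (hcard Z1 C1 hZ1) (hcard Z2 C2 hZ2)).trans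
      (le_of_eq (by ring)))
  obtain ⟨j, hj⟩ : ∃ j, n + 1 - N = j + 2 := ⟨n - 1 - N, by omega⟩
  have hjm : 2 * m ≤ j + N + 1 := by omega
  have hlt : Z.card + C < q ^ j := by
    have h1 := hm0 m (by omega)
    have h2 : (2:ℕ) ^ m = 2 ^ (m - (N + 1)) * 2 ^ (N + 1) := by rw [← pow_add]; congr 1; omega
    have h3 : (C1 + C2 + C) * q ^ 2 * (m + 1) < 2 ^ (m - (N + 1)) := by
      rw [h2] at h1
      refine lt_of_mul_lt_mul_right (a := 2 ^ (N + 1)) ?_ (by positivity)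
      calc _ = (C1 + C2 + C) * q ^ 2 * 2 ^ (N + 1) * (m + 1) := by ring
        _ < _ := h1
    have h4 : (2:ℕ) ^ (m - (N + 1)) ≤ q ^ (m - (N + 1)) := Nat.pow_le_pow_left hq _
    have h5 : q ^ m * q ^ (m - (N + 1)) ≤ q ^ j := by
      rw [← pow_add]; exact Nat.pow_le_pow_right hq0 (by omega)
    have h6 : 1 ≤ q ^ m := Nat.one_le_pow _ _ hq0
    calc Z.card + C ≤ (m + 1) * ((C1 + C2) * q ^ (m + 1)) + C := by omega
      _ ≤ (m + 1) * ((C1 + C2) * q ^ (m + 2)) + (m + 1) * (C * q ^ (m + 2)) := by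
        have h7 : q ^ (m + 1) ≤ q ^ (m + 2) := Nat.pow_le_pow_right hq0 (by omega)
        have h8 : 1 ≤ q ^ (m + 2) := Nat.one_le_pow _ _ hq0
        have h9 : (m + 1) * ((C1 + C2) * q ^ (m + 1)) ≤ (m + 1) * ((C1 + C2) * q ^ (m + 2)) := by gcongr
        have h10 : C ≤ (m + 1) * (C * q ^ (m + 2)) := by
          calc C = 1 * (C * 1) := by ring
            _ ≤ _ := Nat.mul_le_mul (by omega) (Nat.mul_le_mul_left _ h8)
        omega
      _ = q ^ m * ((C1 + C2 + C) * q ^ 2 * (m + 1)) := by ring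
      _ < q ^ m * q ^ (m - (N + 1)) := Nat.mul_lt_mul_of_pos_left (h3.trans_le h4) h6
      _ ≤ q ^ j := h5
  have hex : ∃ a ∉ S ∪ S1, ∃ σ : L →ₐ[F] (frPt F a).C,
      (frPt F a).w (σ (pol k F L (aP k q (j + 2)) - γ)) = 1/2 ∧ a ∉ Z := by
    by_contra! hcon
    have := hC j (by omega) Z hcon
    omega
  obtain ⟨a, ha, σ, hσ, haZ⟩ := hex
  rw [Finset.notMem_union] at ha
  refine ⟨a, ha.1, σ, by rw [hj]; exact hσ, fun i hi1 hin => ?_⟩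
  have hcC : (frPt F a).w (σ c) ≤ 1 := by rw [hc, AlgHom.commutes]; exact frPt_c_le k F a
  have hγ1 := hS1 a ha.2 σ
  have hit : ∀ x l, σ ((fmap q c)^[l] x) = (fmap q (σ c))^[l] (σ x) := fun x l =>
    fmap_map (σ : L →+* (frPt F a).C) q c x l
  have hw := (frPt F a).nonarch
  have hβ1 : (frPt F a).w (σ β) ≤ 1 := by
    rw [← hγβ, hit]
    exact iter_le _ hw q _ hcC _ hγ1 N
  have hai : ∀ i, (frPt F a).w (σ (pol k F L (aP k q i))) ≤ 1 := fun i => LInt.pol _ a σ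
  have hle : (frPt F a).w (σ (pol k F L (aP k q i) - β)) ≤ 1 := by
    rw [map_sub]
    exact (na_sub _ hw _ _).trans (max_le (hai i) hβ1)
  by_contra hne
  have hlt' := lt_of_le_of_ne hle hne
  apply haZ
  rw [Finset.mem_union, Finset.mem_biUnion, Finset.mem_biUnion]
  by_cases him : i ≤ m + 1
  · left
    exact ⟨i, Finset.mem_Icc.2 ⟨hi1, him⟩, hZ1' i hi1 a σ hlt'⟩
  · right
    refine ⟨n + 1 - i, Finset.mem_Icc.2 ⟨by omega, by omega⟩, hZ2' _ (by omega) a σ ?_⟩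
    have hap : ∀ l l', pol k F L (aP k q (l' + l)) = (fmap q c)^[l'] (pol k F L (aP k q l)) := by
      intro l l'
      rw [aP_pol, aP_pol, Function.iterate_add_apply]
    have e1 : (frPt F a).w (σ (pol k F L (aP k q (n + 1)) - β)) < 1 := by
      rw [show n + 1 = N + (j + 2) by omega, hap, ← hγβ, map_sub, hit, hit]
      refine (iter_sub_le _ hw q _ hcC _ _ (hai _) hγ1 N).trans_lt ?_
      rw [← map_sub, hσ]; norm_num
    have e2 : (frPt F a).w (σ (pol k F L (aP k q (n + 1)) - (fmap q c)^[n + 1 - i] β)) < 1 := by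
      rw [show n + 1 = (n + 1 - i) + i by omega, hap, Nat.add_sub_cancel, map_sub, hit, hit]
      refine (iter_sub_le _ hw q _ hcC _ _ (hai _) hβ1 _).trans_lt ?_
      rwa [← map_sub]
    have e3 : (fmap q c)^[n + 1 - i] β - β = (pol k F L (aP k q (n + 1)) - β) -
      (pol k F L (aP k q (n + 1)) - (fmap q c)^[n + 1 - i] β) := by ring
    rw [e3, map_sub]
    exact (na_sub _ hw _ _).trans_lt (max_lt e1 e2)
end prim

section kummer
variable {K Ω : Type*} [Field K] [Field Ω] [CharZero Ω] [Algebra K Ω] [Algebra.IsAlgebraic K Ω]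
  [IsAlgClosed Ω]

theorem aut_fix_sup (E : IntermediateField K Ω) (τ : Ω ≃ₐ[E] Ω) (x : Ω) (hx : τ x = x) (y : Ω)
    (hy : y ∈ E ⊔ IntermediateField.adjoin K {x}) : τ y = y := by
  rw [← IntermediateField.restrictScalars_adjoin_eq_sup, IntermediateField.mem_restrictScalars] at hy
  induction hy using IntermediateField.adjoin_induction with
  | mem z hz => rw [Set.mem_singleton_iff.1 hz]; exact hx
  | algebraMap z => exact τ.commutes z
  | add a b _ _ h1 h2 => rw [map_add, h1, h2]
  | inv a _ h => rw [map_inv₀, h]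
  | mul a b _ _ h1 h2 => rw [map_mul, h1, h2]

theorem aut_fix_mem (E : IntermediateField K Ω) (y : Ω) (h : ∀ τ : Ω ≃ₐ[E] Ω, τ y = y) : y ∈ E := by
  have : Algebra.IsAlgebraic E Ω := Algebra.IsAlgebraic.tower_top (K := K) E
  have h1 := step_fix (E := E) y 0 (fun τ _ => h τ)
  have h2 : IntermediateField.adjoin E {(0:Ω)} = ⊥ := by
    rw [IntermediateField.adjoin_simple_eq_bot_iff]; exact zero_mem _
  rw [h2, IntermediateField.mem_bot] at h1
  obtain ⟨z, rfl⟩ := h1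
  exact z.2

/-- independence modulo `p`-th powers -/
def KInd (p : ℕ) {ι : Type*} [Fintype ι] (E : IntermediateField K Ω) (b : ι → Ω) : Prop :=
  (∀ i, b i ∈ E) ∧ (∀ i, b i ≠ 0) ∧ ∀ (e : ι → ℕ), ∀ w ∈ E, ∏ i, b i ^ e i = w ^ p → ∀ i, p ∣ e i

theorem finrank_simple_sup (E : IntermediateField K Ω) (x : Ω) :
    Module.finrank K ↥(E ⊔ IntermediateField.adjoin K {x}) =
      (minpoly E x).natDegree * Module.finrank K E := by
  have : Algebra.IsAlgebraic E Ω := Algebra.IsAlgebraic.tower_top (K := K) E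
  rw [← IntermediateField.restrictScalars_adjoin_eq_sup,
    ← IntermediateField.adjoin.finrank (K := E) (Algebra.IsIntegral.isIntegral x), mul_comm]
  exact (Module.finrank_mul_finrank K E (IntermediateField.adjoin E {x})).symm

theorem kummer_step (p : ℕ) (hp : p.Prime)
    (hζ : ∀ ζ : Ω, ζ ^ (p ^ 2) = 1 → ∃ z : K, algebraMap K Ω z = ζ)
    {ι : Type*} [Fintype ι] [DecidableEq ι] (E : IntermediateField K Ω) (b : ι → Ω) (hb : KInd p E b)
    (i0 : ι) (x : Ω) (hx : x ^ p = b i0) :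
    Module.finrank K ↥(E ⊔ IntermediateField.adjoin K {x}) = p * Module.finrank K E ∧
      KInd p (E ⊔ IntermediateField.adjoin K {x}) (Function.update b i0 x) := by
  have : Algebra.IsAlgebraic E Ω := Algebra.IsAlgebraic.tower_top (K := K) E
  obtain ⟨hbE, hb0, hind⟩ := hb
  have hζp : ∀ ζ : Ω, ζ ^ p = 1 → ∃ z : K, algebraMap K Ω z = ζ := fun ζ h =>
    hζ ζ (by rw [pow_two, pow_mul, h, one_pow])
  have hζE : ∀ ζ : Ω, ζ ^ p = 1 → ∃ e : E, algebraMap E Ω e = ζ := fun ζ h => by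
    obtain ⟨z, hz⟩ := hζp ζ h
    exact ⟨algebraMap K E z, by rw [← hz]; rfl⟩
  have hfixζ : ∀ (τ : Ω ≃ₐ[E] Ω) (ζ : Ω), ζ ^ (p ^ 2) = 1 → τ ζ = ζ := fun τ ζ h => by
    obtain ⟨z, rfl⟩ := hζ ζ h
    exact τ.commutes (algebraMap K E z)
  have hx0 : x ≠ 0 := by
    rintro rfl
    rw [zero_pow hp.ne_zero] at hx
    exact hb0 i0 hx.symm
  have hnx : ∀ e : E, algebraMap E Ω e ≠ x := by
    intro e he
    have := hind (Pi.single i0 1) x (by rw [← he]; exact e.2) (by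
      rw [Fintype.prod_eq_single i0, Pi.single_eq_same, pow_one, hx]
      intro j hj
      rw [Pi.single_eq_of_ne hj, pow_zero]) i0
    rw [Pi.single_eq_same] at this
    exact hp.one_lt.ne' (Nat.dvd_one.1 this)
  have hmin := step_irr p hp hζE x ⟨b i0, hbE i0⟩ hx hnx
  have hp0 : NeZero p := ⟨hp.ne_zero⟩
  haveI : NeZero (p : Ω) := ⟨Nat.cast_ne_zero.2 hp.ne_zero⟩
  obtain ⟨ζ, hprim⟩ := HasEnoughRootsOfUnity.exists_primitiveRoot Ω p
  have hζ2 : ζ ^ p ^ 2 = 1 := by rw [pow_two, pow_mul, hprim.pow_eq_one, one_pow]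
  obtain ⟨τ0, hτ0⟩ := step_conj (E := E) x (ζ * x) (by
    rw [hmin]
    simp only [map_sub, map_pow, aeval_X, aeval_C, mul_pow, hprim.pow_eq_one, one_mul, hx]
    exact sub_self _)
  have hpowx : ∀ i : ℕ, (τ0 ^ i) x = ζ ^ i * x := by
    intro i
    induction i with
    | zero => simp
    | succ i ih => rw [pow_succ', AlgEquiv.mul_apply, ih, map_mul, map_pow, hfixζ τ0 ζ hζ2, hτ0]; ring
  have hgen : ∀ τ : Ω ≃ₐ[E] Ω, ∃ i : ℕ, τ x = (τ0 ^ i) x := by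
    intro τ
    have h1 : (τ x / x) ^ p = 1 := by
      rw [div_pow, ← map_pow, hx, div_eq_one_iff_eq (hb0 i0)]
      exact τ.commutes ⟨b i0, hbE i0⟩
    obtain ⟨i, -, hi⟩ := hprim.eq_pow_of_pow_eq_one h1
    exact ⟨i, by rw [hpowx, hi]; field_simp⟩
  have hfixE : ∀ u ∈ E ⊔ IntermediateField.adjoin K {x}, τ0 u = u → u ∈ E := by
    intro u hu h
    refine aut_fix_mem E u fun τ => ?_
    obtain ⟨i, hi⟩ := hgen τ
    have h1 : ((τ0 ^ i)⁻¹ * τ) u = u := by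
      refine aut_fix_sup E _ x ?_ u hu
      rw [AlgEquiv.mul_apply, hi, ← AlgEquiv.mul_apply, inv_mul_cancel]; rfl
    have h2 : ∀ j : ℕ, (τ0 ^ j) u = u := by
      intro j
      induction j with
      | zero => rfl
      | succ j ih => rw [pow_succ', AlgEquiv.mul_apply, ih, h]
    have h3 : τ u = (τ0 ^ i) u := by
      conv_rhs => rw [← h1]
      rw [← AlgEquiv.mul_apply, mul_inv_cancel_left]
    rw [h3, h2]
  have hxm : x ∈ E ⊔ IntermediateField.adjoin K {x} :=
    (le_sup_right : _ ≤ E ⊔ _) (IntermediateField.mem_adjoin_simple_self K x)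
  refine ⟨?_, ?_, ?_, ?_⟩
  · rw [finrank_simple_sup, hmin, natDegree_X_pow_sub_C]
  · intro i
    by_cases hi : i = i0
    · subst hi; simpa using hxm
    · rw [Function.update_of_ne hi]
      exact (le_sup_left : E ≤ _) (hbE i)
  · intro i
    by_cases hi : i = i0
    · subst hi; simpa using hx0
    · rw [Function.update_of_ne hi]; exact hb0 i
  intro e w hw he
  have hprod : ∀ (y : Ω) (e : ι → ℕ), ∏ i, Function.update b i0 y i ^ e i =
      y ^ e i0 * ∏ i ∈ Finset.univ.erase i0, b i ^ e i := by
    intro y e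
    rw [← Finset.mul_prod_erase _ _ (Finset.mem_univ i0), Function.update_self]
    congr 1
    refine Finset.prod_congr rfl fun i hi => ?_
    rw [Function.update_of_ne (Finset.ne_of_mem_erase hi)]
  set B := ∏ i ∈ Finset.univ.erase i0, b i ^ e i with hB
  have hBE : B ∈ E := prod_mem fun i _ => pow_mem (hbE i) _
  have hB0 : B ≠ 0 := Finset.prod_ne_zero_iff.2 fun i _ => pow_ne_zero _ (hb0 i)
  rw [hprod] at he
  have hw0 : w ≠ 0 := by
    rintro rfl
    rw [zero_pow hp.ne_zero] at he
    exact mul_ne_zero (pow_ne_zero _ hx0) hB0 he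
  -- first p ∣ e i0
  set η := τ0 w / w with hη
  have hτw : τ0 w = η * w := by rw [hη]; field_simp
  have hηp : η ^ p = ζ ^ e i0 := by
    rw [hη, div_pow, ← map_pow, ← he, map_mul, map_pow, hτ0, mul_pow,
      show τ0 B = B from τ0.commutes ⟨B, hBE⟩]
    have := pow_ne_zero (e i0) hx0
    rw [← hB, mul_assoc, mul_div_assoc, div_self (mul_ne_zero this hB0), mul_one]
  have hη2 : η ^ p ^ 2 = 1 := by
    rw [pow_two, pow_mul, hηp, ← pow_mul, mul_comm, pow_mul, hprim.pow_eq_one, one_pow]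
  have hpoww : ∀ i : ℕ, (τ0 ^ i) w = η ^ i * w := by
    intro i
    induction i with
    | zero => simp
    | succ i ih => rw [pow_succ', AlgEquiv.mul_apply, ih, map_mul, map_pow, hfixζ τ0 η hη2, hτw]; ring
  have hηp1 : η ^ p = 1 := by
    have h1 := aut_fix_sup E (τ0 ^ p) x (by rw [hpowx, hprim.pow_eq_one, one_mul]) w hw
    rw [hpoww] at h1
    exact (mul_eq_right₀ hw0).1 h1
  have hdvd : p ∣ e i0 := hprim.dvd_of_pow_eq_one _ (hηp ▸ hηp1)
  obtain ⟨m, hm⟩ := hdvd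
  obtain ⟨j, hj, hjη⟩ := hprim.eq_pow_of_pow_eq_one hηp1
  have hu := hfixE (w * x ^ (p - j)) (mul_mem hw (pow_mem hxm _)) (by
    rw [map_mul, map_pow, hτw, hτ0, ← hjη, mul_pow]
    have : ζ ^ j * ζ ^ (p - j) = 1 := by rw [← pow_add, Nat.add_sub_cancel' hj.le, hprim.pow_eq_one]
    linear_combination w * x ^ (p - j) * this)
  have key := hind (Function.update e i0 (m + (p - j))) _ hu (by
    rw [← Finset.mul_prod_erase _ _ (Finset.mem_univ i0), Function.update_self]
    have : ∏ i ∈ Finset.univ.erase i0, b i ^ (Function.update e i0 (m + (p - j)) i) = B :=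
      Finset.prod_congr rfl fun i hi => by rw [Function.update_of_ne (Finset.ne_of_mem_erase hi)]
    rw [this, mul_pow, ← he, hm, pow_mul, hx, ← pow_mul, mul_comm (p - j) p, pow_mul, hx, pow_add]
    ring)
  intro i
  by_cases hi : i = i0
  · subst hi; exact ⟨m, hm⟩
  · have := key i
    rwa [Function.update_of_ne hi] at this

theorem kummer_chain (p : ℕ) (hp : p.Prime)
    (hζ : ∀ ζ : Ω, ζ ^ (p ^ 2) = 1 → ∃ z : K, algebraMap K Ω z = ζ)
    {ι : Type*} [Fintype ι] [DecidableEq ι] (i0 : ι) (r : ℕ) (E : IntermediateField K Ω) (b : ι → Ω)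
    (hb : KInd p E b) (x : Ω) (hx : x ^ p ^ r = b i0) :
    Module.finrank K ↥(E ⊔ IntermediateField.adjoin K {x}) = p ^ r * Module.finrank K E ∧
      KInd p (E ⊔ IntermediateField.adjoin K {x}) (Function.update b i0 x) := by
  induction r generalizing x with
  | zero =>
    rw [pow_zero, pow_one] at hx
    have : IntermediateField.adjoin K {x} ≤ E := by
      rw [IntermediateField.adjoin_simple_le_iff, hx]; exact hb.1 i0
    rw [sup_eq_left.2 this, hx, Function.update_eq_self]
    exact ⟨by simp, hb⟩
  | succ r ih =>
    obtain ⟨h1, h2⟩ := ih (x ^ p) (by rw [← pow_mul, ← pow_succ', hx])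
    obtain ⟨h3, h4⟩ := kummer_step p hp hζ _ _ h2 i0 x (by simp)
    have : E ⊔ IntermediateField.adjoin K {x ^ p} ⊔ IntermediateField.adjoin K {x} =
        E ⊔ IntermediateField.adjoin K {x} := by
      rw [sup_assoc]
      congr 1
      refine sup_eq_right.2 ?_
      rw [IntermediateField.adjoin_simple_le_iff]
      exact pow_mem (IntermediateField.mem_adjoin_simple_self K x) _
    rw [this] at h3 h4
    rw [Function.update_idem] at h4
    exact ⟨by rw [h3, h1]; ring, h4⟩

theorem sup_adjoin_insert {ι : Type*} [DecidableEq ι] (E : IntermediateField K Ω) (x : ι → Ω)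
    (i : ι) (s : Finset ι) :
    E ⊔ IntermediateField.adjoin K (x '' ((insert i s : Finset ι) : Set ι)) =
      E ⊔ IntermediateField.adjoin K (x '' (s : Set ι)) ⊔ IntermediateField.adjoin K {x i} := by
  rw [Finset.coe_insert, Set.image_insert_eq, Set.insert_eq, IntermediateField.adjoin_union, sup_assoc,
    sup_comm (IntermediateField.adjoin K {x i})]

theorem sup_adjoin_empty {ι : Type*} (E : IntermediateField K Ω) (x : ι → Ω) :
    E ⊔ IntermediateField.adjoin K (x '' ((∅ : Finset ι) : Set ι)) = E := by simp

theorem kummer_all (p r : ℕ) (hp : p.Prime)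
    (hζ : ∀ ζ : Ω, ζ ^ (p ^ 2) = 1 → ∃ z : K, algebraMap K Ω z = ζ)
    {ι : Type*} [Fintype ι] (E : IntermediateField K Ω) (b : ι → Ω)
    (hb : KInd p E b) (x : ι → Ω) (hx : ∀ i, x i ^ p ^ r = b i) :
    Module.finrank K ↥(E ⊔ IntermediateField.adjoin K (Set.range x)) =
      (p ^ r) ^ Fintype.card ι * Module.finrank K E := by
  classical
  have main : ∀ s : Finset ι, Module.finrank K ↥(E ⊔ IntermediateField.adjoin K (x '' (s : Set ι))) =
      (p ^ r) ^ s.card * Module.finrank K E ∧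
      KInd p (E ⊔ IntermediateField.adjoin K (x '' (s : Set ι))) (fun i => if i ∈ s then x i else b i) := by
    intro s
    induction s using Finset.induction_on with
    | empty => rw [sup_adjoin_empty]; simpa using hb
    | insert i s hi ih =>
      obtain ⟨h1, h2⟩ := ih
      obtain ⟨h3, h4⟩ := kummer_chain p hp hζ i r _ _ h2 (x i) (by simp [hi, hx])
      rw [sup_adjoin_insert, Finset.card_insert_of_notMem hi]
      refine ⟨by rw [h3, h1]; ring, ?_⟩
      convert h4 using 1
      ext j
      by_cases hj : j = i
      · subst hj; simp
      · simp [hj]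
  have := (main Finset.univ).1
  rwa [Finset.coe_univ, Set.image_univ, Finset.card_univ] at this

theorem kummer_upper (q : ℕ) (hq : 0 < q) {ι : Type*} (s : Finset ι)
    (E : IntermediateField K Ω) (x : ι → Ω) (hx : ∀ i ∈ s, x i ^ q ∈ E) :
    Module.finrank K ↥(E ⊔ IntermediateField.adjoin K (x '' (s : Set ι))) ≤ q ^ s.card * Module.finrank K E := by
  classical
  induction s using Finset.induction_on with
  | empty => rw [sup_adjoin_empty]; simp
  | insert i s hi ih =>
    rw [sup_adjoin_insert, Finset.card_insert_of_notMem hi, finrank_simple_sup]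
    have h1 := ih fun j hj => hx j (Finset.mem_insert_of_mem hj)
    set E' := E ⊔ IntermediateField.adjoin K (x '' (s : Set ι)) with hE'
    have hm : x i ^ q ∈ E' := (le_sup_left : E ≤ E') (hx i (Finset.mem_insert_self _ _))
    have h2 : (minpoly E' (x i)).natDegree ≤ q := by
      have h3 := natDegree_le_of_dvd (minpoly.dvd E' (x i) (p := X ^ q - C ⟨x i ^ q, hm⟩) (by
        simp only [map_sub, map_pow, aeval_X, aeval_C]; exact sub_self _))
        (monic_X_pow_sub_C _ hq.ne').ne_zero
      rwa [natDegree_X_pow_sub_C] at h3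
    calc _ ≤ q * (q ^ s.card * Module.finrank K E) := Nat.mul_le_mul h2 h1
      _ = _ := by ring
end kummer

section pre
variable {Ω : Type*} [Field Ω]

theorem iter_finite (q : ℕ) (hq : 0 < q) (c γ : Ω) (m : ℕ) : {x : Ω | (fmap q c)^[m] x = γ}.Finite := by
  induction m with
  | zero => simp
  | succ m ih =>
    have : {x : Ω | (fmap q c)^[m + 1] x = γ} ⊆
        ⋃ α ∈ {x : Ω | (fmap q c)^[m] x = γ}, {x | fmap q c x = α} := by
      intro x hx
      have hx' : (fmap q c)^[m + 1] x = γ := hx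
      rw [Function.iterate_succ_apply] at hx'
      simp only [Set.mem_iUnion, Set.mem_setOf_eq]
      exact ⟨_, hx', rfl⟩
    exact (ih.biUnion fun α _ => children_finite q hq c α).subset this

/-- the finset of `m`-fold preimages -/
noncomputable def pre (q : ℕ) (hq : 0 < q) (c γ : Ω) (m : ℕ) : Finset Ω := (iter_finite q hq c γ m).toFinset

theorem mem_pre {q : ℕ} {hq : 0 < q} {c γ : Ω} {m : ℕ} {x : Ω} :
    x ∈ pre q hq c γ m ↔ (fmap q c)^[m] x = γ := by
  simp [pre]

variable [CharZero Ω] [IsAlgClosed Ω]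

theorem pre_one (q : ℕ) (hq : 0 < q) (c α : Ω) (hα : α ≠ c) :
    (∀ y, ∏ t ∈ pre q hq c α 1, (y - t) = fmap q c y - α) ∧ (pre q hq c α 1).card = q := by
  classical
  obtain ⟨x, hx⟩ := IsAlgClosed.exists_pow_nat_eq (α - c) hq
  have hx0 : x ≠ 0 := by
    rintro rfl
    rw [zero_pow hq.ne'] at hx
    exact hα (sub_eq_zero.1 hx.symm)
  have hinj : Set.InjOn (fun ζ : Ω => ζ * x) (nthRootsFinset q (1 : Ω)) :=
    fun a _ b _ h => mul_right_cancel₀ hx0 h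
  have himg : pre q hq c α 1 = (nthRootsFinset q (1 : Ω)).image (fun ζ => ζ * x) := by
    ext t
    rw [mem_pre, Finset.mem_image]
    simp only [mem_nthRootsFinset hq, Function.iterate_one, fmap]
    constructor
    · intro h
      refine ⟨t / x, ?_, by field_simp⟩
      rw [div_pow, hx, ← h, add_sub_cancel_right, div_self]
      rw [← h, add_sub_cancel_right] at hx
      rw [← hx]; exact pow_ne_zero _ hx0
    · rintro ⟨ζ, h, rfl⟩
      rw [mul_pow, h, hx]; ring
  rw [himg]
  refine ⟨fun y => ?_, ?_⟩
  · rw [Finset.prod_image hinj, ← pow_sub_prod q y x hq, hx, fmap]; ring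
  · rw [Finset.card_image_of_injOn hinj, card_roots1 q hq]

theorem pre_prod (q : ℕ) (hq : 0 < q) (c γ : Ω) (hγ : ∀ j ≥ 1, (fmap q c)^[j] 0 ≠ γ) (m : ℕ) :
    (∀ y, ∏ t ∈ pre q hq c γ m, (y - t) = (fmap q c)^[m] y - γ) ∧ (pre q hq c γ m).card = q ^ m := by
  classical
  induction m with
  | zero =>
    have : pre q hq c γ 0 = {γ} := by ext t; simp [mem_pre]
    simp [this]
  | succ m ih =>
    have hbi : pre q hq c γ (m + 1) = (pre q hq c γ m).biUnion (fun α => pre q hq c α 1) := by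
      ext t
      simp [mem_pre]
    have hdis : ((pre q hq c γ m : Finset Ω) : Set Ω).PairwiseDisjoint (fun α => pre q hq c α 1) := by
      intro a _ b _ hab
      rw [Function.onFun, Finset.disjoint_left]
      intro t h1 h2
      rw [mem_pre] at h1 h2
      exact hab (h1.symm.trans h2)
    have hne : ∀ α ∈ pre q hq c γ m, α ≠ c := by
      rintro α h rfl
      rw [mem_pre] at h
      apply hγ (m + 1) (by omega)
      rw [Function.iterate_succ_apply, fmap, zero_pow hq.ne', zero_add, h]
    rw [hbi]
    refine ⟨fun y => ?_, ?_⟩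
    · rw [Finset.prod_biUnion hdis, Function.iterate_succ_apply, ← ih.1 (fmap q c y)]
      exact Finset.prod_congr rfl fun α hα => (pre_one q hq c α (hne α hα)).1 y
    · rw [Finset.card_biUnion hdis, Finset.sum_congr rfl fun α hα => (pre_one q hq c α (hne α hα)).2,
        Finset.sum_const, ih.2, smul_eq_mul, pow_succ]
end pre

theorem unique_half {ι : Type*} (s : Finset ι) (v : ι → ℝ) (hv : ∀ i ∈ s, ∃ n : ℤ, v i = 2 ^ n)
    (hle : ∀ i ∈ s, v i ≤ 1) (hprod : ∏ i ∈ s, v i = 1 / 2) :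
    ∃ i0 ∈ s, v i0 = 1 / 2 ∧ ∀ i ∈ s, i ≠ i0 → v i = 1 := by
  classical
  have hpos : ∀ i ∈ s, 0 < v i := fun i hi => by
    obtain ⟨n, hn⟩ := hv i hi
    rw [hn]; positivity
  obtain ⟨i0, hi0, hne⟩ : ∃ i0 ∈ s, v i0 ≠ 1 := by
    by_contra! h
    rw [Finset.prod_eq_one h] at hprod
    norm_num at hprod
  have hhalf : v i0 ≤ 1 / 2 := by
    obtain ⟨n, hn⟩ := hv i0 hi0
    have h1 : (2:ℝ) ^ n < 2 ^ (0:ℤ) := by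
      rw [← hn, zpow_zero]; exact lt_of_le_of_ne (hle i0 hi0) hne
    have h2 : n < 0 := (zpow_lt_zpow_iff_right₀ (by norm_num)).1 h1
    have h3 : (2:ℝ) ^ n ≤ 2 ^ (-1:ℤ) := zpow_le_zpow_right₀ (by norm_num) (by omega)
    rw [hn]; refine h3.trans (by norm_num)
  rw [← Finset.mul_prod_erase s v hi0] at hprod
  set R := ∏ i ∈ s.erase i0, v i with hR
  have hR1 : R ≤ 1 := Finset.prod_le_one (fun i hi => (hpos i (Finset.mem_of_mem_erase hi)).le)
    fun i hi => hle i (Finset.mem_of_mem_erase hi)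
  have h0 := hpos i0 hi0
  have hR2 : R = 1 := by
    apply le_antisymm hR1
    by_contra! h
    nlinarith
  rw [hR2, mul_one] at hprod
  refine ⟨i0, hi0, hprod, fun i hi hne => ?_⟩
  have hi' : i ∈ s.erase i0 := Finset.mem_erase.2 ⟨hne, hi⟩
  apply le_antisymm (hle i hi)
  rw [← hR2, hR, ← Finset.mul_prod_erase _ v hi']
  refine mul_le_of_le_one_right (hpos i hi).le (Finset.prod_le_one (fun j hj => ?_) fun j hj => ?_)
  · exact (hpos j (Finset.mem_of_mem_erase (Finset.mem_of_mem_erase hj))).le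
  · exact hle j (Finset.mem_of_mem_erase (Finset.mem_of_mem_erase hj))

section place
variable (k : Type*) (F : Type u) [Field k] [CharZero k] [IsAlgClosed k] [Field F] [CharZero F]
  [Algebra k[X] F] [IsFractionRing k[X] F]

theorem frPt_zeta (a : k) (n : ℕ) (hn : 0 < n) (ζ : (frPt F a).C) (h : ζ ^ n = 1) :
    ζ ∈ (frPt F a).B ∧ (ζ ≠ 1 → (frPt F a).w (1 - ζ) = 1) := by
  obtain ⟨z, hz, rfl⟩ := root_unity_lift ((algebraMap F (frPt F a).C).comp (kF k F)) n hn ζ h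
  refine ⟨(frPt F a).B.algebraMap_mem _, fun h => ?_⟩
  have : (1 : (frPt F a).C) - ((algebraMap F (frPt F a).C).comp (kF k F)) z =
      algebraMap F (frPt F a).C (kF k F (1 - z)) := by simp
  rw [this, (frPt F a).ext, vpt_const]
  rintro h1
  apply h
  rw [sub_eq_zero.1 h1 |>.symm, map_one]

/-- a `q`-th root of a unit of the base completion is in the base completion -/
theorem frPt_root_mem (a : k) (q : ℕ) (hq : 0 < q) (x : (frPt F a).C) (hx : x ^ q ∈ (frPt F a).B)
    (h1 : (frPt F a).w (x ^ q) = 1) : x ∈ (frPt F a).B := by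
  have hw : (frPt F a).w x = 1 := by
    rw [map_pow] at h1
    exact (pow_eq_one_iff_of_nonneg ((frPt F a).w.nonneg _) hq.ne').1 h1
  have hx0 : x ≠ 0 := by
    rintro rfl
    rw [map_zero] at hw; exact zero_ne_one hw
  refine frPt_mem F a x hw.le fun τ hτ => ?_
  have h2 : (τ x / x) ^ q = 1 := by
    rw [div_pow, ← map_pow, show τ (x ^ q) = x ^ q from τ.commutes ⟨_, hx⟩, div_self (pow_ne_zero _ hx0)]
  have h3 := (frPt_zeta k F a q hq _ h2).2
  by_contra hne
  have h4 := h3 (by rwa [Ne, div_eq_one_iff_eq hx0])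
  have h5 : x - τ x = x * (1 - τ x / x) := by field_simp
  rw [h5, map_mul, hw, h4] at hτ
  norm_num at hτ

variable {K Ω : Type*} [Field K] [Field Ω] [Algebra F K] [Algebra K Ω]
  [IsAlgClosed Ω] [CharZero Ω] [Algebra F Ω] [IsScalarTower F K Ω]

theorem place_indep (a : k) (q : ℕ) (hq : 2 ≤ q) (ι : Ω →ₐ[F] (frPt F a).C) (n N : ℕ) (hn : N ≤ n)
    (β : K) (γ : Ω)
    (hγN : (fmap q (algebraMap F Ω (cF k F)))^[N] γ = algebraMap K Ω β)
    (hpost : ∀ n ≥ 1, (fmap q (algebraMap F Ω (cF k F)))^[n] 0 ≠ algebraMap K Ω β)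
    (hB : ∀ x : K, ι (algebraMap K Ω x) ∈ (frPt F a).B)
    (hβ : (frPt F a).w (ι (algebraMap K Ω β)) ≤ 1)
    (h1 : ∀ i, 1 ≤ i → i ≤ n →
      (frPt F a).w (ι ((fmap q (algebraMap F Ω (cF k F)))^[i] 0 - algebraMap K Ω β)) = 1)
    (h2 : (frPt F a).w (ι ((fmap q (algebraMap F Ω (cF k F)))^[n + 1 - N] 0 - γ)) = 1 / 2)
    (h3 : ∀ γ', (fmap q (algebraMap F Ω (cF k F)))^[N] γ' = algebraMap K Ω β → γ' ≠ γ →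
      (frPt F a).w (ι (γ - γ')) = 1) :
    (∀ y ∈ IntermediateField.adjoin K {x : Ω | (fmap q (algebraMap F Ω (cF k F)))^[n] x = algebraMap K Ω β},
      ι y ∈ (frPt F a).B) ∧
    ∃ α0, (fmap q (algebraMap F Ω (cF k F)))^[n - N] α0 = γ ∧
      (frPt F a).w (ι (α0 - algebraMap F Ω (cF k F))) = 1 / 2 ∧
      ∀ α, (fmap q (algebraMap F Ω (cF k F)))^[n] α = algebraMap K Ω β → α ≠ α0 →
        (frPt F a).w (ι (α - algebraMap F Ω (cF k F))) = 1 := by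
  have hq0 : 0 < q := by omega
  set c := algebraMap F Ω (cF k F) with hc
  have hιc : ι c = algebraMap F (frPt F a).C (cF k F) := by rw [hc, AlgHom.commutes]
  have hwc : (frPt F a).w (ι c) ≤ 1 := by rw [hιc]; exact frPt_c_le k F a
  have hna := (frPt F a).nonarch
  have hiter : ∀ (x : Ω) (m : ℕ), ι ((fmap q c)^[m] x) = (fmap q (ι c))^[m] (ι x) :=
    fun x m => fmap_map ι.toRingHom q c x m
  have hcB : ι c ∈ (frPt F a).B := by rw [hιc]; exact (frPt F a).B.algebraMap_mem _
  -- integrality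
  have hIntg : ∀ m x, (frPt F a).w (ι ((fmap q c)^[m] x)) ≤ 1 → (frPt F a).w (ι x) ≤ 1 := by
    intro m
    induction m with
    | zero => intro x hx; exact hx
    | succ m ih =>
      intro x hx
      rw [Function.iterate_succ_apply] at hx
      have h5 := ih _ hx
      have h6 : (ι x) ^ q = ι (fmap q c x) - ι c := by rw [fmap, map_add, map_pow]; ring
      have h7 : (frPt F a).w (ι x) ^ q ≤ 1 := by
        rw [← map_pow, h6]
        exact (na_sub _ hna _ _).trans (max_le h5 hwc)
      exact (pow_le_one_iff_of_nonneg ((frPt F a).w.nonneg _) hq0.ne').1 h7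
  have hintT : ∀ m x, (fmap q c)^[m] x = algebraMap K Ω β → (frPt F a).w (ι x) ≤ 1 := by
    intro m x hx
    exact hIntg m x (by rwa [hx])
  have hfc : ∀ m, (fmap q c)^[m] c = (fmap q c)^[m + 1] 0 := by
    intro m
    rw [Function.iterate_succ_apply, fmap, zero_pow hq0.ne', zero_add]
  have hlip : ∀ m x, (frPt F a).w (ι x) ≤ 1 →
      (frPt F a).w (ι ((fmap q c)^[m + 1] 0 - (fmap q c)^[m] x)) ≤ (frPt F a).w (ι (x - c)) := by
    intro m x hx
    rw [map_sub ι, ← hfc, hiter, hiter, map_sub ι, (frPt F a).w.map_sub (ι x)]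
    exact iter_sub_le _ hna q _ hwc _ _ hwc hx m
  have hle1 : ∀ x, (frPt F a).w (ι x) ≤ 1 → (frPt F a).w (ι (x - c)) ≤ 1 := by
    intro x hx
    rw [map_sub ι]
    exact (na_sub _ hna _ _).trans (max_le hx hwc)
  have hTB : ∀ m ≤ n, ∀ x, (fmap q c)^[m] x = algebraMap K Ω β → ι x ∈ (frPt F a).B := by
    intro m
    induction m with
    | zero => intro _ x hx; rw [show x = _ from hx]; exact hB β
    | succ m ih =>
      intro hm x hx
      rw [Function.iterate_succ_apply] at hx
      have h5 := ih (by omega) _ hx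
      have h6 : (ι x) ^ q = ι (fmap q c x - c) := by rw [← map_pow, fmap]; congr 1; ring
      refine frPt_root_mem k F a q hq0 _ ?_ ?_
      · rw [h6, map_sub ι]; exact sub_mem h5 hcB
      · rw [h6]
        apply le_antisymm (hle1 _ (hintT _ _ hx))
        rw [← h1 (m + 1) (by omega) hm, ← hx]
        exact hlip m _ (hintT _ _ hx)
  refine ⟨?_, ?_⟩
  · intro y hy
    induction hy using IntermediateField.adjoin_induction with
    | mem x hx => exact hTB n le_rfl x hx
    | algebraMap x => exact hB x
    | add a b _ _ h1 h2 => rw [map_add]; exact add_mem h1 h2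
    | inv a _ h => rw [map_inv₀]; exact inv_mem h
    | mul a b _ _ h1 h2 => rw [map_mul]; exact mul_mem h1 h2
  have hnN : n + 1 - N = (n - N) + 1 := by omega
  have hcomp : ∀ x, (fmap q c)^[n] x = (fmap q c)^[N] ((fmap q c)^[n - N] x) := by
    intro x
    rw [← Function.iterate_add_apply]; congr 2; omega
  have hpostγ : ∀ j ≥ 1, (fmap q c)^[j] 0 ≠ γ := by
    intro j hj h
    apply hpost (N + j) (by omega)
    rw [Function.iterate_add_apply, h, hγN]
  obtain ⟨α0, hα0, hhalf, hother⟩ := unique_half (pre q hq0 c γ (n - N))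
    (fun t => (frPt F a).w (ι (t - c))) (by
      intro t ht
      rw [mem_pre] at ht
      refine frPt_val F a (by rw [map_sub]; exact sub_mem (hTB n le_rfl t (by rw [hcomp, ht, hγN])) hcB) ?_
      rw [_root_.map_ne_zero, sub_ne_zero]
      rintro rfl
      rw [hfc] at ht
      exact hpostγ _ (by omega) ht) (by
      intro t ht
      rw [mem_pre] at ht
      exact hle1 t (hintT n t (by rw [hcomp, ht, hγN]))) (by
      rw [← h2, hnN, ← hfc, ← (pre_prod q hq0 c γ hpostγ (n - N)).1 c, map_prod, map_prod]
      refine Finset.prod_congr rfl fun t _ => ?_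
      rw [map_sub ι, map_sub ι, (frPt F a).w.map_sub])
  rw [mem_pre] at hα0
  refine ⟨α0, hα0, hhalf, fun α hα hne => ?_⟩
  by_cases hαγ : (fmap q c)^[n - N] α = γ
  · exact hother α (mem_pre.2 hαγ) hne
  · have hiα := hintT n α hα
    apply le_antisymm (hle1 _ hiα)
    have h5 := h3 ((fmap q c)^[n - N] α) (by rw [← hcomp, hα]) hαγ
    refine le_trans (le_of_eq ?_) (hlip (n - N) α hiα)
    rw [hnN] at h2
    have h6 : ι ((fmap q c)^[n - N + 1] 0 - (fmap q c)^[n - N] α) =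
        ι (γ - (fmap q c)^[n - N] α) + ι ((fmap q c)^[n - N + 1] 0 - γ) := by
      rw [← map_add]; congr 1; ring
    rw [h6, na_add_eq _ hna, h5]
    rw [h5, h2]; norm_num
end place

theorem tower_eq {K Ω : Type*} [Field K] [Field Ω] [Algebra K Ω] (q : ℕ) (hq : 0 < q) (c : K)
    (hζ : ∀ ζ : Ω, ζ ^ q = 1 → ∃ z : K, algebraMap K Ω z = ζ) (β : Ω) (n : ℕ) (x : Ω → Ω)
    (hx : ∀ α, x α ^ q + algebraMap K Ω c = α) :
    IntermediateField.adjoin K {t : Ω | (fmap q (algebraMap K Ω c))^[n + 1] t = β} =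
      IntermediateField.adjoin K {t : Ω | (fmap q (algebraMap K Ω c))^[n] t = β} ⊔
        IntermediateField.adjoin K (x '' {t : Ω | (fmap q (algebraMap K Ω c))^[n] t = β}) := by
  have hxT : ∀ α, (fmap q (algebraMap K Ω c))^[n] α = β →
      (fmap q (algebraMap K Ω c))^[n + 1] (x α) = β := by
    intro α h
    rw [Function.iterate_succ_apply, fmap, hx, h]
  apply le_antisymm
  · rw [IntermediateField.adjoin_le_iff]
    intro t ht
    have ht' : (fmap q (algebraMap K Ω c))^[n + 1] t = β := ht
    rw [Function.iterate_succ_apply] at ht'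
    set α := fmap q (algebraMap K Ω c) t with hα
    have hxm : x α ∈ IntermediateField.adjoin K (x '' {t : Ω | (fmap q (algebraMap K Ω c))^[n] t = β}) :=
      IntermediateField.subset_adjoin _ _ ⟨α, ht', rfl⟩
    have h1 : t ^ q = x α ^ q := by
      have := hx α
      have h2 : t ^ q + algebraMap K Ω c = α := rfl
      exact add_right_cancel (h2.trans this.symm)
    refine (le_sup_right : _ ≤ IntermediateField.adjoin K _ ⊔ _) ?_
    by_cases h0 : x α = 0
    · rw [h0, zero_pow hq.ne', pow_eq_zero_iff hq.ne'] at h1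
      rw [h1]; exact zero_mem _
    · obtain ⟨z, hz⟩ := hζ (t / x α) (by rw [div_pow, h1, div_self (pow_ne_zero _ h0)])
      have : t = algebraMap K Ω z * x α := by rw [hz]; field_simp
      rw [this]
      exact mul_mem (IntermediateField.algebraMap_mem _ _) hxm
  · refine sup_le ?_ ?_
    · rw [IntermediateField.adjoin_le_iff]
      intro α hα
      have h1 : x α ∈ IntermediateField.adjoin K {t : Ω | (fmap q (algebraMap K Ω c))^[n + 1] t = β} :=
        IntermediateField.subset_adjoin _ _ (hxT α hα)
      rw [← hx α]
      exact add_mem (pow_mem h1 _) (IntermediateField.algebraMap_mem _ _)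
    · rw [IntermediateField.adjoin_le_iff]
      rintro _ ⟨α, hα, rfl⟩
      exact IntermediateField.subset_adjoin _ _ (hxT α hα)

theorem aut_iter {K Ω : Type*} [Field K] [Field Ω] [Algebra K Ω] (τ : Ω ≃ₐ[K] Ω) (q : ℕ) (c : K) (m : ℕ)
    (x : Ω) : τ ((fmap q (algebraMap K Ω c))^[m] x) = (fmap q (algebraMap K Ω c))^[m] (τ x) := by
  have := fmap_map τ.toRingEquiv.toRingHom q (algebraMap K Ω c) x m
  have h2 : τ.toRingEquiv.toRingHom (algebraMap K Ω c) = algebraMap K Ω c := τ.commutes c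
  rw [h2] at this
  exact this

theorem aut_adjoin {K Ω : Type*} [Field K] [Field Ω] [Algebra K Ω] (τ : Ω ≃ₐ[K] Ω) (q : ℕ) (c β : K) (m : ℕ)
    (y : Ω) (hy : y ∈ IntermediateField.adjoin K {t : Ω | (fmap q (algebraMap K Ω c))^[m] t = algebraMap K Ω β}) :
    τ y ∈ IntermediateField.adjoin K {t : Ω | (fmap q (algebraMap K Ω c))^[m] t = algebraMap K Ω β} := by
  induction hy using IntermediateField.adjoin_induction with
  | mem x hx =>
    apply IntermediateField.subset_adjoin
    have hx' : (fmap q (algebraMap K Ω c))^[m] x = algebraMap K Ω β := hx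
    rw [Set.mem_setOf_eq, ← aut_iter, hx', τ.commutes]
  | algebraMap x => rw [τ.commutes]; exact IntermediateField.algebraMap_mem _ _
  | add a b _ _ h1 h2 => rw [map_add]; exact add_mem h1 h2
  | inv a _ h => rw [map_inv₀]; exact inv_mem h
  | mul a b _ _ h1 h2 => rw [map_mul]; exact mul_mem h1 h2

theorem conj_level {K Ω : Type*} [Field K] [Field Ω] [Algebra K Ω] (q : ℕ) (c β : K) (N : ℕ)
    (hN : ∀ n ≥ N, ∀ γ : Ω, (fmap q (algebraMap K Ω c))^[n] γ = algebraMap K Ω β →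
      NonSplit K q (algebraMap K Ω c) γ) (γ : Ω)
    (hγ : (fmap q (algebraMap K Ω c))^[N] γ = algebraMap K Ω β) (m : ℕ) :
    ∀ α1 α2, (fmap q (algebraMap K Ω c))^[m] α1 = γ → (fmap q (algebraMap K Ω c))^[m] α2 = γ →
      ∃ τ : Ω ≃ₐ[K] Ω, τ α1 = α2 := by
  induction m with
  | zero =>
    intro α1 α2 h1 h2
    exact ⟨AlgEquiv.refl, by rw [show α1 = γ from h1, show α2 = γ from h2]; rfl⟩
  | succ m ih =>
    intro α1 α2 h1 h2
    rw [Function.iterate_succ_apply] at h1 h2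
    obtain ⟨τ, hτ⟩ := ih _ _ h1 h2
    obtain ⟨τ', hτ'⟩ := hN (N + m) (by omega) (fmap q (algebraMap K Ω c) α2)
      (by rw [Function.iterate_add_apply, h2, hγ]) (τ α1) α2
      (by rw [← hτ, fmap, map_add, map_pow, τ.commutes]) rfl
    exact ⟨τ' * τ, by rw [AlgEquiv.mul_apply, hτ']⟩

theorem k_roots (k F : Type*) [Field k] [IsAlgClosed k] [CharZero k] [Field F] [Algebra k[X] F]
    {K Ω : Type*} [Field K] [Field Ω] [CharZero Ω] [Algebra F K] [Algebra K Ω] [Algebra F Ω]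
    [IsScalarTower F K Ω] (n : ℕ) (hn : 0 < n) (ζ : Ω) (h : ζ ^ n = 1) :
    ∃ z : K, algebraMap K Ω z = ζ := by
  obtain ⟨z, hz, rfl⟩ := root_unity_lift ((algebraMap F Ω).comp (kF k F)) n hn ζ h
  exact ⟨algebraMap F K (kF k F z), by rw [← IsScalarTower.algebraMap_apply F K Ω]; rfl⟩

section hard
variable (k : Type*) (F : Type u) [Field k] [CharZero k] [IsAlgClosed k] [Field F] [CharZero F]
  [Algebra k[X] F] [IsFractionRing k[X] F]
  {K Ω : Type*} [Field K] [Field Ω] [Algebra F K] [FiniteDimensional F K] [Algebra K Ω]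
  [IsAlgClosure K Ω] [Algebra F Ω] [IsScalarTower F K Ω]

theorem ext_hom (a : k) (L : IntermediateField K Ω) (σ : L →ₐ[F] (frPt F a).C) :
    ∃ ι : Ω →ₐ[F] (frPt F a).C, ∀ x : L, ι x = σ x := by
  haveI := IsAlgClosure.isAlgebraic (R := K) (K := Ω)
  haveI : Algebra.IsAlgebraic L Ω := Algebra.IsAlgebraic.tower_top (K := K) L
  letI : Algebra L (frPt F a).C := σ.toRingHom.toAlgebra
  haveI : IsScalarTower F L (frPt F a).C := IsScalarTower.of_algebraMap_eq fun x => (σ.commutes x).symm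
  haveI : IsAlgClosed (frPt F a).C := (frPt F a).closed
  haveI : IsScalarTower F L Ω := IsScalarTower.of_algebraMap_eq fun _ => rfl
  let ι : Ω →ₐ[L] (frPt F a).C := IsAlgClosed.lift
  exact ⟨ι.restrictScalars F, fun x => ι.commutes x⟩

theorem hard_indep (p r : ℕ) (hp : p.Prime) (hr : 1 ≤ r) (N : ℕ) (hN1 : 1 ≤ N) (β : K)
    (hper : ∀ n ≥ 1, (fmap (p ^ r) (algebraMap F K (cF k F)))^[n] β ≠ β)
    (hpost : ∀ n ≥ 1, (fmap (p ^ r) (algebraMap F K (cF k F)))^[n] 0 ≠ β)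
    (hN : ∀ n ≥ N - 1, ∀ γ : Ω,
      (fmap (p ^ r) (algebraMap K Ω (algebraMap F K (cF k F))))^[n] γ = algebraMap K Ω β →
      NonSplit K (p ^ r) (algebraMap K Ω (algebraMap F K (cF k F))) γ) :
    ∃ n0, ∀ n ≥ n0, ∀ (w : Ω),
      w ∈ IntermediateField.adjoin K
        {t : Ω | (fmap (p ^ r) (algebraMap K Ω (algebraMap F K (cF k F))))^[n] t = algebraMap K Ω β} →
      ∀ e : {t : Ω // (fmap (p ^ r) (algebraMap K Ω (algebraMap F K (cF k F))))^[n] t = algebraMap K Ω β} → ℕ,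
      ∀ s : Finset {t : Ω // (fmap (p ^ r) (algebraMap K Ω (algebraMap F K (cF k F))))^[n] t = algebraMap K Ω β},
      ∏ i ∈ s, (i.1 - algebraMap K Ω (algebraMap F K (cF k F))) ^ e i = w ^ p → ∀ i ∈ s, p ∣ e i := by
  classical
  have hq : 2 ≤ p ^ r := hp.two_le.trans (Nat.le_self_pow (by omega) p)
  have hq0 : 0 < p ^ r := by omega
  haveI := IsAlgClosure.isAlgebraic (R := K) (K := Ω)
  haveI : IsAlgClosed Ω := IsAlgClosure.isAlgClosed K
  haveI : CharZero Ω := charZero_of_injective_algebraMap (algebraMap F Ω).injective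
  set q := p ^ r with hqd
  set cK := algebraMap F K (cF k F) with hcK
  set c := algebraMap K Ω cK with hc
  have hcF : algebraMap F Ω (cF k F) = c := IsScalarTower.algebraMap_apply F K Ω _
  set T : Set Ω := {t : Ω | (fmap q c)^[N] t = algebraMap K Ω β} with hT
  have hTfin : T.Finite := iter_finite q hq0 c _ N
  let L := IntermediateField.adjoin K T
  haveI : FiniteDimensional K L := by
    haveI := hTfin.to_subtype
    exact IntermediateField.finiteDimensional_adjoin fun x _ => Algebra.IsIntegral.isIntegral x
  haveI : FiniteDimensional F L := FiniteDimensional.trans F K L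
  have hmap : ∀ x m, ((algebraMap K Ω) ((fmap q cK)^[m] x)) = (fmap q c)^[m] (algebraMap K Ω x) :=
    fun x m => fmap_map (algebraMap K Ω) q cK x m
  have hLc : algebraMap F L (cF k F) = algebraMap K L cK := IsScalarTower.algebraMap_apply F K L _
  have hmapL : ∀ x m, ((algebraMap K L) ((fmap q cK)^[m] x)) =
      (fmap q (algebraMap F L (cF k F)))^[m] (algebraMap K L x) := by
    intro x m
    rw [hLc]
    exact fmap_map (algebraMap K L) q cK x m
  have hmapLΩ : ∀ (x : L) m, (((fmap q (algebraMap F L (cF k F)))^[m] x : L) : Ω) = (fmap q c)^[m] (x : Ω) := by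
    intro x m
    rw [hLc]
    exact fmap_map (algebraMap L Ω) q _ x m
  have hpostΩ : ∀ n ≥ 1, (fmap q c)^[n] 0 ≠ algebraMap K Ω β := by
    intro n hn h
    apply hpost n hn
    apply (algebraMap K Ω).injective
    rw [hmap, map_zero, h]
  -- exceptional set
  let Tf := hTfin.toFinset
  obtain ⟨S1, hS1⟩ := fin_mem k F L
  obtain ⟨S2, hS2⟩ := fin_le k F (algebraMap K L β)
  obtain ⟨S3, hS3⟩ := fin_all k (Set.univ : Set (T × T)) (by
      haveI := hTfin.to_subtype
      exact Set.finite_univ)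
    (fun t a => t.1.1 ≠ t.2.1 → ∀ σ : L →ₐ[F] (frPt F a).C,
      (frPt F a).w (σ ⟨t.1.1 - t.2.1, sub_mem (IntermediateField.subset_adjoin K T t.1.2)
        (IntermediateField.subset_adjoin K T t.2.2)⟩) = 1) (by
      intro t _
      by_cases ht : t.1.1 = t.2.1
      · exact ⟨∅, fun a _ h => absurd ht h⟩
      · obtain ⟨S, hS⟩ := fin_eq k F (L := L) ⟨t.1.1 - t.2.1, sub_mem (IntermediateField.subset_adjoin K T t.1.2)
          (IntermediateField.subset_adjoin K T t.2.2)⟩ (by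
            intro h
            apply ht
            exact sub_eq_zero.1 (congrArg Subtype.val h))
        exact ⟨S, fun a ha _ => hS a ha⟩)
  have hprim : ∀ γ : T, ∃ n0, ∀ n ≥ n0, ∃ a ∉ S1 ∪ S2 ∪ S3, ∃ σ : L →ₐ[F] (frPt F a).C,
      (frPt F a).w (σ (pol k F L (aP k q (n + 1 - N)) - ⟨γ.1, IntermediateField.subset_adjoin K T γ.2⟩)) = 1/2 ∧
      ∀ i, 1 ≤ i → i ≤ n → (frPt F a).w (σ (pol k F L (aP k q i) - algebraMap K L β)) = 1 := by
    intro γ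
    refine prim_zero k F q hq N hN1 (algebraMap K L β) ⟨γ.1, IntermediateField.subset_adjoin K T γ.2⟩ ?_ ?_ ?_ ?_ _
    · apply Subtype.ext
      rw [hmapLΩ]
      exact γ.2
    · intro n hn h
      rw [← hmapL] at h
      exact hper n hn ((algebraMap K L).injective h)
    · intro n hn h
      rw [← map_zero (algebraMap K L), ← hmapL] at h
      exact hpost n hn ((algebraMap K L).injective h)
    · intro h2
      have hγ : (fmap q c)^[N] γ.1 = algebraMap K Ω β := γ.2
      have hγ' : (fmap q c)^[N - 1] (fmap q c γ.1) = algebraMap K Ω β := by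
        rw [← Function.iterate_succ_apply, show (N - 1).succ = N by omega, hγ]
      obtain ⟨τ, hτ⟩ := hN (N - 1) le_rfl _ hγ' γ.1 (-γ.1) rfl (by
        rw [fmap, h2]; ring)
      haveI : Normal K L := by
        haveI : Normal K Ω := IsAlgClosure.normal K Ω
        refine IntermediateField.normal_iff_forall_map_le'.2 fun σ => ?_
        rintro _ ⟨y, hy, rfl⟩
        exact aut_adjoin σ q cK β N y hy
      refine ⟨(τ.restrictNormal L).toAlgHom.restrictScalars F, ?_⟩
      apply Subtype.ext
      have := τ.restrictNormal_commutes L ⟨γ.1, IntermediateField.subset_adjoin K T γ.2⟩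
      exact this.trans hτ
  choose n1 hn1 using hprim
  obtain ⟨n2, hn2⟩ : ∃ n2, ∀ γ, n1 γ ≤ n2 := by
    haveI := hTfin.to_subtype
    obtain ⟨b, hb⟩ := (Set.finite_range n1).bddAbove
    exact ⟨b, fun γ => hb ⟨γ, rfl⟩⟩
  refine ⟨n2 + N, fun n hn w hw e s hprod α hα => ?_⟩
  have hcomp : ∀ x, (fmap q c)^[n] x = (fmap q c)^[N] ((fmap q c)^[n - N] x) := by
    intro x
    rw [← Function.iterate_add_apply]; congr 2; omega
  let γ : T := ⟨(fmap q c)^[n - N] α.1, by rw [hT, Set.mem_setOf_eq, ← hcomp]; exact α.2⟩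
  obtain ⟨a, ha, σ, hσ1, hσ2⟩ := hn1 γ n ((hn2 γ).trans (by omega))
  simp only [Finset.mem_union, not_or] at ha
  obtain ⟨ι, hι⟩ := ext_hom k F a L σ
  have hιK : ∀ x : K, ι (algebraMap K Ω x) = σ (algebraMap K L x) := fun x => hι (algebraMap K L x)
  have hpolΩ : ∀ i, (fmap q c)^[i] 0 = ((pol k F L (aP k q i) : L) : Ω) := by
    intro i
    rw [aP_pol, hmapLΩ]; rfl
  have hcn : ∀ t, (fmap q c)^[n] t = algebraMap K Ω β → t - c ≠ 0 := by
    intro t ht h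
    apply hpostΩ (n + 1) (by omega)
    rw [Function.iterate_succ_apply, fmap, zero_pow hq0.ne', zero_add, ← ht, sub_eq_zero.1 h]
  obtain ⟨hBn, α0, h0γ, h0half, h0other⟩ := place_indep k F (K := K) a q hq ι n N (by omega) β γ.1
    (by rw [hcF]; exact γ.2) (by rw [hcF]; exact hpostΩ)
    (fun x => by rw [hιK]; exact hS1 a ha.1.1 σ _) (by rw [hιK]; exact hS2 a ha.1.2 σ)
    (by
      intro i hi1 hi2
      rw [hcF, hpolΩ, ← hσ2 i hi1 hi2, ← hι]; rfl)
    (by rw [hcF, hpolΩ, ← hσ1, ← hι]; rfl)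
    (by
      intro γ' hγ' hne
      rw [hcF] at hγ'
      rw [← hS3 a ha.2 (γ, ⟨γ', hγ'⟩) trivial (Ne.symm hne) σ, ← hι])
  rw [hcF] at hBn h0γ h0half h0other
  obtain ⟨τ, hτ⟩ := conj_level q cK β N (fun m hm => hN m (by omega)) γ.1 γ.2 (n - N) α.1 α0 rfl h0γ
  have hτc : τ c = c := τ.commutes cK
  have hw0 : w ≠ 0 := by
    rintro rfl
    rw [zero_pow hp.ne_zero] at hprod
    exact Finset.prod_ne_zero_iff.2 (fun t _ => pow_ne_zero _ (hcn t.1 t.2)) hprod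
  have hval := congrArg (fun y => (frPt F a).w (ι (τ y))) hprod
  simp only [map_prod, map_pow] at hval
  rw [Finset.prod_eq_single_of_mem α hα] at hval
  · rw [map_sub τ, hτ, hτc, h0half] at hval
    obtain ⟨z, hz⟩ := frPt_val F a (hBn (τ w) (aut_adjoin τ q cK β n w hw))
      (by rw [_root_.map_ne_zero, _root_.map_ne_zero]; exact hw0)
    rw [hz, one_div, ← zpow_natCast, inv_zpow', ← zpow_natCast, ← zpow_mul] at hval
    have := zpow_right_injective₀ (by norm_num : (0:ℝ) < 2) (by norm_num) hval
    have h3 : (e α : ℤ) = p * (-z) := by linarith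
    exact Int.natCast_dvd_natCast.1 ⟨-z, h3⟩
  · intro t _ hne
    have h4 : (fmap q c)^[n] (τ t.1) = algebraMap K Ω β := by
      rw [← aut_iter, t.2, τ.commutes]
    have := h0other (τ t.1) h4 (by
      rw [← hτ]
      intro h
      exact hne (Subtype.ext (τ.injective h)))
    rw [map_sub τ, hτc, this, one_pow]

theorem hard_dir (p r : ℕ) (hp : p.Prime) (hr : 1 ≤ r)
    (vk : AbsoluteValue k ℝ) (hvk : IsNonarchimedean vk) (hvp : vk p < 1) (β : K)
    (hper : ∀ n ≥ 1, (fmap (p ^ r) (algebraMap F K (cF k F)))^[n] β ≠ β)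
    (hpost : ∀ n ≥ 1, (fmap (p ^ r) (algebraMap F K (cF k F)))^[n] 0 ≠ β) :
    ∃ n0, ∀ n ≥ n0, Module.finrank K (IntermediateField.adjoin K
        {t : Ω | (fmap (p ^ r) (algebraMap K Ω (algebraMap F K (cF k F))))^[n + 1] t = algebraMap K Ω β}) =
      (p ^ r) ^ ((p ^ r) ^ n) * Module.finrank K (IntermediateField.adjoin K
        {t : Ω | (fmap (p ^ r) (algebraMap K Ω (algebraMap F K (cF k F))))^[n] t = algebraMap K Ω β}) := by
  classical
  have hq : 2 ≤ p ^ r := hp.two_le.trans (Nat.le_self_pow (by omega) p)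
  have hq0 : 0 < p ^ r := by omega
  haveI := IsAlgClosure.isAlgebraic (R := K) (K := Ω)
  haveI : IsAlgClosed Ω := IsAlgClosure.isAlgClosed K
  haveI : CharZero Ω := charZero_of_injective_algebraMap (algebraMap F Ω).injective
  obtain ⟨N, hN⟩ := stable_level k F (Ω := Ω) p r hp hr vk hvk hvp β hper
  rw [IsScalarTower.algebraMap_apply F K Ω] at hN
  obtain ⟨n0, hn0⟩ := hard_indep k F (Ω := Ω) p r hp hr (N + 1) (by omega) β hper hpost
    (fun n hn => hN n (by omega))
  refine ⟨n0, fun n hn => ?_⟩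
  set q := p ^ r with hqd
  set cK := algebraMap F K (cF k F) with hcK
  have hroot : ∀ α : Ω, ∃ x : Ω, x ^ q + algebraMap K Ω cK = α := by
    intro α
    obtain ⟨x, hx⟩ := IsAlgClosed.exists_pow_nat_eq (α - algebraMap K Ω cK) hq0
    exact ⟨x, by rw [hx]; ring⟩
  choose x hx using hroot
  have hpostΩ : ∀ n ≥ 1, (fmap q (algebraMap K Ω cK))^[n] 0 ≠ algebraMap K Ω β := by
    intro n hn h
    apply hpost n hn
    apply (algebraMap K Ω).injective
    rw [fmap_map, map_zero, h]
  rw [tower_eq q hq0 cK (fun ζ h => k_roots k F q hq0 ζ h) (algebraMap K Ω β) n x hx]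
  set T := {t : Ω | (fmap q (algebraMap K Ω cK))^[n] t = algebraMap K Ω β} with hT
  have hTfin : T.Finite := iter_finite q hq0 _ _ n
  haveI : Fintype T := hTfin.fintype
  have hcard : Fintype.card T = q ^ n := by
    rw [← (pre_prod q hq0 _ _ hpostΩ n).2, pre, ← Set.toFinset_card]
    congr 1
    ext t; simp [hT]
  have := kummer_all (K := K) p r hp (fun ζ h => k_roots k F (p ^ 2) (pow_pos hp.pos _) ζ h)
    (IntermediateField.adjoin K T) (fun t : T => t.1 - algebraMap K Ω cK) ⟨?_, ?_, ?_⟩ (fun t : T => x t.1)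
    (fun t => by rw [← hqd, eq_sub_iff_add_eq]; exact hx _)
  · rw [hcard] at this
    have himg : x '' T = Set.range (fun t : T => x t.1) := by
      ext y; simp
    rw [himg]
    exact this
  · intro t
    exact sub_mem (IntermediateField.subset_adjoin _ _ t.2) (IntermediateField.algebraMap_mem _ _)
  · intro t h
    apply hpostΩ (n + 1) (by omega)
    have ht : (fmap q (algebraMap K Ω cK))^[n] t.1 = algebraMap K Ω β := t.2
    rw [Function.iterate_succ_apply, fmap, zero_pow hq0.ne', zero_add, ← ht, sub_eq_zero.1 h]
  · intro e w hw hprod i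
    exact hn0 n hn w hw e (Finset.univ : Finset T) hprod i (Finset.mem_univ i)

end hard

section easy
variable {Ω : Type*} [Field Ω] [CharZero Ω] [IsAlgClosed Ω]

theorem pre_c (q : ℕ) (hq : 0 < q) (c : Ω) : pre q hq c c 1 = {0} := by
  ext t
  rw [mem_pre]
  simp [fmap, hq.ne']

theorem pre_one_le (q : ℕ) (hq : 0 < q) (c α : Ω) : (pre q hq c α 1).card ≤ q := by
  by_cases h : α = c
  · rw [h, pre_c, Finset.card_singleton]; omega
  · exact (pre_one q hq c α h).2.le

theorem pre_succ [DecidableEq Ω] (q : ℕ) (hq : 0 < q) (c γ : Ω) (m : ℕ) :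
    pre q hq c γ (m + 1) = (pre q hq c γ m).biUnion (fun α => pre q hq c α 1) := by
  ext t
  simp [mem_pre]

theorem pre_card_succ (q : ℕ) (hq : 0 < q) (c γ : Ω) (m : ℕ) :
    (pre q hq c γ (m + 1)).card ≤ q * (pre q hq c γ m).card := by
  classical
  rw [pre_succ, mul_comm]
  exact Finset.card_biUnion_le_card_mul _ _ _ fun α _ => pre_one_le q hq c α

theorem pre_card_le (q : ℕ) (hq : 0 < q) (c γ : Ω) (m : ℕ) : (pre q hq c γ m).card ≤ q ^ m := by
  induction m with
  | zero =>
    have : pre q hq c γ 0 = {γ} := by ext t; simp [mem_pre]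
    simp [this]
  | succ m ih =>
    rw [pow_succ']
    exact (pre_card_succ q hq c γ m).trans (Nat.mul_le_mul_left _ ih)

theorem pre_card_lt (q : ℕ) (hq : 2 ≤ q) (c γ : Ω) (m : ℕ)
    (h : (fmap q c)^[m + 1] 0 = γ) (n : ℕ) (hn : m + 1 ≤ n) :
    (pre q (by omega) c γ n).card < q ^ n := by
  classical
  have hq0 : 0 < q := by omega
  obtain ⟨j, rfl⟩ := Nat.exists_eq_add_of_le hn
  induction j with
  | zero =>
    rw [add_zero, pre_succ]
    have hc : c ∈ pre q hq0 c γ m := by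
      rw [mem_pre, ← h, Function.iterate_succ_apply, fmap, zero_pow hq0.ne', zero_add]
    calc _ ≤ ∑ α ∈ pre q hq0 c γ m, (pre q hq0 c α 1).card := Finset.card_biUnion_le
      _ < ∑ α ∈ pre q hq0 c γ m, q := Finset.sum_lt_sum (fun α _ => pre_one_le q hq0 c α)
          ⟨c, hc, by rw [pre_c, Finset.card_singleton]; omega⟩
      _ = (pre q hq0 c γ m).card * q := by simp
      _ ≤ q ^ m * q := Nat.mul_le_mul_right _ (pre_card_le q hq0 c γ m)
      _ = _ := (pow_succ _ _).symm
  | succ j ih =>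
    have h1 := ih (by omega)
    rw [← add_assoc, pow_succ']
    exact (pre_card_succ q hq0 c γ _).trans_lt (Nat.mul_lt_mul_of_pos_left h1 hq0)

variable {K : Type*} [Field K] [Algebra K Ω] [Algebra.IsAlgebraic K Ω]

theorem easy_bound (q : ℕ) (hq : 0 < q) (c β : K)
    (hζ : ∀ ζ : Ω, ζ ^ q = 1 → ∃ z : K, algebraMap K Ω z = ζ) (n : ℕ) (s : Finset Ω)
    (hs : s ⊆ pre q hq (algebraMap K Ω c) (algebraMap K Ω β) n)
    (hs' : ∀ α ∈ pre q hq (algebraMap K Ω c) (algebraMap K Ω β) n, α ∉ s →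
      ∃ y : K, α = algebraMap K Ω (y ^ q + c)) :
    Module.finrank K (IntermediateField.adjoin K
        {t : Ω | (fmap q (algebraMap K Ω c))^[n + 1] t = algebraMap K Ω β}) ≤
      q ^ s.card * Module.finrank K (IntermediateField.adjoin K
        {t : Ω | (fmap q (algebraMap K Ω c))^[n] t = algebraMap K Ω β}) := by
  classical
  have hroot : ∀ α : Ω, ∃ x : Ω, x ^ q + algebraMap K Ω c = α := by
    intro α
    obtain ⟨x, hx⟩ := IsAlgClosed.exists_pow_nat_eq (α - algebraMap K Ω c) hq
    exact ⟨x, by rw [hx]; ring⟩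
  choose x hx using hroot
  rw [tower_eq q hq c hζ (algebraMap K Ω β) n x hx]
  set T := {t : Ω | (fmap q (algebraMap K Ω c))^[n] t = algebraMap K Ω β} with hT
  have heq : IntermediateField.adjoin K T ⊔ IntermediateField.adjoin K (x '' T) =
      IntermediateField.adjoin K T ⊔ IntermediateField.adjoin K (x '' (s : Set Ω)) := by
    apply le_antisymm
    · refine sup_le le_sup_left ?_
      rw [IntermediateField.adjoin_le_iff]
      rintro _ ⟨α, hα, rfl⟩
      by_cases h : α ∈ s
      · exact (le_sup_right : _ ≤ IntermediateField.adjoin K T ⊔ _)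
          (IntermediateField.subset_adjoin _ _ ⟨α, h, rfl⟩)
      · obtain ⟨y, hy⟩ := hs' α (mem_pre.2 hα) h
        have h1 : x α ^ q = algebraMap K Ω y ^ q := by
          have := hx α
          have h2 : algebraMap K Ω y ^ q + algebraMap K Ω c = α := by rw [hy]; simp
          exact add_right_cancel (this.trans h2.symm)
        by_cases h0 : algebraMap K Ω y = 0
        · rw [h0, zero_pow hq.ne', pow_eq_zero_iff hq.ne'] at h1
          rw [h1]; exact zero_mem _
        · obtain ⟨z, hz⟩ := hζ (x α / algebraMap K Ω y) (by rw [div_pow, h1, div_self (pow_ne_zero _ h0)])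
          have : x α = algebraMap K Ω (z * y) := by rw [map_mul, hz]; field_simp
          rw [this]
          exact IntermediateField.algebraMap_mem _ _
    · refine sup_le_sup_left (IntermediateField.adjoin.mono _ _ _ (Set.image_mono ?_)) _
      intro t ht
      exact mem_pre.1 (hs ht)
  rw [heq]
  refine kummer_upper q hq s (IntermediateField.adjoin K T) x fun α hα => ?_
  have : x α ^ q = α - algebraMap K Ω c := by rw [eq_sub_iff_add_eq, hx]
  rw [this]
  exact sub_mem (IntermediateField.subset_adjoin _ _ (mem_pre.1 (hs hα))) (IntermediateField.algebraMap_mem _ _)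

theorem easy_dir (q : ℕ) (hq : 2 ≤ q) (c β : K)
    (hζ : ∀ ζ : Ω, ζ ^ q = 1 → ∃ z : K, algebraMap K Ω z = ζ) (N : ℕ)
    (hN : ∀ n ≥ N, Module.finrank K (IntermediateField.adjoin K
        {t : Ω | (fmap q (algebraMap K Ω c))^[n + 1] t = algebraMap K Ω β}) =
      q ^ q ^ n * Module.finrank K (IntermediateField.adjoin K
        {t : Ω | (fmap q (algebraMap K Ω c))^[n] t = algebraMap K Ω β})) :
    (∀ n ≥ 1, (fmap q c)^[n] β ≠ β) ∧ (∀ n ≥ 1, (fmap q c)^[n] 0 ≠ β) := by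
  classical
  have hq0 : 0 < q := by omega
  have key : ∀ n ≥ N, ∀ s : Finset Ω, s ⊆ pre q hq0 (algebraMap K Ω c) (algebraMap K Ω β) n →
    (∀ α ∈ pre q hq0 (algebraMap K Ω c) (algebraMap K Ω β) n, α ∉ s →
      ∃ y : K, α = algebraMap K Ω (y ^ q + c)) → q ^ n ≤ s.card := by
    intro n hn s hs hs'
    have h1 := easy_bound q hq0 c β hζ n s hs hs'
    rw [hN n hn] at h1
    have hpos : 0 < Module.finrank K (IntermediateField.adjoin K
        {t : Ω | (fmap q (algebraMap K Ω c))^[n] t = algebraMap K Ω β}) := by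
      haveI := (iter_finite q hq0 (algebraMap K Ω c) (algebraMap K Ω β) n).to_subtype
      haveI : FiniteDimensional K (IntermediateField.adjoin K
        {t : Ω | (fmap q (algebraMap K Ω c))^[n] t = algebraMap K Ω β}) :=
        IntermediateField.finiteDimensional_adjoin fun x _ => Algebra.IsIntegral.isIntegral x
      exact Module.finrank_pos
    have h2 := Nat.le_of_mul_le_mul_right h1 hpos
    exact (Nat.pow_le_pow_iff_right (by omega)).1 h2
  constructor
  · intro m hm h
    obtain ⟨m, rfl⟩ : ∃ j, m = j + 1 := ⟨m - 1, by omega⟩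
    have hper : (fmap q c)^[(m + 1) * N] β = β := by
      rw [Function.iterate_mul]
      exact Function.iterate_fixed h N
    have hβ : algebraMap K Ω β ∈ pre q hq0 (algebraMap K Ω c) (algebraMap K Ω β) ((m + 1) * N) := by
      rw [mem_pre, ← fmap_map, hper]
    have h1 := key ((m + 1) * N) (by nlinarith) ((pre q hq0 _ _ _).erase (algebraMap K Ω β))
      (Finset.erase_subset _ _) (by
        intro α hα hne
        have : α = algebraMap K Ω β := by
          by_contra h2
          exact hne (Finset.mem_erase.2 ⟨h2, hα⟩)
        refine ⟨(fmap q c)^[m] β, ?_⟩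
        rw [this]
        congr 1
        rw [Function.iterate_succ_apply'] at h
        exact h.symm)
    have h2 := Finset.card_erase_lt_of_mem hβ
    have h3 := pre_card_le q hq0 (algebraMap K Ω c) (algebraMap K Ω β) ((m + 1) * N)
    omega
  · intro m hm h
    obtain ⟨m, rfl⟩ : ∃ j, m = j + 1 := ⟨m - 1, by omega⟩
    have h1 := key (N + (m + 1)) (by omega) _ subset_rfl (fun α hα hne => absurd hα hne)
    have h2 := pre_card_lt q hq (algebraMap K Ω c) (algebraMap K Ω β) m
      (by rw [← h, fmap_map, map_zero]) (N + (m + 1)) (by omega)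
    omega
end easy

theorem polyIter_eval {K : Type*} [Field K] (q : ℕ) (c x : K) (n : ℕ) :
    (polyIter (X ^ q + C c) n).eval x = (fmap q c)^[n] x := by
  induction n with
  | zero => simp [polyIter]
  | succ n ih => rw [polyIter, eval_comp, ih, Function.iterate_succ_apply']; simp [fmap]

theorem polyIter_aeval {K Ω : Type*} [Field K] [Field Ω] [Algebra K Ω] (q : ℕ) (c : K) (x : Ω)
    (n : ℕ) : aeval x (polyIter (X ^ q + C c) n) = (fmap q (algebraMap K Ω c))^[n] x := by
  induction n with
  | zero => simp [polyIter]
  | succ n ih => rw [polyIter, aeval_comp, ih, Function.iterate_succ_apply']; simp [fmap]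

theorem exists_padic (p : ℕ) (hp : p.Prime) : ∃ v : AbsoluteValue (AlgebraicClosure ℚ) ℝ,
    IsNonarchimedean v ∧ v p < 1 := by
  haveI : Fact p.Prime := ⟨hp⟩
  haveI : Algebra.IsAlgebraic ℚ (AlgebraicClosure ℚ) := by
    have e : (DivisionRing.toRatAlgebra : Algebra ℚ (AlgebraicClosure ℚ)) =
      AlgebraicClosure.instAlgebra ℚ := Subsingleton.elim _ _
    have h := AlgebraicClosure.isAlgebraic ℚ
    rw [← e] at h
    exact h
  let φ : AlgebraicClosure ℚ →ₐ[ℚ] PadicAlgCl p := IsAlgClosed.lift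
  refine ⟨⟨⟨fun x => ‖φ x‖, fun x y => by simp⟩, fun x => norm_nonneg _, fun x => by simp,
    fun x y => by simpa using norm_add_le (φ x) (φ y)⟩, fun x y => ?_, ?_⟩
  · change ‖φ (x + y)‖ ≤ max ‖φ x‖ ‖φ y‖
    rw [map_add]
    exact PadicAlgCl.isNonarchimedean p _ _
  · change ‖φ (p : AlgebraicClosure ℚ)‖ < 1
    rw [map_natCast, ← PadicAlgCl.valuation_coe, PadicAlgCl.valuation_p]
    have : (1 : ℝ) < p := by exact_mod_cast hp.one_lt
    push_cast
    rw [div_lt_one (by linarith)]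
    exact this

theorem trdeg_frac (k F : Type*) [Field k] [Field F] [Algebra k[X] F] [IsFractionRing k[X] F]
    [Algebra k F] [IsScalarTower k k[X] F] : Algebra.trdeg k F = 1 := by
  have h := lift_trdeg_add_eq k k[X] F
  haveI : Algebra.IsAlgebraic k[X] F := IsLocalization.isAlgebraic F (nonZeroDivisors k[X])
  rw [Polynomial.trdeg_of_isDomain, trdeg_eq_zero] at h
  simpa using h.symm

theorem fin_of_trans (k F K : Type*) [Field k] [Field F] [Field K] [Algebra (RatFunc k) K]
    [FiniteDimensional (RatFunc k) K] [Algebra k K] [IsScalarTower k (RatFunc k) K]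
    [Algebra k[X] F] [IsFractionRing k[X] F] [Algebra k F] [IsScalarTower k k[X] F]
    [Algebra F K] [IsScalarTower k F K] : FiniteDimensional F K := by
  have h1 := lift_trdeg_add_eq k (RatFunc k) K
  rw [trdeg_frac k (RatFunc k), trdeg_eq_zero] at h1
  have h2 := lift_trdeg_add_eq k F K
  rw [trdeg_frac k F] at h2
  have h1' : Algebra.trdeg k K = 1 := by simpa using h1.symm
  rw [h1'] at h2
  have h3 : Algebra.trdeg F K = 0 := by
    simp only [Cardinal.lift_one] at h2
    have := Cardinal.eq_of_add_eq_add_left (h2.trans (add_zero 1).symm) Cardinal.one_lt_aleph0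
    simpa using this
  haveI : Algebra.IsAlgebraic F K := trdeg_eq_zero_iff.1 h3
  haveI : Algebra.EssFiniteType k[X] (RatFunc k) :=
    Algebra.EssFiniteType.of_isLocalization _ (nonZeroDivisors k[X])
  haveI : Algebra.EssFiniteType k (RatFunc k) := Algebra.EssFiniteType.comp k k[X] (RatFunc k)
  haveI : Algebra.EssFiniteType k K := Algebra.EssFiniteType.comp k (RatFunc k) K
  haveI : Algebra.EssFiniteType F K := Algebra.EssFiniteType.of_comp k F K
  exact Algebra.finite_of_essFiniteType_of_isAlgebraic

theorem final_hard (k K Ω : Type*) [Field k] [CharZero k] [IsAlgClosed k] [Field K] [Field Ω]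
    [Algebra (RatFunc k) K] [FiniteDimensional (RatFunc k) K] [Algebra K Ω] [IsAlgClosure K Ω]
    (p r : ℕ) (hp : p.Prime) (hr : 1 ≤ r)
    (vk : AbsoluteValue k ℝ) (hvk : IsNonarchimedean vk) (hvp : vk p < 1) (c β : K)
    (hc : c ∉ Set.range fun a : k => algebraMap (RatFunc k) K (RatFunc.C a))
    (hper : ∀ n ≥ 1, (fmap (p ^ r) c)^[n] β ≠ β)
    (hpost : ∀ n ≥ 1, (fmap (p ^ r) c)^[n] 0 ≠ β) :
    ∃ n0, ∀ n ≥ n0, Module.finrank K (IntermediateField.adjoin K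
        {t : Ω | (fmap (p ^ r) (algebraMap K Ω c))^[n + 1] t = algebraMap K Ω β}) =
      (p ^ r) ^ ((p ^ r) ^ n) * Module.finrank K (IntermediateField.adjoin K
        {t : Ω | (fmap (p ^ r) (algebraMap K Ω c))^[n] t = algebraMap K Ω β}) := by
  letI : Algebra k K := ((algebraMap (RatFunc k) K).comp (algebraMap k (RatFunc k))).toAlgebra
  haveI : IsScalarTower k (RatFunc k) K := IsScalarTower.of_algebraMap_eq fun _ => rfl
  have htr : Transcendental k c := by
    intro h
    haveI : Algebra.IsAlgebraic k (IntermediateField.adjoin k {c}) :=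
      IntermediateField.isAlgebraic_adjoin_simple h.isIntegral
    have hb := IntermediateField.eq_bot_of_isAlgClosed_of_isAlgebraic (IntermediateField.adjoin k {c})
    have hm := IntermediateField.mem_adjoin_simple_self k c
    rw [hb, IntermediateField.mem_bot] at hm
    obtain ⟨a, ha⟩ := hm
    exact hc ⟨a, ha⟩
  have hinj : Function.Injective (aeval (R := k) c) := transcendental_iff_injective.1 htr
  let F := FractionRing k[X]
  haveI : CharZero F := charZero_of_injective_algebraMap (algebraMap k F).injective
  let φ : F →+* K := IsFractionRing.lift (A := k[X]) (g := (aeval (R := k) c).toRingHom) hinj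
  have hφ : ∀ x : k[X], φ (algebraMap k[X] F x) = aeval c x := fun x =>
    IsFractionRing.lift_algebraMap hinj x
  letI : Algebra F K := φ.toAlgebra
  letI : Algebra F Ω := ((algebraMap K Ω).comp φ).toAlgebra
  haveI : IsScalarTower F K Ω := IsScalarTower.of_algebraMap_eq fun _ => rfl
  haveI : IsScalarTower k F K := IsScalarTower.of_algebraMap_eq fun x => by
    rw [IsScalarTower.algebraMap_apply k k[X] F]
    exact ((hφ _).trans (by simp)).symm
  haveI : FiniteDimensional F K := fin_of_trans k F K
  have hcF : algebraMap F K (cF k F) = c := (hφ X).trans (by simp)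
  have := hard_dir k F (Ω := Ω) p r hp hr vk hvk hvp β (by rwa [hcF]) (by rwa [hcF])
  rwa [hcF] at this

/-- for `f = X^q + c` with `q = p^r` a prime power and `c` non-constant in a
function field `K` over `Qbar`, the point `β` is neither periodic nor postcritical for `f`
iff the tower degrees `[K_n(β) : K_{n-1}(β)]` are eventually maximal, equal to `q^(q^(n-1))`. -/
theorem stmt_0 (p r : ℕ) (hp : p.Prime) (hr : 1 ≤ r)
    (K : Type*) [Field K] [Algebra (RatFunc (AlgebraicClosure ℚ)) K]
    [FunctionField (AlgebraicClosure ℚ) K]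
    (Ω : Type*) [Field Ω] [Algebra K Ω] [IsAlgClosure K Ω]
    (c : K)
    (hc : c ∉ Set.range fun a : AlgebraicClosure ℚ =>
      algebraMap (RatFunc (AlgebraicClosure ℚ)) K (RatFunc.C a))
    (f : K[X]) (hf : f = X ^ (p ^ r) + C c) (β : K) :
    ((¬ ∃ n : ℕ, 1 ≤ n ∧ (polyIter f n).eval β = β) ∧
      (¬ ∃ n : ℕ, 1 ≤ n ∧ (polyIter f n).eval 0 = β)) ↔
    (∃ N : ℕ, ∀ n : ℕ, N ≤ n → 1 ≤ n →
      Module.finrank K (preimField K Ω f β n) =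
        (p ^ r) ^ ((p ^ r) ^ (n - 1)) * Module.finrank K (preimField K Ω f β (n - 1))) := by
  have hq : 2 ≤ p ^ r := hp.two_le.trans (Nat.le_self_pow (by omega) p)
  have hpre : ∀ n, preimField K Ω f β n = IntermediateField.adjoin K
      {t : Ω | (fmap (p ^ r) (algebraMap K Ω c))^[n] t = algebraMap K Ω β} := by
    intro n
    simp only [preimField, hf, polyIter_aeval]
  have hfr : ∀ n, Module.finrank K (preimField K Ω f β n) =
      Module.finrank K (IntermediateField.adjoin K
        {t : Ω | (fmap (p ^ r) (algebraMap K Ω c))^[n] t = algebraMap K Ω β}) := by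
    intro n; rw [hpre]
  have hev : ∀ n x, (polyIter f n).eval x = (fmap (p ^ r) c)^[n] x := by
    intro n x
    rw [hf, polyIter_eval]
  simp only [hfr, hev]
  haveI : IsAlgClosed Ω := IsAlgClosure.isAlgClosed K
  haveI := IsAlgClosure.isAlgebraic (R := K) (K := Ω)
  let ψ : AlgebraicClosure ℚ →+* K :=
    (algebraMap (RatFunc (AlgebraicClosure ℚ)) K).comp RatFunc.C
  haveI : CharZero Ω := charZero_of_injective_ringHom ((algebraMap K Ω).comp ψ).injective
  constructor
  · rintro ⟨h1, h2⟩
    obtain ⟨v, hv, hvp⟩ := exists_padic p hp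
    obtain ⟨n0, hn0⟩ := final_hard (AlgebraicClosure ℚ) K Ω p r hp hr v hv hvp c β hc
      (fun n hn h => h1 ⟨n, hn, h⟩) (fun n hn h => h2 ⟨n, hn, h⟩)
    refine ⟨n0 + 1, fun n hn h1n => ?_⟩
    obtain ⟨m, rfl⟩ := Nat.exists_eq_add_of_le' h1n
    exact hn0 m (by omega)
  · rintro ⟨N, hN⟩
    obtain ⟨h1, h2⟩ := easy_dir (Ω := Ω) (p ^ r) hq c β (fun ζ h => by
      obtain ⟨z, hz, rfl⟩ := root_unity_lift ((algebraMap K Ω).comp ψ) (p ^ r) (by omega) ζ h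
      exact ⟨ψ z, rfl⟩) N (fun n hn => by
        have h := hN (n + 1) (Nat.le_succ_of_le hn) (Nat.succ_pos n)
        rwa [Nat.add_sub_cancel] at h)
    exact ⟨fun ⟨n, hn, h⟩ => h1 n hn h, fun ⟨n, hn, h⟩ => h2 n hn h⟩
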